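/- arXiv:1201.4892 — 5 statements merged into one kernel-verified Lean document; each statement's English description precedes it below -/
import Mathlib

section
/- Let B1 and B2 be unital C*-subalgebras of M_N such that B1 is *-isomorphic to M_{k1} and B2 is *-isomorphic to M_{k2}, and let k = gcd(k1, k2). Let B be a unital C*-subalgebra of B1 and suppose there exists a unitary u ∈ U(M_N) with u*Bu ⊆ B2. Then there exists an injective unital *-homomorphism from B into M_k. -/
noncomputable section

abbrev MatN (N : ℕ) := Matrix (Fin N) (Fin N) ℂ

namespace GcdEmb
open Module

section hom
variable {A : Type} [Ring A] [Algebra ℂ A]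

lemma finite_hom (S V : Type) [AddCommGroup S] [Module ℂ S] [Module A S] [IsScalarTower ℂ A S]
    [AddCommGroup V] [Module ℂ V] [Module A V] [IsScalarTower ℂ A V]
    [FiniteDimensional ℂ S] [FiniteDimensional ℂ V] : FiniteDimensional ℂ (S →ₗ[A] V) :=
  FiniteDimensional.of_injective (LinearMap.restrictScalarsₗ ℂ A S V ℂ)
    (LinearMap.restrictScalars_injective ℂ)

/-- Postcomposition with an equivalence, as a `ℂ`-linear equivalence of Hom spaces. -/
lemma finrank_hom_congr (S : Type) {V V' : Type} [AddCommGroup S] [Module ℂ S] [Module A S]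
    [IsScalarTower ℂ A S]
    [AddCommGroup V] [Module ℂ V] [Module A V] [IsScalarTower ℂ A V]
    [AddCommGroup V'] [Module ℂ V'] [Module A V'] [IsScalarTower ℂ A V']
    (e : V ≃ₗ[A] V') : finrank ℂ (S →ₗ[A] V) = finrank ℂ (S →ₗ[A] V') := by
  have key : ∀ {X Y : Type} [AddCommGroup X] [Module ℂ X] [Module A X] [IsScalarTower ℂ A X]
      [AddCommGroup Y] [Module ℂ Y] [Module A Y] [IsScalarTower ℂ A Y] (e : X ≃ₗ[A] Y)
      (c : ℂ) (x : X), e (c • x) = c • e x := by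
    intro X Y _ _ _ _ _ _ _ _ e c x
    rw [← algebraMap_smul A c x, map_smul, algebraMap_smul]
  refine LinearEquiv.finrank_eq
    { toFun := fun f => e.toLinearMap ∘ₗ f
      invFun := fun f => e.symm.toLinearMap ∘ₗ f
      map_add' := fun f g => by ext; simp
      map_smul' := fun c f => by ext x; simpa using key e c (f x)
      left_inv := fun f => by ext; simp
      right_inv := fun f => by ext; simp }

lemma finrank_hom_pi (S V : Type) [AddCommGroup S] [Module ℂ S] [Module A S] [IsScalarTower ℂ A S]
    [AddCommGroup V] [Module ℂ V] [Module A V] [IsScalarTower ℂ A V]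
    [FiniteDimensional ℂ S] [FiniteDimensional ℂ V] (m : ℕ) :
    finrank ℂ (S →ₗ[A] (Fin m → V)) = m * finrank ℂ (S →ₗ[A] V) := by
  have := finite_hom (A := A) S V
  have e : (S →ₗ[A] (Fin m → V)) ≃ₗ[ℂ] (Fin m → (S →ₗ[A] V)) :=
    { toFun := fun f i => LinearMap.proj i ∘ₗ f
      invFun := fun g => LinearMap.pi g
      map_add' := fun f g => by ext; simp
      map_smul' := fun c f => by ext; simp
      left_inv := fun f => by ext; simp
      right_inv := fun f => by ext; simp }
  rw [e.finrank_eq, finrank_pi_fintype]; simp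

lemma finrank_hom_prod (S V V' : Type) [AddCommGroup S] [Module ℂ S] [Module A S]
    [IsScalarTower ℂ A S]
    [AddCommGroup V] [Module ℂ V] [Module A V] [IsScalarTower ℂ A V]
    [AddCommGroup V'] [Module ℂ V'] [Module A V'] [IsScalarTower ℂ A V']
    [FiniteDimensional ℂ S] [FiniteDimensional ℂ V] [FiniteDimensional ℂ V'] :
    finrank ℂ (S →ₗ[A] (V × V')) = finrank ℂ (S →ₗ[A] V) + finrank ℂ (S →ₗ[A] V') := by
  have := finite_hom (A := A) S V
  have := finite_hom (A := A) S V'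
  rw [← (LinearMap.prodEquiv (R := A) (M := S) (M₂ := V) (M₃ := V') ℂ).finrank_eq, finrank_prod]

lemma schur (S : Type) [AddCommGroup S] [Module ℂ S] [Module A S] [IsScalarTower ℂ A S]
    [FiniteDimensional ℂ S] [IsSimpleModule A S] : finrank ℂ (S →ₗ[A] S) = 1 := by
  have h := IsSimpleModule.algebraMap_end_bijective_of_isAlgClosed ℂ (A := A) (V := S)
  have := (LinearEquiv.ofBijective (Algebra.linearMap ℂ (End A S)) h).finrank_eq
  simpa using this.symm

lemma finite_sub (V : Type) [AddCommGroup V] [Module ℂ V] [Module A V] [IsScalarTower ℂ A V]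
    [FiniteDimensional ℂ V] (W : Submodule A V) : FiniteDimensional ℂ W :=
  inferInstanceAs (FiniteDimensional ℂ (W.restrictScalars ℂ))

attribute [local instance] finite_sub

lemma split (S V : Type) [AddCommGroup S] [Module ℂ S] [Module A S] [IsScalarTower ℂ A S]
    [AddCommGroup V] [Module ℂ V] [Module A V] [IsScalarTower ℂ A V]
    [FiniteDimensional ℂ S] [FiniteDimensional ℂ V] [IsSimpleModule A S] [IsSemisimpleModule A V]
    (m : ℕ) (hm : m ≤ finrank ℂ (S →ₗ[A] V)) :
    ∃ V' : Submodule A V, Nonempty (V ≃ₗ[A] (Fin m → S) × V') := by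
  induction m with
  | zero =>
    exact ⟨⊤, ⟨Submodule.topEquiv.symm.trans (LinearEquiv.uniqueProd (R := A)
      (M := (⊤ : Submodule A V)) (M₂ := Fin 0 → S)).symm⟩⟩
  | succ m ih =>
    obtain ⟨V', ⟨e⟩⟩ := ih (by omega)
    have h1 := finrank_hom_congr S e
    rw [finrank_hom_prod, finrank_hom_pi, schur] at h1
    have h2 : 0 < finrank ℂ (S →ₗ[A] V') := by omega
    have := finite_hom (A := A) S V'
    obtain ⟨f, hf⟩ := Module.finrank_pos_iff_exists_ne_zero.mp h2
    have hinj := LinearMap.injective_of_ne_zero hf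
    obtain ⟨C, hC⟩ := exists_isCompl (LinearMap.range f)
    refine ⟨C.map V'.subtype, ⟨?_⟩⟩
    have e1 : V' ≃ₗ[A] S × (C.map V'.subtype) :=
      (Submodule.prodEquivOfIsCompl _ _ hC).symm.trans
        (LinearEquiv.prodCongr (LinearEquiv.ofInjective f hinj).symm
          (Submodule.equivSubtypeMap V' C))
    have e2 : (Fin (m+1) → S) ≃ₗ[A] S × (Fin m → S) :=
      (Fin.consLinearEquiv A (fun _ : Fin (m+1) => S)).symm
    exact e.trans ((LinearEquiv.prodCongr (LinearEquiv.refl A _) e1).trans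
      ((LinearEquiv.prodAssoc A _ _ _).symm.trans
        (LinearEquiv.prodCongr ((LinearEquiv.prodComm A _ _).trans e2.symm)
          (LinearEquiv.refl A _))))

lemma root (r : ℕ) (hr : 0 < r) (n : ℕ) : ∀ (V : Type) [AddCommGroup V] [Module ℂ V] [Module A V]
    [IsScalarTower ℂ A V] [FiniteDimensional ℂ V] [IsSemisimpleModule A V],
    finrank ℂ V ≤ n →
    (∀ (S : Type) [AddCommGroup S] [Module ℂ S] [Module A S] [IsScalarTower ℂ A S]
      [FiniteDimensional ℂ S] [IsSimpleModule A S], r ∣ finrank ℂ (S →ₗ[A] V)) →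
    ∃ W : Submodule A V, Nonempty (V ≃ₗ[A] (Fin r → W)) := by
  have resc : ∀ {X Y : Type} [AddCommGroup X] [Module ℂ X] [Module A X] [IsScalarTower ℂ A X]
      [AddCommGroup Y] [Module ℂ Y] [Module A Y] [IsScalarTower ℂ A Y] (e : X ≃ₗ[A] Y),
      finrank ℂ X = finrank ℂ Y := by
    intro X Y _ _ _ _ _ _ _ _ e
    exact (e.restrictScalars ℂ).finrank_eq
  induction n with
  | zero =>
    intro V _ _ _ _ _ _ hV _
    have : Subsingleton V := (Module.finrank_zero_iff (R := ℂ)).mp (by omega)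
    exact ⟨⊥, ⟨0, 0, fun _ => Subsingleton.elim _ _, fun _ => Subsingleton.elim _ _⟩⟩
  | succ n ih =>
    intro V _ _ _ _ _ _ hV hdvd
    by_cases hs : Subsingleton V
    · exact ⟨⊥, ⟨0, 0, fun _ => Subsingleton.elim _ _, fun _ => Subsingleton.elim _ _⟩⟩
    have : Nontrivial V := not_subsingleton_iff_nontrivial.mp hs
    obtain ⟨S, hS⟩ := IsSemisimpleModule.exists_simple_submodule A V
    have hpos : 0 < finrank ℂ (S →ₗ[A] V) := by
      have := finite_hom (A := A) S V
      refine Module.finrank_pos_iff_exists_ne_zero.mpr ⟨S.subtype, fun h => ?_⟩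
      have := IsSimpleModule.nontrivial A S
      obtain ⟨x, hx⟩ := exists_ne (0 : S)
      exact hx (Subtype.ext (by simpa using LinearMap.congr_fun h x))
    obtain ⟨V', ⟨e⟩⟩ := split S V r (Nat.le_of_dvd hpos (hdvd S))
    have hSpos : 0 < finrank ℂ S := by
      have := IsSimpleModule.nontrivial A S
      exact Module.finrank_pos
    have hdim := resc e
    rw [finrank_prod, finrank_pi_fintype] at hdim
    simp only [Finset.sum_const, Finset.card_univ, Fintype.card_fin, smul_eq_mul] at hdim
    have := Nat.mul_pos hr hSpos
    obtain ⟨W', ⟨e'⟩⟩ := ih V' (by omega) (by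
      intro T _ _ _ _ _ _
      have h1 := hdvd T
      rw [finrank_hom_congr T e, finrank_hom_prod, finrank_hom_pi] at h1
      exact (Nat.dvd_add_right (dvd_mul_right _ _)).mp h1)
    have e2 : V ≃ₗ[A] (Fin r → (S × W')) := e.trans ((LinearEquiv.prodCongr
      (LinearEquiv.refl A _) e').trans
        { toFun := fun p i => (p.1 i, p.2 i)
          invFun := fun q => (fun i => (q i).1, fun i => (q i).2)
          map_add' := fun _ _ => rfl
          map_smul' := fun _ _ => rfl
          left_inv := fun _ => rfl
          right_inv := fun _ => rfl })
    let j : (S × W') →ₗ[A] V := e2.symm.toLinearMap ∘ₗ LinearMap.single A (fun _ => S × W') ⟨0, hr⟩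
    have hj : Function.Injective j :=
      e2.symm.injective.comp (Pi.single_injective (M := fun _ : Fin r => S × W') ⟨0, hr⟩)
    exact ⟨LinearMap.range j, ⟨e2.trans
      (LinearEquiv.piCongrRight fun _ => LinearEquiv.ofInjective j hj)⟩⟩

end hom

section rep
variable {A : Type} [Ring A] [Algebra ℂ A]

/-- The module attached to a matrix representation. -/
def RepMod {n : ℕ} (_ρ : A →ₐ[ℂ] MatN n) : Type := EuclideanSpace ℂ (Fin n)

variable {n : ℕ} (ρ : A →ₐ[ℂ] MatN n)

instance : AddCommGroup (RepMod ρ) := inferInstanceAs (AddCommGroup (EuclideanSpace ℂ (Fin n)))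
instance : Module ℂ (RepMod ρ) := inferInstanceAs (Module ℂ (EuclideanSpace ℂ (Fin n)))
instance : FiniteDimensional ℂ (RepMod ρ) :=
  inferInstanceAs (FiniteDimensional ℂ (EuclideanSpace ℂ (Fin n)))

instance : Module A (RepMod ρ) where
  smul a v := (Matrix.toEuclideanCLM (𝕜 := ℂ) (ρ a) (v : EuclideanSpace ℂ (Fin n)) :)
  one_smul v := by
    change Matrix.toEuclideanCLM (𝕜 := ℂ) (ρ 1) _ = _
    rw [map_one, map_one]; rfl
  mul_smul a b v := by
    change Matrix.toEuclideanCLM (𝕜 := ℂ) (ρ (a * b)) _ = Matrix.toEuclideanCLM (𝕜 := ℂ) (ρ a)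
      (Matrix.toEuclideanCLM (𝕜 := ℂ) (ρ b) _)
    rw [map_mul, map_mul]; rfl
  smul_zero a := map_zero (Matrix.toEuclideanCLM (𝕜 := ℂ) (ρ a))
  smul_add a v w := map_add (Matrix.toEuclideanCLM (𝕜 := ℂ) (ρ a)) v w
  add_smul a b v := by
    change Matrix.toEuclideanCLM (𝕜 := ℂ) (ρ (a + b)) _ = Matrix.toEuclideanCLM (𝕜 := ℂ) (ρ a) _ +
      Matrix.toEuclideanCLM (𝕜 := ℂ) (ρ b) _
    rw [map_add, map_add]; rfl
  zero_smul v := by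
    change Matrix.toEuclideanCLM (𝕜 := ℂ) (ρ 0) _ = _
    rw [map_zero, map_zero]; rfl

lemma smul_def (a : A) (v : RepMod ρ) :
    a • v = (Matrix.toEuclideanCLM (𝕜 := ℂ) (ρ a) (v : EuclideanSpace ℂ (Fin n)) :) := rfl

instance : IsScalarTower ℂ A (RepMod ρ) where
  smul_assoc c a v := by
    change Matrix.toEuclideanCLM (𝕜 := ℂ) (ρ (c • a)) _ = c • Matrix.toEuclideanCLM (𝕜 := ℂ) (ρ a) _
    rw [map_smul, map_smul]; rfl

/-- every unital representation of `M_k` is a multiple of the standard one -/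
lemma amplify {k N : ℕ} (hk : 0 < k) (f : MatN k →ₐ[ℂ] MatN N) (σ : A →ₐ[ℂ] MatN k) :
    ∃ m : ℕ, Nonempty (RepMod (f.comp σ) ≃ₗ[A] (Fin m → RepMod σ)) := by
  let E := EuclideanSpace ℂ (Fin N)
  let F : MatN k →ₐ[ℂ] (E →L[ℂ] E) :=
    ((Matrix.toEuclideanCLM (n := Fin N) (𝕜 := ℂ)).toAlgEquiv : MatN N →ₐ[ℂ] (E →L[ℂ] E)).comp f
  let o : Fin k := ⟨0, hk⟩
  let G : Fin k → Fin k → MatN k := fun i j => Matrix.single i j 1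
  have FF : ∀ x y v, F x (F y v) = F (x * y) v := fun x y v => by rw [map_mul]; rfl
  have GG : ∀ i j l, G i j * G j l = G i l := fun i j l => by simp [G]
  have GG0 : ∀ i j j' l, j ≠ j' → G i j * G j' l = 0 := fun i j j' l h => by
    simp [G, h]
  let P : Submodule ℂ E := LinearMap.range (F (G o o)).toLinearMap
  let b := Module.finBasis ℂ P
  have mem : ∀ j v, F (G o j) v ∈ P := fun j v => ⟨F (G o j) v, by
    change F (G o o) (F (G o j) v) = _
    rw [FF, GG]⟩
  have memP : ∀ p : P, F (G o o) p = p := by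
    rintro ⟨_, ⟨v, rfl⟩⟩
    change F (G o o) (F (G o o) v) = F (G o o) v
    rw [FF, GG]
  let q : Fin k → E →ₗ[ℂ] P := fun j => (F (G o j)).toLinearMap.codRestrict P (mem j)
  have hq : ∀ j v, (q j v : E) = F (G o j) v := fun j v => rfl
  have hone : ∑ j, G j j = 1 := by
    ext a c
    simp only [G, Matrix.sum_apply, Matrix.single_apply, Matrix.one_apply]
    by_cases h : a = c
    · subst h; simp
    · rw [if_neg h]; apply Finset.sum_eq_zero; intro x _; rw [if_neg]; rintro ⟨rfl, rfl⟩; exact h rfl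
  have hrow : ∀ (x : MatN k) j, G o j * x = ∑ l, x j l • G o l := by
    intro x j
    ext a c
    simp only [G, Matrix.sum_apply, Matrix.smul_apply, Matrix.single_apply, Matrix.mul_apply]
    by_cases h : o = a
    · simp [h]
    · simp [h]
  have hqx : ∀ x j v, q j (F x v) = ∑ l, x j l • q l v := by
    intro x j v
    apply Subtype.ext
    rw [hq, FF, hrow]
    simp [hq]
  have hadd : ∀ (v w : E) i j, b.repr (q j (v + w)) i = b.repr (q j v) i + b.repr (q j w) i := by
    intro v w i j
    rw [map_add, map_add]; rfl
  have hmul : ∀ (x : MatN k) (v : E) i j, b.repr (q j (F x v)) i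
      = Matrix.mulVec x (fun j => b.repr (q j v) i) j := by
    intro x v i j
    rw [hqx]
    simp [Matrix.mulVec, dotProduct]
  let T : RepMod (f.comp σ) →ₗ[A] (Fin (finrank ℂ P) → RepMod σ) :=
    { toFun := fun v i => (WithLp.toLp 2 (fun j => b.repr (q j v) i) : EuclideanSpace ℂ (Fin k))
      map_add' := fun v w => by
        funext i
        apply WithLp.ofLp_injective 2
        funext j
        exact hadd v w i j
      map_smul' := fun a v => by
        funext i
        change _ = Matrix.toEuclideanCLM (𝕜 := ℂ) (σ a) (WithLp.toLp 2 _)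
        rw [Matrix.toEuclideanCLM_toLp]
        congr 1
        funext j
        exact hmul (σ a) v i j }
  have hT : ∀ v i j, (show EuclideanSpace ℂ (Fin k) from T v i) j = b.repr (q j v) i := fun _ _ _ => rfl
  have hinj : ∀ v : E, (∀ j, q j v = 0) → v = 0 := by
    intro v h0
    have h1 : v = F 1 v := by rw [map_one]; rfl
    have h2 : F 1 v = ∑ j, F (G j o) (F (G o j) v) := by
      rw [← hone, map_sum]
      simp [FF, GG]
    rw [h1, h2]
    apply Finset.sum_eq_zero
    intro j _
    rw [← hq, h0]; simp
  refine ⟨finrank ℂ P, ⟨LinearEquiv.ofBijective T ⟨?_, ?_⟩⟩⟩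
  · rw [← LinearMap.ker_eq_bot, LinearMap.ker_eq_bot']
    intro v hv
    have h0 : ∀ j, q j v = 0 := by
      intro j
      apply b.repr.injective
      ext i
      rw [← hT, hv, map_zero]; rfl
    exact hinj v h0
  · intro w
    let p : Fin k → P := fun j => ∑ i, (show EuclideanSpace ℂ (Fin k) from w i) j • b i
    refine ⟨(∑ j, F (G j o) (p j) : E), ?_⟩
    funext i
    apply WithLp.ofLp_injective 2
    funext j
    refine (hT _ i j).trans ?_
    have : q j (∑ j, F (G j o) (p j) : E) = p j := by
      apply Subtype.ext
      rw [hq, map_sum, Finset.sum_eq_single j]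
      · rw [FF, GG, memP]
      · intro l _ hl
        rw [FF, GG0 _ _ _ _ hl.symm]; simp
      · simp
    rw [this]
    simp only [p, map_sum, map_smul, Finsupp.coe_finsetSum, Finset.sum_apply]
    simp [Finsupp.single_apply]

end rep

section star
variable {A : Type} [Ring A] [StarRing A] [Algebra ℂ A]

lemma inner_smul {n : ℕ} (ρ : A →⋆ₐ[ℂ] MatN n) (a : A) (v w : EuclideanSpace ℂ (Fin n)) :
    inner ℂ (Matrix.toEuclideanCLM (𝕜 := ℂ) (ρ (star a)) v) w
      = inner ℂ v (Matrix.toEuclideanCLM (𝕜 := ℂ) (ρ a) w) := by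
  rw [map_star, map_star, ContinuousLinearMap.star_eq_adjoint,
    ContinuousLinearMap.adjoint_inner_left]

lemma semisimple {n : ℕ} (ρ : A →⋆ₐ[ℂ] MatN n) :
    IsSemisimpleModule A (RepMod ρ.toAlgHom) := by
  rw [isSemisimpleModule_iff]
  refine ⟨fun W => ?_⟩
  let W0 : Submodule ℂ (EuclideanSpace ℂ (Fin n)) := W.restrictScalars ℂ
  let C : Submodule A (RepMod ρ.toAlgHom) :=
    { carrier := (W0ᗮ : Set (EuclideanSpace ℂ (Fin n)))
      add_mem' := fun h1 h2 => W0ᗮ.add_mem h1 h2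
      zero_mem' := W0ᗮ.zero_mem
      smul_mem' := fun a v hv w hw => by
        have := inner_smul ρ a w v
        refine this.symm.trans ?_
        exact hv _ (W.smul_mem (star a) hw) }
  have hc : IsCompl W0 W0ᗮ := Submodule.isCompl_orthogonal _
  refine ⟨C, ?_⟩
  rw [isCompl_iff, Submodule.disjoint_def, codisjoint_iff, Submodule.eq_top_iff']
  constructor
  · intro x h1 h2
    exact Submodule.disjoint_def.mp hc.disjoint x h1 h2
  · intro x
    have hx : (show EuclideanSpace ℂ (Fin n) from x) ∈ W0 ⊔ W0ᗮ := by rw [hc.sup_eq_top]; trivial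
    obtain ⟨y, hy, z, hz, rfl⟩ := Submodule.mem_sup.mp hx
    exact Submodule.mem_sup.mpr ⟨y, hy, z, hz, rfl⟩

lemma toMat {k : ℕ} {H : Type} [NormedAddCommGroup H] [InnerProductSpace ℂ H]
    [FiniteDimensional ℂ H] (hk : finrank ℂ H = k) (L : A →ₐ[ℂ] (H →ₗ[ℂ] H))
    (hL : ∀ a v w, inner ℂ (L (star a) v) w = inner ℂ v (L a w)) (hinj : Function.Injective L) :
    ∃ φ : A →⋆ₐ[ℂ] MatN k, Function.Injective φ := by
  let b : OrthonormalBasis (Fin k) ℂ H := (stdOrthonormalBasis ℂ H).reindex (finCongr hk)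
  let ψ : A →⋆ₐ[ℂ] (H →ₗ[ℂ] H) :=
    { L with
      map_star' := fun a => by
        rw [LinearMap.star_eq_adjoint, LinearMap.eq_adjoint_iff]
        intro v w
        exact hL a v w }
  refine ⟨((LinearMap.toMatrixOrthonormal b : (H →ₗ[ℂ] H) ≃⋆ₐ[ℂ] MatN k) :
    (H →ₗ[ℂ] H) →⋆ₐ[ℂ] MatN k).comp ψ, ?_⟩
  exact (LinearMap.toMatrixOrthonormal b : (H →ₗ[ℂ] H) ≃⋆ₐ[ℂ] MatN k).injective.comp hinj

lemma compress0 {k : ℕ} {H : Type} [NormedAddCommGroup H] [InnerProductSpace ℂ H]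
    [FiniteDimensional ℂ H] (L0 : A →ₐ[ℂ] Module.End ℂ H)
    (hL0 : ∀ a v w, inner ℂ (L0 (star a) v) w = inner ℂ v (L0 a w))
    (W0 : Submodule ℂ H) (hinv : ∀ a, ∀ w ∈ W0, L0 a w ∈ W0) (hk : finrank ℂ W0 = k)
    (hf : ∀ a : A, (∀ w ∈ W0, L0 a w = 0) → a = 0) :
    ∃ φ : A →⋆ₐ[ℂ] MatN k, Function.Injective φ := by
  let L : A → (W0 →ₗ[ℂ] W0) := fun a => (L0 a).restrict (hinv a)
  have hL : ∀ a w, (L a w : H) = L0 a w := fun _ _ => rfl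
  have ext' : ∀ x y : W0 →ₗ[ℂ] W0, (∀ w, (x w : H) = y w) → x = y := fun x y h =>
    LinearMap.ext fun w => Subtype.ext (h w)
  let ψ : A →ₐ[ℂ] (W0 →ₗ[ℂ] W0) :=
    { toFun := L
      map_one' := ext' _ _ fun w => by rw [hL, map_one]; rfl
      map_mul' := fun x y => ext' _ _ fun w => by
        rw [hL, map_mul]; rfl
      map_zero' := ext' _ _ fun w => by rw [hL, map_zero]; rfl
      map_add' := fun x y => ext' _ _ fun w => by rw [hL, map_add]; rfl
      commutes' := fun c => ext' _ _ fun w => by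
        rw [hL, AlgHom.commutes]; rfl }
  have hψ : Function.Injective ψ := by
    rw [injective_iff_map_eq_zero]
    intro a ha
    apply hf a
    intro w hw
    rw [← hL a ⟨w, hw⟩]
    have h : L a = 0 := ha
    rw [h]; rfl
  exact toMat hk ψ (fun a v w => hL0 a v w) hψ

/-- compress a `*`-representation to an invariant subspace -/
lemma compress {n k : ℕ} (ρ : A →⋆ₐ[ℂ] MatN n)
    (W : Submodule A (RepMod ρ.toAlgHom)) (hk : finrank ℂ W = k)
    (hf : ∀ a : A, (∀ w ∈ W, a • w = 0) → a = 0) :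
    ∃ φ : A →⋆ₐ[ℂ] MatN k, Function.Injective φ := by
  let L0 : A →ₐ[ℂ] Module.End ℂ (EuclideanSpace ℂ (Fin n)) :=
    AlgHom.ofLinearMap
      { toFun := fun a => (Matrix.toEuclideanCLM (𝕜 := ℂ) (ρ a)).toLinearMap
        map_add' := fun x y => by rw [map_add, map_add]; rfl
        map_smul' := fun x y => by rw [map_smul, map_smul]; rfl }
      (by change (Matrix.toEuclideanCLM (𝕜 := ℂ) (ρ 1)).toLinearMap = _
          rw [map_one, map_one]; rfl)
      (fun x y => by
          change (Matrix.toEuclideanCLM (𝕜 := ℂ) (ρ (x * y))).toLinearMap = _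
          rw [map_mul, map_mul]; rfl)
  exact compress0 (H := EuclideanSpace ℂ (Fin n)) L0 (fun a v w => inner_smul ρ a v w)
    (W.restrictScalars ℂ) (fun a w hw => W.smul_mem a hw) hk hf

lemma main {N k1 k2 : ℕ} (hN : 0 < N) (hk1 : 0 < k1) (hk2 : 0 < k2)
    (ρ1 : A →⋆ₐ[ℂ] MatN k1) (ρ2 : A →⋆ₐ[ℂ] MatN k2)
    (f1 : MatN k1 →ₐ[ℂ] MatN N) (f2 : MatN k2 →ₐ[ℂ] MatN N) (hinj : Function.Injective ρ1)
    (e : RepMod (f1.comp ρ1.toAlgHom) ≃ₗ[A] RepMod (f2.comp ρ2.toAlgHom)) :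
    ∃ φ : A →⋆ₐ[ℂ] MatN (Nat.gcd k1 k2), Function.Injective φ := by
  have dimR : ∀ {n : ℕ} (ρ : A →ₐ[ℂ] MatN n), finrank ℂ (RepMod ρ) = n := fun {n} ρ =>
    (finrank_euclideanSpace_fin : finrank ℂ (EuclideanSpace ℂ (Fin n)) = n)
  obtain ⟨m1, ⟨a1⟩⟩ := amplify hk1 f1 ρ1.toAlgHom
  obtain ⟨m2, ⟨a2⟩⟩ := amplify hk2 f2 ρ2.toAlgHom
  have d1 := (a1.restrictScalars ℂ).finrank_eq
  have d2 := (a2.restrictScalars ℂ).finrank_eq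
  rw [finrank_pi_fintype] at d1 d2
  simp only [dimR, Finset.sum_const, Finset.card_univ, Fintype.card_fin, smul_eq_mul] at d1 d2
  have hss := semisimple ρ1
  obtain ⟨r, s, hcop, h1, h2⟩ := Nat.exists_coprime k1 k2
  have hg : 0 < Nat.gcd k1 k2 := Nat.gcd_pos_of_pos_left k2 hk1
  generalize Nat.gcd k1 k2 = g at *
  have hr : 0 < r := Nat.pos_of_ne_zero fun h => by simp [h] at h1; omega
  obtain ⟨W, ⟨eW⟩⟩ := root (A := A) r hr k1 (RepMod ρ1.toAlgHom) (dimR _).le (by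
    intro S _ _ _ _ _ _
    have c1 := finrank_hom_congr S a1
    have c2 := finrank_hom_congr S a2
    have c3 := finrank_hom_congr S e
    rw [finrank_hom_pi] at c1 c2
    rw [c1, c2] at c3
    generalize finrank ℂ (S →ₗ[A] RepMod ρ1.toAlgHom) = x at c3 ⊢
    generalize finrank ℂ (S →ₗ[A] RepMod ρ2.toAlgHom) = y at c3
    have h3 : N * g * (s * x) = N * g * (r * y) := by
      calc N * g * (s * x) = N * (s * g) * x := by ring
        _ = m1 * k1 * k2 * x := by rw [← h2, ← d1]
        _ = (m1 * x) * k1 * k2 := by ring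
        _ = (m2 * k2) * k1 * y := by rw [c3]; ring
        _ = N * g * (r * y) := by rw [← d2, h1]; ring
    have h4 := Nat.eq_of_mul_eq_mul_left (Nat.mul_pos hN hg) h3
    exact hcop.dvd_of_dvd_mul_left (Dvd.intro _ h4.symm))
  have := finite_sub (A := A) _ W
  have dW := (eW.restrictScalars ℂ).finrank_eq
  rw [finrank_pi_fintype, dimR] at dW
  simp only [Finset.sum_const, Finset.card_univ, Fintype.card_fin, smul_eq_mul] at dW
  refine compress ρ1 W (Nat.eq_of_mul_eq_mul_left hr (dW.symm.trans h1)) ?_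
  intro a ha
  have hz : ∀ v : RepMod ρ1.toAlgHom, a • v = 0 := by
    intro v
    apply eW.injective
    rw [map_smul, map_zero]
    funext i
    exact Subtype.ext (ha _ (eW v i).2)
  apply hinj
  rw [map_zero]
  apply (Matrix.toEuclideanCLM (n := Fin k1) (𝕜 := ℂ)).injective
  rw [map_zero]
  ext1 v
  exact hz v

end star
end GcdEmb

/-- If `B1 ≅ M_{k1}` and `B2 ≅ M_{k2}` are unital C*-subalgebras of `M_N`, `B` is a unital
C*-subalgebra of `B1`, and `u* B u ⊆ B2` for some unitary `u`, then `B` embeds unitally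
into `M_k` where `k = gcd(k1, k2)`. -/
theorem embedding_into_gcd (N k1 k2 : ℕ) (hN : 0 < N) (hk1 : 0 < k1) (hk2 : 0 < k2)
    (B1 B2 : StarSubalgebra ℂ (MatN N))
    (e1 : Nonempty (↥B1 ≃⋆ₐ[ℂ] Matrix (Fin k1) (Fin k1) ℂ))
    (e2 : Nonempty (↥B2 ≃⋆ₐ[ℂ] Matrix (Fin k2) (Fin k2) ℂ))
    (B : StarSubalgebra ℂ (MatN N)) (hB : B ≤ B1)
    (u : MatN N) (hu : u ∈ unitary (MatN N))
    (huB : ∀ b ∈ B, star u * b * u ∈ B2) :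
    ∃ φ : ↥B →⋆ₐ[ℂ] Matrix (Fin (Nat.gcd k1 k2)) (Fin (Nat.gcd k1 k2)) ℂ,
      Function.Injective φ := by
  obtain ⟨e1⟩ := e1
  obtain ⟨e2⟩ := e2
  have hu1 : star u * u = 1 := (Unitary.mem_iff.mp hu).1
  have hu2 : u * star u = 1 := (Unitary.mem_iff.mp hu).2
  let c : ↥B →⋆ₐ[ℂ] ↥B2 :=
    { toFun := fun b => ⟨star u * (b : MatN N) * u, huB b b.2⟩
      map_one' := Subtype.ext (by simp [hu1])
      map_mul' := fun x y => Subtype.ext (by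
        change star u * ((x : MatN N) * y) * u = (star u * x * u) * (star u * y * u)
        calc star u * ((x : MatN N) * y) * u = star u * x * 1 * y * u := by simp only [mul_assoc, one_mul]
          _ = _ := by rw [← hu2]; simp only [mul_assoc])
      map_zero' := Subtype.ext (by simp)
      map_add' := fun x y => Subtype.ext (by simp [mul_add, add_mul])
      commutes' := fun z => Subtype.ext (by
        change star u * (algebraMap ℂ (MatN N) z) * u = algebraMap ℂ (MatN N) z
        rw [← Algebra.commutes, mul_assoc, hu1, mul_one])
      map_star' := fun x => Subtype.ext (by
        change star u * star (x : MatN N) * u = star (star u * (x : MatN N) * u)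
        simp [mul_assoc]) }
  let ρ1 : ↥B →⋆ₐ[ℂ] MatN k1 := (e1 : ↥B1 →⋆ₐ[ℂ] MatN k1).comp (StarSubalgebra.inclusion hB)
  let ρ2 : ↥B →⋆ₐ[ℂ] MatN k2 := (e2 : ↥B2 →⋆ₐ[ℂ] MatN k2).comp c
  let f1 : MatN k1 →ₐ[ℂ] MatN N := (B1.subtype.comp (e1.symm : MatN k1 →⋆ₐ[ℂ] ↥B1)).toAlgHom
  let f2 : MatN k2 →ₐ[ℂ] MatN N := (B2.subtype.comp (e2.symm : MatN k2 →⋆ₐ[ℂ] ↥B2)).toAlgHom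
  have hρ1 : ∀ b : ↥B, f1 (ρ1 b) = b := fun b => by
    change ((e1.symm (e1 (StarSubalgebra.inclusion hB b)) : ↥B1) : MatN N) = b
    rw [e1.symm_apply_apply]; rfl
  have hρ2 : ∀ b : ↥B, f2 (ρ2 b) = star u * b * u := fun b => by
    change ((e2.symm (e2 (c b)) : ↥B2) : MatN N) = _
    rw [e2.symm_apply_apply]; rfl
  have hinj : Function.Injective ρ1 := fun x y h => Subtype.ext (by
    rw [← hρ1, ← hρ1, h])
  let t : MatN N → EuclideanSpace ℂ (Fin N) →L[ℂ] EuclideanSpace ℂ (Fin N) :=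
    fun x => Matrix.toEuclideanCLM (𝕜 := ℂ) x
  have tt : ∀ x y v, t x (t y v) = t (x * y) v := fun x y v => by
    simp only [t]; rw [map_mul]; rfl
  have t1 : ∀ v, t 1 v = v := fun v => by simp only [t]; rw [map_one]; rfl
  have e : GcdEmb.RepMod (f1.comp ρ1.toAlgHom) ≃ₗ[↥B] GcdEmb.RepMod (f2.comp ρ2.toAlgHom) :=
    { toFun := fun v => t (star u) v
      invFun := fun v => t u v
      map_add' := fun v w => map_add (t (star u)) v w
      map_smul' := fun b v => by
        have key : ∀ v, t (star u) (t (f1 (ρ1 b)) v) = t (f2 (ρ2 b)) (t (star u) v) := fun v => by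
          rw [tt, tt, hρ1, hρ2, mul_assoc _ u, hu2, mul_one]
        exact key v
      left_inv := fun v => by
        have key : ∀ v, t u (t (star u) v) = v := fun v => by rw [tt, hu2, t1]
        exact key v
      right_inv := fun v => by
        have key : ∀ v, t (star u) (t u v) = v := fun v => by rw [tt, hu1, t1]
        exact key v }
  exact GcdEmb.main hN hk1 hk2 ρ1 ρ2 f1 f2 hinj e
end
end

section
/- Let B1 and B2 be proper unital C*-subalgebras of M_N with B1 *-isomorphic to M_{k1} and B2 *-isomorphic to M_{k2} (so both are simple). Let B be a commutative unital C*-subalgebra of B1 with dim B ≥ 2, and let u ∈ U(M_N) be a unitary with u*Bu ⊆ B2. Then (dim B1 − dim(B1 ∩ B')) + (dim B2 − dim(B2 ∩ u*B'u)) + dim B' < N². (In the paper this says d(B) < N², using that the unitary group of a finite-dimensional C*-algebra A is a compact Lie group of real dimension equal to the complex dimension of A.) -/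
noncomputable section

/-- The commutant (relative to `M_N`) of a set of matrices. -/
abbrev commutant {N : ℕ} (S : Set (MatN N)) : Subalgebra ℂ (MatN N) :=
  Subalgebra.centralizer ℂ S


lemma aux_bij {k : ℕ} {R : Type} [Ring R] [Algebra ℂ R]
    (E : Matrix (Fin k) (Fin k) ℂ →ₐ[ℂ] R) {d : ℕ}
    (y : Module.Basis (Fin d) ℂ (Subalgebra.centralizer ℂ (Set.range E))) :
    Function.Bijective (fun x : Fin d → Matrix (Fin k) (Fin k) ℂ => ∑ i, E (x i) * (y i : R)) := by
  classical
  have hcomm : ∀ (c : Subalgebra.centralizer ℂ (Set.range E)) (m : Matrix (Fin k) (Fin k) ℂ),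
      E m * (c : R) = (c : R) * E m := fun c m =>
    (Subalgebra.mem_centralizer_iff ℂ).1 c.2 (E m) ⟨m, rfl⟩
  let e : Fin k → Fin k → Matrix (Fin k) (Fin k) ℂ := fun i j => Matrix.single i j 1
  have hsum : ∀ (m : Matrix (Fin k) (Fin k) ℂ) (a b : Fin k),
      ∑ c, e c a * m * e b c = (m a b) • (1 : Matrix (Fin k) (Fin k) ℂ) := by
    intro m a b
    ext p q
    simp only [e, Matrix.sum_apply, Matrix.single_mul_mul_single, Matrix.smul_apply,
      Matrix.one_apply, Matrix.single_apply]
    by_cases h : p = q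
    · subst h; simp
    · have : ∀ x, ¬ (x = p ∧ x = q) := by rintro x ⟨rfl, h'⟩; exact h h'
      simp [h, this]
  have hone : ∑ a, e a a = (1 : Matrix (Fin k) (Fin k) ℂ) := by
    simp only [e]
    ext p q
    simp only [Matrix.sum_apply, Matrix.one_apply, Matrix.single_apply]
    by_cases h : p = q
    · subst h; simp
    · have : ∀ x, ¬ (x = p ∧ x = q) := by rintro x ⟨rfl, h'⟩; exact h h'
      simp [h, this]
  constructor
  · intro x x' hxx
    have h0 : ∑ i, E (x i - x' i) * (y i : R) = 0 := by
      simp only [map_sub, sub_mul, Finset.sum_sub_distrib]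
      exact sub_eq_zero.2 hxx
    have h1 : ∀ a b, ∑ i, ((x i - x' i) a b) • (y i) = 0 := by
      intro a b
      apply Subtype.ext
      have h2 : ∑ c, E (e c a) * (∑ i, E (x i - x' i) * (y i : R)) * E (e b c) = 0 := by
        rw [h0]; simp
      refine Eq.trans ?_ h2
      simp only [Finset.mul_sum, Finset.sum_mul]
      rw [Finset.sum_comm]
      simp only [AddSubmonoidClass.coe_finset_sum]
      refine Finset.sum_congr rfl fun i _ => ?_
      have : ∀ c, E (e c a) * (E (x i - x' i) * (y i : R)) * E (e b c)
          = E (e c a * (x i - x' i) * e b c) * (y i : R) := by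
        intro c
        rw [map_mul, map_mul, mul_assoc, mul_assoc, mul_assoc, mul_assoc, ← hcomm]
      simp only [this]
      rw [← Finset.sum_mul, ← map_sum, hsum]
      simp
    funext i
    ext a b
    have := Fintype.linearIndependent_iff.1 y.linearIndependent _ (h1 a b) i
    exact sub_eq_zero.1 (by simpa using this)
  · intro z
    have hz : ∀ a b, ∑ c, E (e c a) * z * E (e b c) ∈ Subalgebra.centralizer ℂ (Set.range E) := by
      intro a b
      rw [Subalgebra.mem_centralizer_iff]
      rintro _ ⟨m, rfl⟩
      have hm : ∀ c, m * e c a = ∑ p, m p c • e p a := by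
        intro c
        ext p q
        simp only [e, Matrix.sum_apply, Matrix.smul_apply]
        by_cases h : a = q
        · subst h; simp [Matrix.single_apply]
        · simp [Matrix.single_apply, h, Ne.symm h]
      have hm' : ∀ c, e b c * m = ∑ p, m c p • e b p := by
        intro c
        ext p q
        simp only [e, Matrix.sum_apply, Matrix.smul_apply]
        by_cases h : b = p
        · subst h; simp [Matrix.single_apply]
        · simp [Matrix.single_apply, h, Ne.symm h]
      simp only [Finset.mul_sum, Finset.sum_mul]
      have l1 : ∀ c, E m * (E (e c a) * z * E (e b c))
          = ∑ p, m p c • (E (e p a) * z * E (e b c)) := by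
        intro c
        rw [← mul_assoc, ← mul_assoc, ← map_mul, hm]
        simp [Finset.sum_mul]
      have l2 : ∀ c, (E (e c a) * z * E (e b c)) * E m
          = ∑ p, m c p • (E (e c a) * z * E (e b p)) := by
        intro c
        rw [mul_assoc, ← map_mul, hm']
        simp [Finset.mul_sum]
      simp only [l1, l2]
      rw [Finset.sum_comm]
    let Z : Fin k → Fin k → Subalgebra.centralizer ℂ (Set.range E) := fun a b => ⟨_, hz a b⟩
    refine ⟨fun i => Matrix.of fun a b => y.repr (Z a b) i, ?_⟩
    have hx : ∀ m : Matrix (Fin k) (Fin k) ℂ, m = ∑ a, ∑ b, m a b • e a b := by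
      intro m
      conv_lhs => rw [Matrix.matrix_eq_sum_single m]
      simp [e, Matrix.smul_single]
    have hrep : ∀ a b, ∑ i, y.repr (Z a b) i • (y i : R) = Z a b := by
      intro a b
      have := congrArg Subtype.val (y.sum_repr (Z a b))
      rw [← this]
      simp only [AddSubmonoidClass.coe_finset_sum]
      rfl
    have h3 : ∀ i, E (Matrix.of fun a b => y.repr (Z a b) i) * (y i : R)
        = ∑ a, ∑ b, E (e a b) * (y.repr (Z a b) i • (y i : R)) := by
      intro i
      rw [hx (Matrix.of fun a b => y.repr (Z a b) i)]
      simp [Finset.sum_mul]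
    simp only [h3]
    rw [Finset.sum_comm]
    have h4 : ∀ a, ∑ i, ∑ b, E (e a b) * (y.repr (Z a b) i • (y i : R))
        = ∑ b, E (e a b) * (Z a b : R) := by
      intro a
      rw [Finset.sum_comm]
      refine Finset.sum_congr rfl fun b _ => ?_
      rw [← Finset.mul_sum, hrep]
    simp only [h4]
    have h5 : ∀ a b, E (e a b) * (Z a b : R) = E (e a a) * z * E (e b b) := by
      intro a b
      rw [hcomm]
      simp only [Z, Finset.sum_mul]
      rw [Finset.sum_eq_single a]
      · rw [mul_assoc, ← map_mul]; simp [e]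
      · intro c _ hc
        rw [mul_assoc, ← map_mul]; simp [e, hc]
      · simp
    simp only [h5]
    simp only [← Finset.mul_sum, ← Finset.sum_mul, ← map_sum, hone]
    simp

lemma aux_top {N : ℕ} (B1 : StarSubalgebra ℂ (MatN N)) (h : Module.finrank ℂ ↥B1 = N ^ 2) :
    B1 = ⊤ := by
  have hfull : Module.finrank ℂ (MatN N) = N ^ 2 := by simp [Module.finrank_matrix, sq]
  have htop : Subalgebra.toSubmodule B1.toSubalgebra = ⊤ :=
    Submodule.eq_top_of_finrank_eq (by rw [hfull]; exact h)
  rw [eq_top_iff]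
  intro z _
  have hz : z ∈ Subalgebra.toSubmodule B1.toSubalgebra := by rw [htop]; trivial
  exact hz

lemma aux_four {N k d : ℕ} (hN : 0 < N) (hfin : d * k ^ 2 = N ^ 2) (hk : k ≠ N) : 4 ≤ d := by
  have hdvd : k ∣ N := by
    rw [← Nat.pow_dvd_pow_iff (two_ne_zero)]
    exact ⟨d, by rw [← hfin]; ring⟩
  obtain ⟨m, rfl⟩ := hdvd
  have hk0 : 0 < k := Nat.pos_of_mul_pos_right hN
  have hdm : d = m ^ 2 := by
    have : k ^ 2 * d = k ^ 2 * m ^ 2 := by rw [mul_comm, hfin]; ring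
    exact Nat.eq_of_mul_eq_mul_left (by positivity) this
  have hm1 : m ≠ 1 := by rintro rfl; simp at hk
  have hm0 : m ≠ 0 := by rintro rfl; simp at hN
  have : 2 ≤ m := by omega
  rw [hdm]; nlinarith

lemma aux_key {N k : ℕ} (hN : 0 < N) (B1 : StarSubalgebra ℂ (MatN N)) (hB1 : B1 ≠ ⊤)
    (e1 : Nonempty (↥B1 ≃⋆ₐ[ℂ] Matrix (Fin k) (Fin k) ℂ))
    (S : Set (MatN N)) (hS : S ⊆ B1) :
    ∃ d, 4 ≤ d ∧ d * Module.finrank ℂ ↥B1 = N ^ 2 ∧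
      Module.finrank ℂ ↥(commutant S) =
        d * Module.finrank ℂ ↥(B1.toSubalgebra ⊓ commutant S) := by
  obtain ⟨e1⟩ := e1
  have hfin1 : Module.finrank ℂ ↥B1 = k ^ 2 := by
    rw [e1.toAlgEquiv.toLinearEquiv.finrank_eq]
    simp [Module.finrank_matrix, sq]
  obtain ⟨E, hEinj, hEr, hEm⟩ : ∃ E : Matrix (Fin k) (Fin k) ℂ →ₐ[ℂ] MatN N,
      Function.Injective E ∧ (∀ z, z ∈ B1 → ∃ x, E x = z) ∧ (∀ x, E x ∈ B1) := by
    refine ⟨B1.toSubalgebra.val.comp (e1.symm.toAlgEquiv : _ →ₐ[ℂ] B1.toSubalgebra), ?_, ?_, ?_⟩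
    · intro a b h
      exact e1.symm.injective (Subtype.ext h)
    · intro z hz
      refine ⟨e1 ⟨z, hz⟩, ?_⟩
      exact congrArg Subtype.val (e1.symm_apply_apply ⟨z, hz⟩)
    · intro x
      exact (e1.symm x).2
  clear e1
  let C := Subalgebra.centralizer ℂ (Set.range E)
  obtain ⟨d, ⟨y⟩⟩ : ∃ d, Nonempty (Module.Basis (Fin d) ℂ C) := ⟨_, ⟨Module.finBasis ℂ C⟩⟩
  have hbij := aux_bij E y
  let Ψ : (Fin d → Matrix (Fin k) (Fin k) ℂ) →ₗ[ℂ] MatN N :=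
    { toFun := fun x => ∑ i, E (x i) * (y i : MatN N)
      map_add' := by intro a b; simp [add_mul, Finset.sum_add_distrib]
      map_smul' := by intro a b; simp [Finset.smul_sum] }
  have hΨ : ∀ x, Ψ x = ∑ i, E (x i) * (y i : MatN N) := fun x => rfl
  have hΨb : Function.Bijective Ψ := hbij
  have hcomm : ∀ (c : C) (m : Matrix (Fin k) (Fin k) ℂ),
      E m * (c : MatN N) = (c : MatN N) * E m := fun c m =>
    (Subalgebra.mem_centralizer_iff ℂ).1 c.2 (E m) ⟨m, rfl⟩
  have hfin : d * k ^ 2 = N ^ 2 := by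
    have := (LinearEquiv.ofBijective Ψ hΨb).finrank_eq
    rw [Module.finrank_pi_fintype] at this
    simpa [Module.finrank_matrix, sq] using this
  refine ⟨d, ?_, by rw [hfin1, hfin], ?_⟩
  · refine aux_four hN hfin ?_
    rintro rfl
    exact hB1 (aux_top B1 hfin1)
  · let P : Submodule ℂ (MatN N) := Subalgebra.toSubmodule (commutant S)
    let W : Submodule ℂ (Matrix (Fin k) (Fin k) ℂ) := P.comap E.toLinearMap
    have hW : Module.finrank ℂ ↥(B1.toSubalgebra ⊓ commutant S) = Module.finrank ℂ W := by
      have h1 : Subalgebra.toSubmodule (B1.toSubalgebra ⊓ commutant S) = W.map E.toLinearMap := by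
        ext z
        constructor
        · rintro ⟨h1, h2⟩
          obtain ⟨x, rfl⟩ := hEr z h1
          exact ⟨x, h2, rfl⟩
        · rintro ⟨x, hx, rfl⟩
          exact ⟨hEm x, hx⟩
      have h2 := (Submodule.equivMapOfInjective E.toLinearMap hEinj W).finrank_eq
      rw [h2, ← h1]; rfl
    let Θ : (Fin d → W) →ₗ[ℂ] MatN N := Ψ.comp (LinearMap.pi fun i => W.subtype.comp (LinearMap.proj i))
    have hΘi : Function.Injective Θ := by
      intro a b h
      have := hΨb.1 h
      funext i
      exact Subtype.ext (congrFun this i)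
    have hΘr : LinearMap.range Θ = P := by
      ext z
      constructor
      · rintro ⟨x, rfl⟩
        change (∑ i, E (x i) * (y i : MatN N)) ∈ commutant S
        refine sum_mem fun i _ => mul_mem (x i).2 ?_
        rw [Subalgebra.mem_centralizer_iff]
        intro s hs
        obtain ⟨t, rfl⟩ := hEr s (hS hs)
        exact hcomm _ _
      · intro hz
        obtain ⟨x, rfl⟩ := hΨb.2 z
        have hx : ∀ i, x i ∈ W := by
          intro i
          change E (x i) ∈ commutant S
          rw [Subalgebra.mem_centralizer_iff]
          intro s hs
          have hzs := (Subalgebra.mem_centralizer_iff ℂ).1 hz s hs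
          obtain ⟨t, rfl⟩ := hEr s (hS hs)
          have : Ψ (fun i => t * x i) = Ψ (fun i => x i * t) := by
            rw [hΨ] at hzs ⊢
            rw [hΨ]
            rw [Finset.mul_sum, Finset.sum_mul] at hzs
            have l1 : ∀ j, E (t * x j) * (y j : MatN N) = E t * (E (x j) * (y j : MatN N)) := by
              intro j; rw [map_mul, mul_assoc]
            have l2 : ∀ j, E (x j * t) * (y j : MatN N) = E (x j) * (y j : MatN N) * E t := by
              intro j; rw [map_mul, mul_assoc, mul_assoc, hcomm]
            simp only [l1, l2]
            exact hzs
          rw [← map_mul, ← map_mul]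
          exact congrArg E (congrFun (hΨb.1 this) i)
        exact ⟨fun i => ⟨x i, hx i⟩, rfl⟩
    have h3 := LinearMap.finrank_range_of_inj hΘi
    rw [hΘr, Module.finrank_pi_fintype] at h3
    rw [hW]
    rw [Finset.sum_const, Finset.card_univ, Fintype.card_fin, smul_eq_mul] at h3
    exact h3

/-- If `B1 ≅ M_{k1}` and `B2 ≅ M_{k2}` are proper unital C*-subalgebras of `M_N`,
`B` is a commutative unital C*-subalgebra of `B1` with `dim B ≥ 2`, and `u* B u ⊆ B2`
for a unitary `u`, then
`(dim B1 − dim(B1 ∩ B')) + (dim B2 − dim(B2 ∩ u*B'u)) + dim B' < N²`. -/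
theorem dB_lt_Nsq_simple_case (N k1 k2 : ℕ) (hN : 0 < N)
    (B1 B2 : StarSubalgebra ℂ (MatN N)) (hB1 : B1 ≠ ⊤) (hB2 : B2 ≠ ⊤)
    (e1 : Nonempty (↥B1 ≃⋆ₐ[ℂ] Matrix (Fin k1) (Fin k1) ℂ))
    (e2 : Nonempty (↥B2 ≃⋆ₐ[ℂ] Matrix (Fin k2) (Fin k2) ℂ))
    (B : StarSubalgebra ℂ (MatN N)) (hB : B ≤ B1)
    (hBcomm : ∀ x ∈ B, ∀ y ∈ B, x * y = y * x)
    (hBdim : 2 ≤ Module.finrank ℂ ↥B)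
    (u : MatN N) (hu : u ∈ unitary (MatN N))
    (huB : ∀ b ∈ B, star u * b * u ∈ B2) :
    (Module.finrank ℂ ↥B1 -
        Module.finrank ℂ ↥(B1.toSubalgebra ⊓ commutant (B : Set (MatN N)))) +
      (Module.finrank ℂ ↥B2 -
        Module.finrank ℂ ↥(Submodule.span ℂ ((B2 : Set (MatN N)) ∩
          ((fun x => star u * x * u) '' (commutant (B : Set (MatN N)) : Set (MatN N)))))) +
      Module.finrank ℂ ↥(commutant (B : Set (MatN N))) < N ^ 2 := by
  classical
  have hu1 : star u * u = 1 := (Unitary.mem_iff.1 hu).1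
  have hu2 : u * star u = 1 := (Unitary.mem_iff.1 hu).2
  obtain ⟨d1, hd1, hf1, hc1⟩ := aux_key hN B1 hB1 e1 (B : Set (MatN N)) hB
  let S : Set (MatN N) := (fun x => star u * x * u) '' (B : Set (MatN N))
  obtain ⟨d2, hd2, hf2, hc2⟩ := aux_key hN B2 hB2 e2 S (by rintro _ ⟨b, hb, rfl⟩; exact huB b hb)
  have hconj : ((fun x => star u * x * u) '' (commutant (B : Set (MatN N)) : Set (MatN N)))
      = (commutant S : Set (MatN N)) := by
    have hm : ∀ a b : MatN N, (star u * a * u) * (star u * b * u) = star u * (a * b) * u := by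
      intro a b
      calc _ = star u * a * (u * star u) * b * u := by simp only [mul_assoc]
        _ = _ := by rw [hu2]; simp only [mul_assoc, mul_one]
    have hinv : ∀ z : MatN N, star u * (u * z * star u) * u = z := by
      intro z
      calc _ = (star u * u) * z * (star u * u) := by simp only [mul_assoc]
        _ = _ := by rw [hu1]; simp
    have hinv' : ∀ z : MatN N, u * (star u * z * u) * star u = z := by
      intro z
      calc _ = (u * star u) * z * (u * star u) := by simp only [mul_assoc]
        _ = _ := by rw [hu2]; simp
    ext z
    constructor
    · rintro ⟨x, hx, rfl⟩
      refine (Subalgebra.mem_centralizer_iff ℂ).2 ?_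
      rintro _ ⟨b, hb, rfl⟩
      have := (Subalgebra.mem_centralizer_iff ℂ).1 hx b hb
      simp only [hm, this]
    · intro hz
      refine ⟨u * z * star u, (Subalgebra.mem_centralizer_iff ℂ).2 ?_, hinv z⟩
      intro b hb
      have := (Subalgebra.mem_centralizer_iff ℂ).1 hz _ ⟨b, hb, rfl⟩
      have h2 : star u * (b * (u * z * star u)) * u = star u * ((u * z * star u) * b) * u := by
        rw [← hm b, ← hm _ b, hinv]; exact this
      rw [← hinv' (b * _), h2, hinv']
  have hspan : Module.finrank ℂ ↥(Submodule.span ℂ ((B2 : Set (MatN N)) ∩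
          ((fun x => star u * x * u) '' (commutant (B : Set (MatN N)) : Set (MatN N)))))
      = Module.finrank ℂ ↥(B2.toSubalgebra ⊓ commutant S) := by
    rw [hconj]
    have : Submodule.span ℂ ((B2 : Set (MatN N)) ∩ (commutant S : Set (MatN N)))
        = Subalgebra.toSubmodule (B2.toSubalgebra ⊓ commutant S) :=
      Submodule.span_eq (Subalgebra.toSubmodule (B2.toSubalgebra ⊓ commutant S))
    rw [this]; rfl
  have hcc : Module.finrank ℂ ↥(commutant S) = Module.finrank ℂ ↥(commutant (B : Set (MatN N))) := by
    let L : MatN N →ₗ[ℂ] MatN N := (LinearMap.mulRight ℂ u).comp (LinearMap.mulLeft ℂ (star u))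
    have hL : ∀ x, L x = star u * x * u := fun x => rfl
    have hLi : Function.Injective L := by
      intro a b h
      have hinv' : ∀ z : MatN N, u * (star u * z * u) * star u = z := by
        intro z
        calc _ = (u * star u) * z * (u * star u) := by simp only [mul_assoc]
          _ = _ := by rw [hu2]; simp
      rw [← hinv' a, ← hL, h, hL, hinv']
    have h2 := (Submodule.equivMapOfInjective L hLi
      (Subalgebra.toSubmodule (commutant (B : Set (MatN N))))).finrank_eq
    have h1 : Subalgebra.toSubmodule (commutant S)
        = (Subalgebra.toSubmodule (commutant (B : Set (MatN N)))).map L :=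
      SetLike.coe_injective hconj.symm
    rw [← h1] at h2
    exact h2.symm
  have hlt : Module.finrank ℂ ↥(commutant (B : Set (MatN N))) < N ^ 2 := by
    have hfull : Module.finrank ℂ (MatN N) = N ^ 2 := by simp [Module.finrank_matrix, sq]
    have hle := Submodule.finrank_le (Subalgebra.toSubmodule (commutant (B : Set (MatN N))))
    rw [hfull] at hle
    refine lt_of_le_of_ne hle fun heq => ?_
    have htop : Subalgebra.toSubmodule (commutant (B : Set (MatN N))) = ⊤ :=
      Submodule.eq_top_of_finrank_eq (by rw [hfull]; exact heq)
    haveI : Nonempty (Fin N) := ⟨⟨0, hN⟩⟩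
    have hbot : B.toSubalgebra ≤ ⊥ := by
      rw [← Algebra.IsCentral.center_eq_bot ℂ (MatN N)]
      intro b hb
      rw [Subalgebra.mem_center_iff]
      intro z
      have hz : z ∈ Subalgebra.toSubmodule (commutant (B : Set (MatN N))) := by
        rw [htop]; trivial
      exact ((Subalgebra.mem_centralizer_iff ℂ).1 hz b hb).symm
    have h1 : Module.finrank ℂ B ≤ Module.finrank ℂ (⊥ : Subalgebra ℂ (MatN N)) :=
      Submodule.finrank_mono (s := Subalgebra.toSubmodule B.toSubalgebra)
        (t := Subalgebra.toSubmodule ⊥) hbot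
    rw [Subalgebra.finrank_bot] at h1
    omega
  rw [hspan]
  rw [hcc] at hc2
  generalize Module.finrank ℂ ↥(commutant (B : Set (MatN N))) = c at *
  generalize Module.finrank ℂ ↥(B1.toSubalgebra ⊓ commutant (B : Set (MatN N))) = g1 at *
  generalize Module.finrank ℂ ↥(B2.toSubalgebra ⊓ commutant S) = g2 at *
  generalize Module.finrank ℂ ↥B1 = f1 at *
  generalize Module.finrank ℂ ↥B2 = f2 at *
  have key : ∀ d f g : ℕ, 4 ≤ d → d * f = N ^ 2 → c = d * g → 4 * (f - g) + c ≤ N ^ 2 := by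
    intro d f g hd hf hc
    have hfg : g ≤ f := by
      by_contra h
      have : d * f ≤ d * g := Nat.mul_le_mul_left d (by omega)
      omega
    obtain ⟨t, rfl⟩ := Nat.exists_eq_add_of_le hfg
    rw [Nat.add_sub_cancel_left]
    nlinarith [Nat.mul_le_mul_right t hd]
  have k1 := key d1 f1 g1 hd1 hf1 hc1
  have k2 := key d2 f2 g2 hd2 hf2 hc2
  omega
end
end

section
/- Let B1 and B2 be proper unital C*-subalgebras of M_N. Suppose l1 := dim C(B1) ≥ 2 and B1 is *-isomorphic to the direct sum of l1 copies of M_{N/l1}, and that one of the following holds: (a) dim C(B2) = 1; (b) B1 is *-isomorphic to M_{N/2} ⊕ M_{N/2} and B2 is *-isomorphic to M_{N/2} ⊕ M_{N/(2k)} for some integer k ≥ 2; (c) l2 := dim C(B2) ≥ 3 and B2 is *-isomorphic to the direct sum of l2 copies of M_{N/l2}. Let B be a commutative unital C*-subalgebra of B1 with dim B ≥ 2, and let u ∈ U(M_N) be a unitary with u*Bu ⊆ B2. Then (dim B1 − dim(B1 ∩ B')) + (dim B2 − dim(B2 ∩ u*B'u)) + dim B' < N². -/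
set_option synthInstance.maxHeartbeats 1000000
set_option maxHeartbeats 1000000

noncomputable section

open scoped ComplexOrder in
lemma aux_selfadj_nil {N : ℕ} (m : ℕ) : ∀ (y : MatN N), y.conjTranspose = y → y ^ (2 ^ m) = 0 → y = 0 := by
  induction m with
  | zero => intro y _ h; simpa using h
  | succ m ih =>
    intro y hy h
    have h2 : y * y = 0 := by
      apply ih
      · rw [Matrix.conjTranspose_mul, hy]
      · rw [← sq, ← pow_mul, ← pow_succ']; exact h
    have : y.conjTranspose * y = 0 := by rw [hy, h2]
    exact Matrix.conjTranspose_mul_self_eq_zero.mp this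

open scoped ComplexOrder in
lemma aux_wedderburn {N : ℕ} (A : StarSubalgebra ℂ (MatN N)) :
    ∃ (n : ℕ) (d : Fin n → ℕ), (∀ i, NeZero (d i)) ∧
      Nonempty (A ≃ₐ[ℂ] ∀ i, MatN (d i)) := by
  have hfin : FiniteDimensional ℂ A :=
    inferInstanceAs (FiniteDimensional ℂ (Subalgebra.toSubmodule A.toSubalgebra))
  have hart : IsArtinianRing A := IsArtinianRing.of_finite ℂ A
  have hss : IsSemisimpleRing A := by
    rw [IsArtinianRing.isSemisimpleRing_iff_jacobson]
    rw [eq_bot_iff]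
    intro x hx
    obtain ⟨k, hk⟩ := IsSemiprimaryRing.isNilpotent (R := A)
    have h1 : star x * x ∈ Ring.jacobson A := Ideal.mul_mem_left _ _ hx
    have h2 : (star x * x) ^ k = 0 := by
      have := Ideal.pow_mem_pow h1 k
      rw [hk] at this
      simpa using this
    have h3 : (star x * x) ^ (2 ^ k) = 0 := pow_eq_zero_of_le (Nat.lt_two_pow_self).le h2
    have h4 := aux_selfadj_nil k ((x : MatN N).conjTranspose * (x : MatN N))
      (by rw [Matrix.conjTranspose_mul, Matrix.conjTranspose_conjTranspose])
      (by
        have := congrArg (Subtype.val) h3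
        simpa [Matrix.star_eq_conjTranspose] using this)
    have h5 := Matrix.conjTranspose_mul_self_eq_zero.mp h4
    simpa using h5
  exact IsSemisimpleRing.exists_algEquiv_pi_matrix_of_isAlgClosed ℂ A

lemma aux_projs {N : ℕ} (B : StarSubalgebra ℂ (MatN N))
    (hBcomm : ∀ x ∈ B, ∀ y ∈ B, x * y = y * x) :
    ∃ (p : Fin (Module.finrank ℂ B) → MatN N),
      (∀ i k, p i * p k = if i = k then p i else 0) ∧ ∑ i, p i = 1 ∧ (∀ i, p i ∈ B) ∧
      (∀ i, p i ≠ 0) ∧ commutant (B : Set (MatN N)) = commutant (Set.range p) := by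
  obtain ⟨n, d, hd, ⟨e⟩⟩ := aux_wedderburn B
  have hcomm : ∀ x y : ∀ i, MatN (d i), x * y = y * x := by
    intro x y
    apply e.symm.injective
    rw [map_mul, map_mul]
    exact Subtype.ext (hBcomm _ (e.symm x).2 _ (e.symm y).2)
  have hd1 : ∀ i, d i = 1 := by
    intro i
    by_contra h
    have h0 := (hd i).out
    let s : Fin (d i) := ⟨0, by omega⟩
    let t : Fin (d i) := ⟨1, by omega⟩
    have hst : s ≠ t := by simp [s, t, Fin.ext_iff]
    have := congrFun (congrFun (congrFun (hcomm (Pi.single i (Matrix.single s t 1)) (Pi.single i (Matrix.single t s 1))) i) s) s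
    simp [hst] at this
  obtain rfl : d = fun _ => 1 := funext hd1
  have hn : n = Module.finrank ℂ B := by
    rw [e.toLinearEquiv.finrank_eq, Module.finrank_pi_fintype]
    simp [Module.finrank_matrix]
  rw [← hn]
  let p : Fin n → B := fun i => e.symm (Pi.single i 1)
  have hpB : ∀ i k, p i * p k = if i = k then p i else 0 := by
    intro i k
    simp only [p]
    rw [← map_mul]
    split_ifs with h
    · subst h; rw [← Pi.single_mul, one_mul]
    · rw [map_eq_zero_iff _ e.symm.injective]
      funext j
      rw [Pi.mul_apply, Pi.zero_apply]
      rcases eq_or_ne j i with hj | hj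
      · have hk : j ≠ k := fun hjk => h (hj.symm.trans hjk)
        rw [Pi.single_eq_of_ne hk, mul_zero]
      · rw [Pi.single_eq_of_ne hj, zero_mul]
  refine ⟨fun i => p i, ?_, ?_, fun i => (p i).2, ?_, ?_⟩
  · intro i k
    rw [← MulMemClass.coe_mul, hpB]
    split_ifs <;> rfl
  · have : ∑ i, p i = 1 := by
      simp only [p]
      rw [← map_sum]
      have : ∑ i, Pi.single i (1 : MatN 1) = (1 : Fin n → MatN 1) := by
        exact Finset.univ_sum_single (1 : Fin n → MatN 1)
      rw [this, map_one]
    have := congrArg Subtype.val this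
    simpa using this
  · intro i h
    have h1 : p i = 0 := Subtype.ext h
    simp only [p] at h1
    rw [map_eq_zero_iff _ e.symm.injective] at h1
    have := congrFun h1 i
    simp at this
  · apply le_antisymm
    · apply Subalgebra.centralizer_le
      rintro _ ⟨i, rfl⟩
      exact (p i).2
    · intro z hz
      rw [Subalgebra.mem_centralizer_iff] at hz ⊢
      intro x hx
      have hx1 : (⟨x, hx⟩ : B) = ∑ i, (e ⟨x, hx⟩ i 0 0) • p i := by
        apply e.injective
        rw [map_sum]
        simp only [map_smul, p, AlgEquiv.apply_symm_apply]
        ext i s t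
        have hs : s = 0 := Subsingleton.elim _ _
        have ht : t = 0 := Subsingleton.elim _ _
        subst hs ht
        rw [Finset.sum_apply, Finset.sum_eq_single i]
        · simp
        · intro k _ hk; simp [hk.symm]
        · simp
      have hx2 : x = ∑ i, (e ⟨x, hx⟩ i 0 0) • (p i : MatN N) := by
        have := congrArg Subtype.val hx1
        simpa using this
      rw [hx2, Finset.sum_mul, Finset.mul_sum]
      refine Finset.sum_congr rfl fun i _ => ?_
      have := hz (p i) ⟨i, rfl⟩
      rw [smul_mul_assoc, this, mul_smul_comm]

lemma aux_cross {n : ℕ} (s r : Fin n → ℕ) (h : ∀ i, s i ≤ r i) :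
    (∑ i, s i) ^ 2 + ∑ i, r i ^ 2 ≤ (∑ i, r i) ^ 2 + ∑ i, s i ^ 2 := by
  have key : ∀ t : Fin n → ℕ, (∑ i, t i) ^ 2 = ∑ i, t i ^ 2 + ∑ i, ∑ k ∈ Finset.univ.erase i, t i * t k := by
    intro t
    rw [sq, Finset.sum_mul_sum, ← Finset.sum_add_distrib]
    refine Finset.sum_congr rfl fun i _ => ?_
    rw [← Finset.add_sum_erase _ _ (Finset.mem_univ i), sq]
  rw [key s, key r]
  have : ∑ i, ∑ k ∈ Finset.univ.erase i, s i * s k ≤ ∑ i, ∑ k ∈ Finset.univ.erase i, r i * r k :=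
    Finset.sum_le_sum fun i _ => Finset.sum_le_sum fun k _ => Nat.mul_le_mul (h i) (h k)
  omega

lemma aux_Xpos {n N : ℕ} (hn : 2 ≤ n) (r : Fin n → ℕ) (hr : ∀ i, 1 ≤ r i) (hs : ∑ i, r i = N) :
    ∑ i, r i ^ 2 < N ^ 2 := by
  have := aux_cross (fun _ => 1) r hr
  simp at this
  rw [hs] at this
  nlinarith

lemma aux_num {n l N d : ℕ} (c : Fin l → ℕ) (a : Fin n → Fin l → ℕ) (r : Fin n → ℕ)
    (hc : ∀ j, 1 ≤ c j) (ha : ∀ j, ∑ i, a i j = d) (hr : ∀ i, r i = ∑ j, c j * a i j)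
    (hs : ∑ i, r i = N) :
    l * (∑ _j : Fin l, d ^ 2) + ∑ i, r i ^ 2 ≤ N ^ 2 + l * ∑ i, ∑ j, a i j ^ 2 := by
  have h1 := aux_cross (fun i => ∑ j, a i j) r (fun i => by
    rw [hr]; exact Finset.sum_le_sum fun j _ => Nat.le_mul_of_pos_left _ (hc j))
  have h2 : ∑ i, ∑ j, a i j = l * d := by
    rw [Finset.sum_comm]; simp [ha]
  have h3 : ∑ i, (∑ j, a i j) ^ 2 ≤ l * ∑ i, ∑ j, a i j ^ 2 := by
    rw [Finset.mul_sum]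
    refine Finset.sum_le_sum fun i _ => ?_
    simpa using sq_sum_le_card_mul_sum_sq (s := Finset.univ) (f := a i)
  rw [h2, hs] at h1
  have h4 : l * (∑ _j : Fin l, d ^ 2) = (l * d) ^ 2 := by simp; ring
  rw [h4]
  omega
lemma aux_trace_idem {V : Type*} [AddCommGroup V] [Module ℂ V] [FiniteDimensional ℂ V]
    (f : V →ₗ[ℂ] V) (hf : IsIdempotentElem f) :
    LinearMap.trace ℂ V f = (Module.finrank ℂ (LinearMap.range f) : ℂ) :=
  (LinearMap.IsIdempotentElem.isProj_range f hf).trace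

lemma aux_trace_proj {V : Type*} [AddCommGroup V] [Module ℂ V] [FiniteDimensional ℂ V]
    (f : V →ₗ[ℂ] V) (S : Submodule ℂ V) (hf : LinearMap.IsProj S f) :
    LinearMap.trace ℂ V f = (Module.finrank ℂ S : ℂ) := hf.trace

lemma aux_mat_trace_idem {d : ℕ} (x : MatN d) (hx : x * x = x) :
    ∃ r : ℕ, x.trace = (r : ℂ) ∧ (r = 0 → x = 0) := by
  have h1 : IsIdempotentElem (Matrix.toLin' x) := by
    unfold IsIdempotentElem
    rw [Module.End.mul_eq_comp, ← Matrix.toLin'_mul, hx]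
  refine ⟨Module.finrank ℂ (LinearMap.range (Matrix.toLin' x)), ?_, ?_⟩
  · rw [← aux_trace_idem _ h1, Matrix.trace_toLin'_eq]
  · intro h
    rw [Submodule.finrank_eq_zero, LinearMap.range_eq_bot] at h
    simpa using h

lemma aux_trace_lr {ι : Type} [Fintype ι] [DecidableEq ι] (d : ι → ℕ)
    (a b : ∀ j, MatN (d j)) :
    LinearMap.trace ℂ (∀ j, MatN (d j))
      ((LinearMap.mulLeft ℂ a).comp (LinearMap.mulRight ℂ b)) =
      ∑ j, (a j).trace * (b j).trace := by
  rw [LinearMap.trace_eq_matrix_trace ℂ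
    (Pi.basis (fun j => Matrix.stdBasis ℂ (Fin (d j)) (Fin (d j))))]
  simp only [Matrix.trace, Matrix.diag, LinearMap.toMatrix_apply, Fintype.sum_sigma,
    Fintype.sum_prod_type, Pi.basis_repr, Pi.basis_apply, Matrix.stdBasis_eq_single,
    Finset.sum_mul_sum]
  refine Finset.sum_congr rfl fun j _ => Finset.sum_congr rfl fun i _ =>
    Finset.sum_congr rfl fun k _ => ?_
  have h : ∀ y : MatN (d j), ((Matrix.stdBasis ℂ (Fin (d j)) (Fin (d j))).repr y) (i, k) = y i k := by
    intro y
    simp [Matrix.stdBasis]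
  rw [h]
  simp only [LinearMap.comp_apply, LinearMap.mulLeft_apply, LinearMap.mulRight_apply, Pi.mul_apply,
    Pi.single_eq_same, Matrix.mul_apply, Matrix.single_apply]
  simp [ite_and]

lemma aux_tracial {ι : Type} [Fintype ι] [DecidableEq ι] (d : ι → ℕ)
    (τ : (∀ j, MatN (d j)) →ₗ[ℂ] ℂ) (hτ : ∀ x y, τ (x * y) = τ (y * x))
    (hpos : ∀ x, x * x = x → x ≠ 0 → ∃ r : ℕ, 1 ≤ r ∧ τ x = r) :
    ∃ c : ι → ℕ, (∀ j, 1 ≤ c j) ∧ ∀ x, τ x = ∑ j, (c j : ℂ) * (x j).trace := by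
  have key : ∀ j, ∃ c : ℕ, 1 ≤ c ∧ ∀ y : MatN (d j), τ (Pi.single j y) = c * y.trace := by
    intro j
    rcases Nat.eq_zero_or_pos (d j) with h0 | h0
    · refine ⟨1, le_rfl, fun y => ?_⟩
      have : IsEmpty (Fin (d j)) := by rw [h0]; infer_instance
      have : y = 0 := Subsingleton.elim _ _
      simp [this]
    · let i0 : Fin (d j) := ⟨0, h0⟩
      obtain ⟨c, hc, hc'⟩ := hpos (Pi.single j (Matrix.single i0 i0 1)) (by
        rw [← Pi.single_mul]; simp) (by
        intro h
        have := congrFun (congrFun (congrFun h j) i0) i0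
        simp at this)
      refine ⟨c, hc, fun y => ?_⟩
      have : τ.comp (LinearMap.single ℂ (fun j => MatN (d j)) j) =
          (c : ℂ) • Matrix.traceLinearMap (Fin (d j)) ℂ ℂ := by
        apply Matrix.ext_linearMap
        intro i k
        ext
        have e1 : (Pi.single j (Matrix.single i k (1:ℂ)) : ∀ j, MatN (d j)) =
          Pi.single j (Matrix.single i i0 1) * Pi.single j (Matrix.single i0 k 1) := by
          rw [← Pi.single_mul]; simp
        have e2 : τ (Pi.single j (Matrix.single i k (1:ℂ))) = if i = k then (c:ℂ) else 0 := by
          rw [e1, hτ, ← Pi.single_mul]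
          split_ifs with h
          · subst h; simpa using hc'
          · rw [Matrix.single_mul_single_of_ne]; simp
            exact fun h' => h h'.symm
        simp [e2]
        split_ifs with h
        · subst h; simp
        · simp [h]
      simpa using congrArg (fun f => f y) this
  choose c hc hc' using key
  refine ⟨c, hc, fun x => ?_⟩
  conv_lhs => rw [← Finset.univ_sum_single x]
  rw [map_sum]
  exact Finset.sum_congr rfl fun j _ => hc' j _

lemma aux_G {N n : ℕ} {ι : Type} [Fintype ι] [DecidableEq ι] (d : ι → ℕ)
    (A : Subalgebra ℂ (MatN N)) (e : A ≃ₐ[ℂ] ∀ j, MatN (d j)) (p : Fin n → MatN N)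
    (hp : ∀ i k, p i * p k = if i = k then p i else 0) (hs : ∑ i, p i = 1)
    (hA : ∀ i, p i ∈ A) :
    ∃ (c : ι → ℕ) (a : Fin n → ι → ℕ), (∀ j, 1 ≤ c j) ∧ ∑ j, c j * d j = N ∧
      (∀ j, ∑ i, a i j = d j) ∧ (∀ i, (p i).trace = ((∑ j, c j * a i j : ℕ) : ℂ)) ∧
      Module.finrank ℂ A = ∑ j, d j ^ 2 ∧
      Module.finrank ℂ ↥(A ⊓ commutant (Set.range p)) = ∑ i, ∑ j, a i j ^ 2 := by
  let q : Fin n → A := fun i => ⟨p i, hA i⟩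
  have hq : ∀ i k, q i * q k = if i = k then q i else 0 := by
    intro i k
    apply Subtype.ext
    simp only [q, MulMemClass.mk_mul_mk, hp]
    split_ifs <;> rfl
  have hqs : ∑ i, q i = 1 := by
    apply Subtype.ext
    simpa [q] using hs
  obtain ⟨c, hc, hc'⟩ := aux_tracial d
    ((Matrix.traceLinearMap (Fin N) ℂ ℂ).comp (A.val.toLinearMap.comp e.symm.toLinearMap))
    (by
      intro x y
      simp only [LinearMap.comp_apply, AlgEquiv.toLinearMap_apply, map_mul, AlgHom.toLinearMap_apply,
        Matrix.traceLinearMap_apply]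
      exact Matrix.trace_mul_comm _ _)
    (by
      intro x hx hx0
      obtain ⟨r, hr, hr'⟩ := aux_mat_trace_idem ((e.symm x : A) : MatN N) (by
        rw [← MulMemClass.coe_mul, ← map_mul, hx])
      refine ⟨r, ?_, by simpa using hr⟩
      rw [Nat.one_le_iff_ne_zero]
      intro h
      have := hr' h
      simp at this
      exact hx0 this)
  have hc2 : ∀ y : A, (y : MatN N).trace = ∑ j, (c j : ℂ) * (e y j).trace := by
    intro y
    simpa using hc' (e y)
  have ha : ∀ i j, ∃ r : ℕ, (e (q i) j).trace = r := by
    intro i j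
    obtain ⟨r, hr, -⟩ := aux_mat_trace_idem (e (q i) j) (by
      rw [← Pi.mul_apply, ← map_mul, hq, if_pos rfl])
    exact ⟨r, hr⟩
  choose a ha using ha
  refine ⟨c, a, hc, ?_, ?_, ?_, ?_, ?_⟩
  · have := hc2 1
    simp at this
    exact_mod_cast this.symm
  · intro j
    have h1 : ∑ i, e (q i) j = 1 := by
      rw [← Finset.sum_apply, ← map_sum, hqs, map_one, Pi.one_apply]
    have := congrArg Matrix.trace h1
    rw [Matrix.trace_sum] at this
    simp [ha] at this
    exact_mod_cast this
  · intro i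
    have := hc2 (q i)
    simp only [ha] at this
    push_cast
    exact this
  · rw [e.toLinearEquiv.finrank_eq, Module.finrank_pi_fintype]
    simp [Module.finrank_matrix, sq]
  · let E : A →ₗ[ℂ] A := ∑ i, (LinearMap.mulLeft ℂ (q i)).comp (LinearMap.mulRight ℂ (q i))
    have hE : ∀ x, E x = ∑ i, q i * x * q i := by
      intro x; simp [E, mul_assoc]
    let S : Submodule ℂ A := (Subalgebra.toSubmodule (commutant (Set.range p))).comap
      A.val.toLinearMap
    have hS : ∀ x : A, x ∈ S ↔ ∀ i, q i * x = x * q i := by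
      intro x
      simp [S, Subalgebra.mem_centralizer_iff, q, Subtype.ext_iff]
    have hproj : LinearMap.IsProj S E := by
      constructor
      · intro x
        rw [hS]
        intro i
        rw [hE, Finset.mul_sum, Finset.sum_mul]
        rw [Finset.sum_eq_single i, Finset.sum_eq_single i]
        · rw [mul_assoc _ (q i) (q i), ← mul_assoc (q i) (q i * x), ← mul_assoc (q i) (q i)]
          simp [hq]
        · intro k _ hk
          rw [mul_assoc, hq, if_neg hk, mul_zero]
        · simp
        · intro k _ hk
          rw [← mul_assoc, ← mul_assoc, hq, if_neg hk.symm, zero_mul, zero_mul]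
        · simp
      · intro x hx
        rw [hS] at hx
        rw [hE]
        calc ∑ i, q i * x * q i = ∑ i, x * q i := by
              refine Finset.sum_congr rfl fun i _ => ?_
              rw [hx, mul_assoc, hq, if_pos rfl]
          _ = x := by rw [← Finset.mul_sum, hqs, mul_one]
    have hfin : Module.finrank ℂ ↥(A ⊓ commutant (Set.range p)) = Module.finrank ℂ S := by
      have h1 := (Submodule.equivMapOfInjective A.val.toLinearMap Subtype.val_injective S).finrank_eq
      rw [h1]
      have h2 : S.map A.val.toLinearMap =
          Subalgebra.toSubmodule (A ⊓ commutant (Set.range p)) := by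
        ext x
        simp only [S, Submodule.mem_map, Submodule.mem_comap, Subalgebra.mem_toSubmodule]
        constructor
        · rintro ⟨y, hy, rfl⟩
          exact ⟨y.2, hy⟩
        · rintro ⟨hy1, hy2⟩
          exact ⟨⟨x, hy1⟩, hy2, rfl⟩
      rw [h2]
      rfl
    have : Module.Finite ℂ A := FiniteDimensional.finiteDimensional_subalgebra A
    have htr := aux_trace_proj E S hproj
    rw [← LinearMap.trace_conj' E e.toLinearEquiv] at htr
    have hconj : e.toLinearEquiv.conj E = ∑ i, (LinearMap.mulLeft ℂ (e (q i))).comp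
        (LinearMap.mulRight ℂ (e (q i))) := by
      refine LinearMap.ext fun x => ?_
      simp [LinearEquiv.conj_apply, hE, mul_assoc]
    rw [hconj, map_sum] at htr
    simp only [aux_trace_lr, ha] at htr
    rw [hfin]
    have : ((Module.finrank ℂ S : ℕ) : ℂ) = ((∑ i, ∑ j, a i j ^ 2 : ℕ) : ℂ) := by
      rw [← htr]; push_cast; simp [sq]
    exact_mod_cast this

lemma aux_numb {n N k b0 b1 c0 c1 : ℕ} (hN : 0 < N) (hk : 2 ≤ k) (A B r : Fin n → ℕ)
    (hc0 : 1 ≤ c0) (hc1 : 1 ≤ c1)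
    (hb : b0 * (N / 2) + b1 * (N / 2) = N)
    (hc : c0 * (N / 2) + c1 * (N / (2 * k)) = N)
    (hA : ∑ i, A i = N / 2) (hB : ∑ i, B i = N / (2 * k))
    (hr : ∀ i, r i = c0 * A i + c1 * B i) (hX : ∑ i, r i ^ 2 < N ^ 2) :
    2 * ((N / 2) ^ 2 + (N / (2 * k)) ^ 2) + ∑ i, r i ^ 2 <
      N ^ 2 + 2 * ∑ i, (A i ^ 2 + B i ^ 2) := by
  rw [← Nat.div_div_eq_div_mul] at *
  have hN2 : N = 2 * (N / 2) ∨ N = 2 * (N / 2) + 1 := by omega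
  generalize hh : N / 2 = h at *
  have hke : h / k * k ≤ h := Nat.div_mul_le_self h k
  have hlt : h < k → h / k = 0 := Nat.div_eq_of_lt
  generalize h / k = e at *
  have hsB : ∑ i, B i ^ 2 ≤ (∑ i, B i) ^ 2 := by
    have := aux_cross (fun _ => 0) B (by simp)
    simpa using this
  have hsA : ∑ i, A i ≤ ∑ i, A i ^ 2 :=
    Finset.sum_le_sum fun i _ => Nat.le_self_pow (by norm_num) _
  rw [Finset.sum_add_distrib]
  rw [hA] at hsA
  rw [hB] at hsB
  rcases Nat.eq_zero_or_pos h with h0 | h0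
  · subst h0; simp at hb; omega
  rcases hN2 with h2 | h2
  · rcases Nat.eq_zero_or_pos e with he | he
    · subst he
      have hc2 : c0 = 2 := by
        have : c0 * h = 2 * h := by omega
        exact Nat.eq_of_mul_eq_mul_right h0 this
      have hB0 : ∀ i, B i = 0 := by simpa using hB
      have : ∑ i, r i ^ 2 = 4 * ∑ i, A i ^ 2 := by
        rw [Finset.mul_sum]
        refine Finset.sum_congr rfl fun i _ => ?_
        rw [hr, hB0, hc2]; ring
      have hNN : N ^ 2 = 4 * h ^ 2 := by rw [h2]; ring
      omega
    · have hc01 : c0 = 1 := by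
        by_contra hcc
        have : 2 ≤ c0 := by omega
        have h3 := Nat.mul_le_mul_right h this
        have h4 : 1 * 1 ≤ c1 * e := Nat.mul_le_mul hc1 he
        omega
      subst hc01
      have hce : c1 * e = h := by omega
      have hc2 : 2 ≤ c1 := by
        by_contra hcc
        have : c1 = 1 := by omega
        subst this
        nlinarith
      by_contra hcon
      push Not at hcon
      have e1 : ∑ i, ((A i : ℤ) - c1 * B i) ^ 2 + ∑ i, (r i : ℤ) ^ 2 =
          2 * ∑ i, (A i : ℤ) ^ 2 + 2 * c1 ^ 2 * ∑ i, (B i : ℤ) ^ 2 := by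
        rw [Finset.mul_sum, Finset.mul_sum, ← Finset.sum_add_distrib, ← Finset.sum_add_distrib]
        refine Finset.sum_congr rfl fun i _ => ?_
        rw [hr]; push_cast; ring
      have e0 : 0 ≤ ∑ i, ((A i : ℤ) - c1 * B i) ^ 2 := Finset.sum_nonneg fun i _ => sq_nonneg _
      zify at hcon hsB hX hce h2 hc2
      rw [h2] at hcon hX
      rw [← hce] at hcon hX
      have e3 : (∑ i, (B i : ℤ) ^ 2) = e ^ 2 := by
        apply le_antisymm hsB
        by_contra hlt2
        push Not at hlt2
        have hc3 : (0 : ℤ) < (c1 : ℤ) ^ 2 - 1 := by nlinarith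
        have := mul_pos hc3 (sub_pos.mpr hlt2)
        nlinarith
      rw [e3] at e1 hcon
      have e4 : ∑ i, ((A i : ℤ) - c1 * B i) ^ 2 = 0 := by nlinarith
      rw [Finset.sum_eq_zero_iff_of_nonneg (fun i _ => sq_nonneg _)] at e4
      have e5 : ∑ i, (A i : ℤ) ^ 2 = c1 ^ 2 * ∑ i, (B i : ℤ) ^ 2 := by
        rw [Finset.mul_sum]
        refine Finset.sum_congr rfl fun i hi => ?_
        have := pow_eq_zero_iff (two_ne_zero) |>.mp (e4 i hi)
        rw [sub_eq_zero.mp this]; ring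
      rw [e3] at e5
      nlinarith
  · have hh1 : h = 1 := by
      have : h ∣ 1 := by
        have h3 : h ∣ 2 * h + 1 := ⟨b0 + b1, by rw [← h2, ← hb]; ring⟩
        exact (Nat.dvd_add_right (Dvd.intro_left 2 rfl)).mp h3
      exact Nat.dvd_one.mp this
    have he : e = 0 := hlt (by omega)
    subst he hh1
    omega

lemma aux_center {N : ℕ} (hN : 0 < N) (B2 : StarSubalgebra ℂ (MatN N)) (hB2 : B2 ≠ ⊤)
    (hC : Module.finrank ℂ (Subalgebra.center ℂ ↥B2) = 1) :
    ∃ d : ℕ, d ≠ N ∧ Nonempty (B2 ≃ₐ[ℂ] (∀ _ : Fin 1, MatN d)) := by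
  obtain ⟨n, d, hd, ⟨e⟩⟩ := aux_wedderburn B2
  have hfin : FiniteDimensional ℂ B2 :=
    inferInstanceAs (FiniteDimensional ℂ (Subalgebra.toSubmodule B2.toSubalgebra))
  have hle : n ≤ 1 := by
    let g : (Fin n → ℂ) →ₗ[ℂ] (∀ i, MatN (d i)) :=
      { toFun := fun f i => f i • (1 : MatN (d i))
        map_add' := fun f f' => by funext i; exact add_smul _ _ _
        map_smul' := fun t f => by funext i; exact mul_smul _ _ _ }
    have hg : ∀ f x, x * g f = g f * x := by
      intro f x
      funext i
      show x i * (f i • (1 : MatN (d i))) = (f i • (1 : MatN (d i))) * x i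
      simp
    have hginj : Function.Injective g := by
      intro f f' h
      funext i
      have h0 := (hd i).out
      have := congrFun (congrFun (congrFun h i) ⟨0, by omega⟩) ⟨0, by omega⟩
      simpa [g] using this
    let G : (Fin n → ℂ) →ₗ[ℂ] Subalgebra.center ℂ ↥B2 :=
      LinearMap.codRestrict (Subalgebra.toSubmodule (Subalgebra.center ℂ ↥B2))
        (e.symm.toLinearMap.comp g) (by
          intro f
          rw [Subalgebra.mem_toSubmodule, Subalgebra.mem_center_iff]
          intro b
          apply e.injective
          simp [hg])
    have hG : Function.Injective G := by
      intro f f' h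
      apply hginj
      apply e.symm.injective
      exact congrArg Subtype.val h
    have hfc : FiniteDimensional ℂ (Subalgebra.center ℂ ↥B2) :=
      FiniteDimensional.of_finrank_pos (by omega)
    have := LinearMap.finrank_le_finrank_of_injective hG
    simpa [hC] using this
  have hne : n ≠ 0 := by
    rintro rfl
    have h1 : (1 : B2) = 0 := e.injective (Subsingleton.elim _ _)
    have h2 : (1 : MatN N) = 0 := congrArg Subtype.val h1
    have := congrFun (congrFun h2 ⟨0, hN⟩) ⟨0, hN⟩
    simp at this
  obtain rfl : n = 1 := by omega
  have hdd : d = fun _ => d 0 := by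
    funext i
    rw [Subsingleton.elim i 0]
  generalize d 0 = d0 at hdd
  subst hdd
  refine ⟨d0, ?_, ⟨e⟩⟩
  rintro rfl
  apply hB2
  have h1 : Module.finrank ℂ (Subalgebra.toSubmodule B2.toSubalgebra) =
      Module.finrank ℂ (MatN d0) := by
    have := e.toLinearEquiv.finrank_eq
    rw [Module.finrank_pi_fintype, Fin.sum_univ_one] at this
    exact this
  have h2 := Submodule.eq_top_of_finrank_eq h1
  rw [eq_top_iff]
  intro x _
  have : x ∈ Subalgebra.toSubmodule B2.toSubalgebra := by rw [h2]; trivial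
  exact this

/-- Product of two matrix algebras as a dependent product over `Fin 2`. -/
def auxProdEquiv (a b : ℕ) : (MatN a × MatN b) ≃ₐ[ℂ] (∀ j : Fin 2, MatN (![a, b] j)) :=
  AlgEquiv.symm (AlgEquiv.ofRingEquiv
    (f := (RingEquiv.piFinTwo (fun j : Fin 2 => MatN (![a, b] j)) :
      (∀ j : Fin 2, MatN (![a, b] j)) ≃+* (MatN a × MatN b))) (fun _ => rfl))

/-- Non-simple case: with `B1 ≅ ⊕^{l1} M_{N/l1}`, `l1 ≥ 2`, and one of the three conditions
on `B2`, every commutative unital C*-subalgebra `B ≠ ℂ·1` of `B1` unitarily embeddable into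
`B2` satisfies `(dim B1 − dim(B1 ∩ B')) + (dim B2 − dim(B2 ∩ u*B'u)) + dim B' < N²`. -/
theorem dB_lt_Nsq_nonsimple_case (N l1 : ℕ) (hN : 0 < N) (hl1 : 2 ≤ l1)
    (B1 B2 : StarSubalgebra ℂ (MatN N)) (hB1 : B1 ≠ ⊤) (hB2 : B2 ≠ ⊤)
    (hC1 : Module.finrank ℂ (Subalgebra.center ℂ ↥B1) = l1)
    (e1 : Nonempty (↥B1 ≃⋆ₐ[ℂ] (Fin l1 → MatN (N / l1))))
    (hcases :
      -- (a) B2 simple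
      (Module.finrank ℂ (Subalgebra.center ℂ ↥B2) = 1) ∨
      -- (b) B1 ≅ M_{N/2} ⊕ M_{N/2} and B2 ≅ M_{N/2} ⊕ M_{N/(2k)}, k ≥ 2
      (Nonempty (↥B1 ≃⋆ₐ[ℂ] (MatN (N / 2) × MatN (N / 2))) ∧
        ∃ k : ℕ, 2 ≤ k ∧
          Nonempty (↥B2 ≃⋆ₐ[ℂ] (MatN (N / 2) × MatN (N / (2 * k))))) ∨
      -- (c) dim C(B2) = l2 ≥ 3 and B2 ≅ ⊕^{l2} M_{N/l2}
      (∃ l2 : ℕ, 3 ≤ l2 ∧ Module.finrank ℂ (Subalgebra.center ℂ ↥B2) = l2 ∧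
        Nonempty (↥B2 ≃⋆ₐ[ℂ] (Fin l2 → MatN (N / l2)))))
    (B : StarSubalgebra ℂ (MatN N)) (hB : B ≤ B1)
    (hBcomm : ∀ x ∈ B, ∀ y ∈ B, x * y = y * x)
    (hBdim : 2 ≤ Module.finrank ℂ ↥B)
    (u : MatN N) (hu : u ∈ unitary (MatN N))
    (huB : ∀ b ∈ B, star u * b * u ∈ B2) :
    (Module.finrank ℂ ↥B1 -
        Module.finrank ℂ ↥(B1.toSubalgebra ⊓ commutant (B : Set (MatN N)))) +
      (Module.finrank ℂ ↥B2 -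
        Module.finrank ℂ ↥(Submodule.span ℂ ((B2 : Set (MatN N)) ∩
          ((fun x => star u * x * u) '' (commutant (B : Set (MatN N)) : Set (MatN N)))))) +
      Module.finrank ℂ ↥(commutant (B : Set (MatN N))) < N ^ 2 := by
  obtain ⟨p, hp, hps, hpB, hp0, hcomm⟩ := aux_projs B hBcomm
  generalize Module.finrank ℂ ↥B = n at hBdim p
  have huu : u * star u = 1 := (Unitary.mem_iff.mp hu).2
  have huu' : star u * u = 1 := (Unitary.mem_iff.mp hu).1
  let p' : Fin n → MatN N := fun i => star u * p i * u
  have hp' : ∀ i k, p' i * p' k = if i = k then p' i else 0 := by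
    intro i k
    have : p' i * p' k = star u * (p i * p k) * u := by
      calc star u * p i * u * (star u * p k * u) = star u * p i * (u * star u) * p k * u := by
            noncomm_ring
        _ = _ := by rw [huu]; noncomm_ring
    rw [this, hp]
    split_ifs <;> simp [p']
  have hps' : ∑ i, p' i = 1 := by
    simp only [p']
    rw [← Finset.sum_mul, ← Finset.mul_sum, hps, mul_one, huu']
  have hp'B : ∀ i, p' i ∈ B2.toSubalgebra := fun i => huB _ (hpB i)
  have hp1 : ∀ i, p i ∈ B1.toSubalgebra := fun i => hB (hpB i)
  have htr' : ∀ i, (p' i).trace = (p i).trace := by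
    intro i
    simp only [p']
    rw [Matrix.trace_mul_comm, ← mul_assoc, huu, one_mul]
  have hset : ((B2 : Set (MatN N)) ∩
      ((fun x => star u * x * u) '' (commutant (B : Set (MatN N)) : Set (MatN N)))) =
      (Subalgebra.toSubmodule (B2.toSubalgebra ⊓ commutant (Set.range p')) : Set (MatN N)) := by
    rw [hcomm]
    ext x
    constructor
    · rintro ⟨hx, y, hy, rfl⟩
      refine ⟨hx, ?_⟩
      rw [SetLike.mem_coe, Subalgebra.mem_centralizer_iff] at hy
      show _ ∈ commutant (Set.range p')
      rw [Subalgebra.mem_centralizer_iff]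
      rintro _ ⟨i, rfl⟩
      have h1 := hy (p i) ⟨i, rfl⟩
      calc star u * p i * u * (star u * y * u) = star u * (p i * (u * star u) * y) * u := by
            noncomm_ring
        _ = star u * (y * (u * star u) * p i) * u := by rw [huu, mul_one, mul_one, h1]
        _ = _ := by simp only [p']; noncomm_ring
    · rintro ⟨hx, hx2⟩
      refine ⟨hx, u * x * star u, ?_, ?_⟩
      · have hx3 : x ∈ commutant (Set.range p') := hx2
        rw [Subalgebra.mem_centralizer_iff] at hx3
        rw [SetLike.mem_coe, Subalgebra.mem_centralizer_iff]
        rintro _ ⟨i, rfl⟩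
        have h1 : star u * p i * u * x = x * (star u * p i * u) := hx3 (p' i) ⟨i, rfl⟩
        calc p i * (u * x * star u) = (u * star u) * p i * (u * x * star u) := by
              rw [huu, one_mul]
          _ = u * (star u * p i * u * x) * star u := by noncomm_ring
          _ = u * x * star u * p i * (u * star u) := by rw [h1]; noncomm_ring
          _ = _ := by rw [huu, mul_one]
      · show star u * (u * x * star u) * u = x
        calc star u * (u * x * star u) * u = (star u * u) * x * (star u * u) := by noncomm_ring
          _ = x := by rw [huu', one_mul, mul_one]
  rw [hset, Submodule.span_eq, hcomm]
  have hfin2 : Module.finrank ℂ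
      ↥(Subalgebra.toSubmodule (B2.toSubalgebra ⊓ commutant (Set.range p'))) =
      Module.finrank ℂ ↥(B2.toSubalgebra ⊓ commutant (Set.range p')) := rfl
  rw [hfin2]
  obtain ⟨ct, aT, hct, hct1, hat, htrt, -, hdimt⟩ := aux_G (fun _ : Fin 1 => N) ⊤
    (Subalgebra.topEquiv.trans (AlgEquiv.funUnique ℂ (Fin 1) (MatN N)).symm) p hp hps
    (fun _ => trivial)
  rw [top_inf_eq] at hdimt
  have hct0 : ct 0 = 1 := by
    simp at hct1
    exact Nat.eq_of_mul_eq_mul_right hN (by simpa using hct1)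
  obtain ⟨r, hrdef⟩ : ∃ r : Fin n → ℕ, r = fun i => aT i 0 := ⟨_, rfl⟩
  have hrtr : ∀ i, (p i).trace = (r i : ℂ) := by
    intro i; rw [htrt]; simp [hct0, hrdef]
  have hrs : ∑ i, r i = N := by simpa [hrdef] using hat 0
  have hdimB' : Module.finrank ℂ ↥(commutant (Set.range p)) = ∑ i, r i ^ 2 := by
    rw [hdimt]; simp [hrdef]
  have hr1 : ∀ i, 1 ≤ r i := by
    intro i
    obtain ⟨s, hs, hs0⟩ := aux_mat_trace_idem (p i) (by rw [hp, if_pos rfl])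
    rw [hrtr] at hs
    have : r i = s := by exact_mod_cast hs
    rw [this]
    exact Nat.one_le_iff_ne_zero.mpr fun h => hp0 i (hs0 h)
  have hX : ∑ i, r i ^ 2 < N ^ 2 := aux_Xpos hBdim r hr1 hrs
  rw [hdimB']
  have hD1 : 2 * Module.finrank ℂ ↥B1 + ∑ i, r i ^ 2 ≤ N ^ 2 + 2 * Module.finrank ℂ
      ↥(B1.toSubalgebra ⊓ commutant (Set.range p)) := by
    obtain ⟨e1⟩ := e1
    obtain ⟨c, a, hc, hc1, ha, htr, hdim, hdimc⟩ := aux_G (fun _ : Fin l1 => N / l1)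
      B1.toSubalgebra e1.toAlgEquiv p hp hps hp1
    have h1 := aux_num c a r hc ha (fun i => by
      have := htr i; rw [hrtr] at this; exact_mod_cast this) hrs
    rw [← hdim, ← hdimc] at h1
    have hle : Module.finrank ℂ ↥(B1.toSubalgebra ⊓ commutant (Set.range p)) ≤
        Module.finrank ℂ ↥B1.toSubalgebra :=
      Submodule.finrank_mono (s := Subalgebra.toSubmodule (B1.toSubalgebra ⊓ commutant (Set.range p)))
        (t := Subalgebra.toSubmodule B1.toSubalgebra) (fun x hx => hx.1)
    have hid : Module.finrank ℂ ↥B1 = Module.finrank ℂ ↥B1.toSubalgebra := rfl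
    rw [hid]
    obtain ⟨t, ht⟩ := Nat.exists_eq_add_of_le hle
    rw [ht] at h1 ⊢
    have : 2 * t ≤ l1 * t := Nat.mul_le_mul_right _ hl1
    have h3 : l1 * (Module.finrank ℂ ↥(B1.toSubalgebra ⊓ commutant (Set.range p)) + t) =
      l1 * Module.finrank ℂ ↥(B1.toSubalgebra ⊓ commutant (Set.range p)) + l1 * t := by ring
    omega
  have hD2 : 2 * Module.finrank ℂ ↥B2 + ∑ i, r i ^ 2 < N ^ 2 + 2 * Module.finrank ℂ
      ↥(B2.toSubalgebra ⊓ commutant (Set.range p')) := by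
    have hid : Module.finrank ℂ ↥B2 = Module.finrank ℂ ↥B2.toSubalgebra := rfl
    rw [hid]
    have hle : Module.finrank ℂ ↥(B2.toSubalgebra ⊓ commutant (Set.range p')) ≤
        Module.finrank ℂ ↥B2.toSubalgebra :=
      Submodule.finrank_mono
        (s := Subalgebra.toSubmodule (B2.toSubalgebra ⊓ commutant (Set.range p')))
        (t := Subalgebra.toSubmodule B2.toSubalgebra) (fun x hx => hx.1)
    obtain ⟨t, ht⟩ := Nat.exists_eq_add_of_le hle
    rcases hcases with hC | ⟨⟨f1⟩, k, hk, ⟨f2⟩⟩ | ⟨l2, hl2, -, ⟨f2⟩⟩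
    · obtain ⟨d, hdN, ⟨f2⟩⟩ := aux_center hN B2 hB2 hC
      obtain ⟨c, a, hc, hc1, ha, htr, hdim, hdimc⟩ := aux_G (fun _ : Fin 1 => d)
        B2.toSubalgebra f2 p' hp' hps' hp'B
      have hr : ∀ i, r i = c 0 * a i 0 := by
        intro i
        have := htr i
        rw [htr', hrtr] at this
        have h2 : r i = ∑ j, c j * a i j := by exact_mod_cast this
        simpa using h2
      have hc0 := hc 0
      simp at hc1 hdim hdimc
      have hc2 : 2 ≤ c 0 := by
        by_contra hcc
        have : c 0 = 1 := by omega
        rw [this, one_mul] at hc1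
        exact hdN hc1
      have h1 : ∑ i, r i ^ 2 = c 0 ^ 2 * ∑ i, a i 0 ^ 2 := by
        rw [Finset.mul_sum]
        exact Finset.sum_congr rfl fun i _ => by rw [hr]; ring
      have h4 : 4 * t ≤ c 0 ^ 2 * t := Nat.mul_le_mul_right _ (by nlinarith)
      have h5 : N ^ 2 = c 0 ^ 2 * ∑ i, a i 0 ^ 2 + c 0 ^ 2 * t := by
        rw [← hc1, mul_pow, ← hdim, ← hdimc, ht]; ring
      omega
    · obtain ⟨b, _, -, hb1, -⟩ := aux_G ![N / 2, N / 2]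
        B1.toSubalgebra (f1.toAlgEquiv.trans (auxProdEquiv _ _)) p hp hps hp1
      obtain ⟨c, a, hc, hc1, ha, htr, hdim, hdimc⟩ := aux_G ![N / 2, N / (2 * k)]
        B2.toSubalgebra (f2.toAlgEquiv.trans (auxProdEquiv _ _)) p' hp' hps' hp'B
      have hr : ∀ i, r i = c 0 * a i 0 + c 1 * a i 1 := by
        intro i
        have := htr i
        rw [htr', hrtr] at this
        have h2 : r i = ∑ j, c j * a i j := by exact_mod_cast this
        simpa [Fin.sum_univ_two] using h2
      simp only [Fin.sum_univ_two, Matrix.cons_val_zero, Matrix.cons_val_one] at hb1 hc1 hdim hdimc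
      have := aux_numb hN hk (fun i => a i 0) (fun i => a i 1) r (hc 0) (hc 1)
        hb1 hc1 (ha 0) (ha 1) hr hX
      rw [hdim, hdimc]
      exact this
    · obtain ⟨c, a, hc, hc1, ha, htr, hdim, hdimc⟩ := aux_G (fun _ : Fin l2 => N / l2)
        B2.toSubalgebra f2.toAlgEquiv p' hp' hps' hp'B
      have h1 := aux_num c a r hc ha (fun i => by
        have := htr i; rw [htr', hrtr] at this; exact_mod_cast this) hrs
      rw [← hdim, ← hdimc] at h1
      rw [ht] at h1 ⊢
      have : 3 * t ≤ l2 * t := Nat.mul_le_mul_right _ hl2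
      rw [mul_add] at h1
      omega
  omega
end
end

section
/- Let A1 and A2 be finite-dimensional unital C*-algebras over ℂ, let H be a finite-dimensional complex Hilbert space, and let π_1 : A1 → B(H), π_2 : A2 → B(H) be unital *-homomorphisms. Then there exist a finite-dimensional complex Hilbert space Ĥ and unital *-homomorphisms π̂_1 : A1 → B(Ĥ), π̂_2 : A2 → B(Ĥ) such that for each i = 1, 2, the representation π_i ⊕ π̂_i : A_i → B(H ⊕ Ĥ) satisfies the Rank of Central Projections (RCP) condition: the rank of (π_i ⊕ π̂_i)(p) is the same for all minimal projections p of the center of A_i. -/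
set_option synthInstance.maxHeartbeats 1000000
set_option maxHeartbeats 1000000

noncomputable section

/-- The finite-dimensional Hilbert space `ℂ^m`. -/
abbrev HS (m : ℕ) := EuclideanSpace ℂ (Fin m)

/-- `B(H)` for `H = ℂ^m`. -/
abbrev BH (m : ℕ) := HS m →L[ℂ] HS m

/-- `p` is a minimal projection of the center of `A`. -/
def IsMinCentralProjection {A : Type*} [Ring A] [StarRing A] (p : A) : Prop :=
  p ≠ 0 ∧ star p = p ∧ p * p = p ∧ (∀ b : A, p * b = b * p) ∧
    ∀ q : A, (∀ b : A, q * b = b * q) → star q = q → q * q = q → q * p = q →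
      q = 0 ∨ q = p

/-- The rank of an operator on `ℂ^m ⊕ ℂ^{m'}`. -/
def prodRank {m m' : ℕ} (f : HS m × HS m' →L[ℂ] HS m × HS m') : ℕ :=
  Module.finrank ℂ (LinearMap.range (f : HS m × HS m' →ₗ[ℂ] HS m × HS m'))


section trace
variable {A : Type*} [NormedRing A] [StarRing A] [CStarRing A] [NormedAlgebra ℂ A]
      [StarModule ℂ A] [FiniteDimensional ℂ A]

/-- trace of left multiplication -/
def lmTr (A : Type*) [NormedRing A] [NormedAlgebra ℂ A] : A →ₗ[ℂ] ℂ :=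
  (LinearMap.trace ℂ A).comp (Algebra.lmul ℂ A).toLinearMap

lemma lmTr_eq (a : A) : lmTr A a = (Algebra.lmul ℂ A a).charpoly.roots.sum := by
  change LinearMap.trace ℂ A (Algebra.lmul ℂ A a) = _
  exact Module.End.trace_eq_sum_roots_charpoly_of_splits (IsAlgClosed.splits _)

lemma root_spec (a : A) (z : ℂ) (hz : z ∈ (Algebra.lmul ℂ A a).charpoly.roots) :
    z ∈ spectrum ℂ a := by
  have h1 := Polynomial.isRoot_of_mem_roots hz
  rw [← Module.End.hasEigenvalue_iff_isRoot_charpoly,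
    Module.End.hasEigenvalue_iff_mem_spectrum] at h1
  exact AlgHom.spectrum_apply_subset (Algebra.lmul ℂ A) a h1

lemma spec_real {a : A} (ha : IsSelfAdjoint a) {z : ℂ} (hz : z ∈ spectrum ℂ a) : z = z.re := by
  let _ : CStarAlgebra A :=
    { ‹NormedRing A›, ‹StarRing A›, ‹CStarRing A›, ‹NormedAlgebra ℂ A›, ‹StarModule ℂ A› with
      complete := (FiniteDimensional.complete ℂ A).complete }
  exact ha.mem_spectrum_eq_re hz

lemma spec_nonneg {a : A} {z : ℂ} (hz : z ∈ spectrum ℂ (star a * a)) : 0 ≤ z.re := by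
  let _ : CStarAlgebra A :=
    { ‹NormedRing A›, ‹StarRing A›, ‹CStarRing A›, ‹NormedAlgebra ℂ A›, ‹StarModule ℂ A› with
      complete := (FiniteDimensional.complete ℂ A).complete }
  have h := spec_real (IsSelfAdjoint.star_mul_self a) hz
  rw [h] at hz
  have := (spectrum.algebraMap_mem_iff ℂ (R := ℝ) (r := z.re) (a := star a * a)).1 hz
  exact spectrum_star_mul_self_nonneg _ this

lemma lmTr_im {a : A} (ha : IsSelfAdjoint a) : (lmTr A a).im = 0 := by
  rw [lmTr_eq]
  have h : ∀ z ∈ (Algebra.lmul ℂ A a).charpoly.roots, z.im = 0 := fun z hz => by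
    have := spec_real ha (root_spec a z hz)
    rw [this]; simp
  generalize (Algebra.lmul ℂ A a).charpoly.roots = s at h
  induction s using Multiset.induction with
  | empty => simp
  | cons x s ih => simp_all

lemma lmTr_star (a : A) : lmTr A (star a) = star (lmTr A a) := by
  have hr := lmTr_im (realPart a).2
  have hi := lmTr_im (imaginaryPart a).2
  have h := realPart_add_I_smul_imaginaryPart a
  have e1 : lmTr A a = lmTr A (realPart a : A) + Complex.I * lmTr A (imaginaryPart a : A) := by
    conv_lhs => rw [← h]
    simp
  have e2 : lmTr A (star a) = lmTr A (realPart a : A) - Complex.I * lmTr A (imaginaryPart a : A) := by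
    conv_lhs => rw [← h]
    simp [(realPart a).2.star_eq, (imaginaryPart a).2.star_eq, sub_eq_add_neg]
  rw [e2, e1]
  apply Complex.ext <;> simp [hr, hi]

lemma lmTr_re_nonneg (a : A) : 0 ≤ (lmTr A (star a * a)).re := by
  rw [lmTr_eq]
  have h : ∀ z ∈ (Algebra.lmul ℂ A (star a * a)).charpoly.roots, 0 ≤ z.re :=
    fun z hz => spec_nonneg (root_spec _ z hz)
  generalize (Algebra.lmul ℂ A (star a * a)).charpoly.roots = s at h
  induction s using Multiset.induction with
  | empty => simp
  | cons x s ih => simp_all; linarith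

lemma sum_zero (s : Multiset ℂ) (h : ∀ z ∈ s, 0 ≤ z.re) (hs : s.sum.re = 0) :
    0 ≤ s.sum.re ∧ ∀ z ∈ s, z.re = 0 := by
  have key : ∀ s : Multiset ℂ, (∀ z ∈ s, 0 ≤ z.re) →
     0 ≤ s.sum.re ∧ (s.sum.re = 0 → ∀ z ∈ s, z.re = 0) := by
    intro s
    induction s using Multiset.induction with
    | empty => simp
    | cons x s ih =>
      intro h
      have h1 := ih (fun z hz => h z (Multiset.mem_cons_of_mem hz))
      have h2 := h x (Multiset.mem_cons_self x s)
      simp only [Multiset.sum_cons, Complex.add_re]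
      refine ⟨by linarith [h1.1], fun h3 z hz => ?_⟩
      rcases Multiset.mem_cons.1 hz with rfl | hz
      · linarith [h1.1]
      · exact h1.2 (by linarith [h1.1]) z hz
  exact ⟨(key s h).1, (key s h).2 hs⟩

lemma sa_nilpotent {a : A} (ha : IsSelfAdjoint a) (h : IsNilpotent a) : a = 0 := by
  obtain ⟨n, hn⟩ := h
  have h1 := ha.nnnorm_pow_two_pow n
  have h2 : a ^ 2 ^ n = 0 := pow_eq_zero_of_le Nat.lt_two_pow_self.le hn
  rw [h2, nnnorm_zero] at h1
  exact nnnorm_eq_zero.1 (pow_eq_zero_iff (by positivity) |>.1 h1.symm)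

lemma lmTr_def (a : A) (h : lmTr A (star a * a) = 0) : a = 0 := by
  have hsa := IsSelfAdjoint.star_mul_self a
  rw [lmTr_eq] at h
  have h1 := (sum_zero _ (fun z hz => spec_nonneg (root_spec _ z hz)) (by rw [h]; rfl)).2
  have h2 : ∀ z ∈ (Algebra.lmul ℂ A (star a * a)).charpoly.roots, z = 0 := fun z hz => by
    rw [spec_real hsa (root_spec _ z hz), h1 z hz]; rfl
  have h3 : IsNilpotent (Algebra.lmul ℂ A (star a * a)) := by
    refine ⟨Multiset.card (Algebra.lmul ℂ A (star a * a)).charpoly.roots, ?_⟩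
    have h4 := (IsAlgClosed.splits (Algebra.lmul ℂ A (star a * a)).charpoly).eq_prod_roots_of_monic
      (LinearMap.charpoly_monic _)
    rw [Multiset.eq_replicate_of_mem h2] at h4
    have h5 := LinearMap.aeval_self_charpoly (Algebra.lmul ℂ A (star a * a))
    rw [h4] at h5
    simpa using h5
  have h6 : IsNilpotent (star a * a) := by
    obtain ⟨n, hn⟩ := h3
    refine ⟨n, ?_⟩
    rw [← map_pow] at hn
    have := LinearMap.congr_fun hn 1
    simpa using this
  exact (CStarRing.star_mul_self_eq_zero_iff a).1 (sa_nilpotent hsa h6)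

/-- The GNS inner product. -/
@[reducible] def gnsCore (A : Type*) [NormedRing A] [StarRing A] [CStarRing A] [NormedAlgebra ℂ A]
      [StarModule ℂ A] [FiniteDimensional ℂ A] : InnerProductSpace.Core ℂ A where
  inner x y := lmTr A (star x * y)
  conj_inner_symm x y := by
    have := lmTr_star (star y * x)
    simp only [star_mul, star_star] at this
    exact this.symm
  re_inner_nonneg x := lmTr_re_nonneg x
  add_left x y z := by simp [add_mul]
  smul_left x y r := by simp
  definite x h := lmTr_def x h

end trace

section compress

lemma compress_aux {A : Type*} [Ring A] [StarRing A] [Algebra ℂ A]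
    {V : Type*} [NormedAddCommGroup V] [InnerProductSpace ℂ V] [FiniteDimensional ℂ V]
    (φ : A →ₐ[ℂ] Module.End ℂ V)
    (hφ : ∀ a x y, inner ℂ (φ a x) y = inner ℂ x (φ (star a) y))
    (p : A) (hp : p * p = p) (hc : ∀ b, p * b = b * p) :
    ∃ τ : A →⋆ₐ[ℂ] Matrix (Fin (Module.finrank ℂ (LinearMap.range (φ p))))
      (Fin (Module.finrank ℂ (LinearMap.range (φ p)))) ℂ, τ p = 1 := by
  have hinv : ∀ a, ∀ x ∈ LinearMap.range (φ p), φ a x ∈ LinearMap.range (φ p) := by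
    rintro a _ ⟨y, rfl⟩
    refine ⟨φ a y, ?_⟩
    rw [← Module.End.mul_apply, ← Module.End.mul_apply, ← map_mul, ← map_mul, hc]
  let ψ : A →ₐ[ℂ] Module.End ℂ (LinearMap.range (φ p)) :=
    { toFun := fun a => (φ a).restrict (hinv a)
      map_one' := by ext x; simp
      map_mul' := fun a b => by ext x; simp
      map_zero' := by ext x; simp
      map_add' := fun a b => by ext x; simp
      commutes' := fun r => by ext x; simp }
  have hψ : ∀ a, ψ (star a) = star (ψ a) := by
    intro a
    rw [LinearMap.star_eq_adjoint, LinearMap.eq_adjoint_iff]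
    intro x y
    have := hφ (star a) x y
    rw [star_star] at this
    exact this
  let b := stdOrthonormalBasis ℂ (LinearMap.range (φ p))
  let Ψ : A →⋆ₐ[ℂ] Module.End ℂ (LinearMap.range (φ p)) := { ψ with map_star' := hψ }
  refine ⟨((LinearMap.toMatrixOrthonormal b : _ ≃⋆ₐ[ℂ] _) : _ →⋆ₐ[ℂ] _).comp Ψ, ?_⟩
  have h1 : Ψ p = 1 := by
    ext ⟨x, y, rfl⟩
    change φ p (φ p y) = φ p y
    rw [← Module.End.mul_apply, ← map_mul, hp]
  simp [h1]

lemma compress {A : Type*} [Ring A] [StarRing A] [Algebra ℂ A]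
    {V : Type*} [AddCommGroup V] [Module ℂ V] [FiniteDimensional ℂ V]
    (c : InnerProductSpace.Core ℂ V)
    (φ : A →ₐ[ℂ] Module.End ℂ V)
    (hφ : ∀ a x y, c.inner (φ a x) y = c.inner x (φ (star a) y))
    (p : A) (hp : p * p = p) (hc : ∀ b, p * b = b * p) :
    ∃ τ : A →⋆ₐ[ℂ] Matrix (Fin (Module.finrank ℂ (LinearMap.range (φ p))))
      (Fin (Module.finrank ℂ (LinearMap.range (φ p)))) ℂ, τ p = 1 := by
  let _ : NormedAddCommGroup V := c.toNormedAddCommGroup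
  let _ : InnerProductSpace ℂ V := InnerProductSpace.ofCore c.toCore
  exact compress_aux φ hφ p hp hc

end compress

section proj
variable {A : Type*} [Ring A] [StarRing A] [Algebra ℂ A]

lemma minproj_orth {p q : A} (hp : IsMinCentralProjection p) (hq : IsMinCentralProjection q)
    (h : p ≠ q) : p * q = 0 := by
  obtain ⟨hp0, hps, hpp, hpc, hpm⟩ := hp
  obtain ⟨hq0, hqs, hqq, hqc, hqm⟩ := hq
  have c1 : ∀ b, p * q * b = b * (p * q) := fun b => by
    rw [mul_assoc, hqc, ← mul_assoc, hpc b, mul_assoc]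
  have c2 : star (p * q) = p * q := by rw [star_mul, hps, hqs, hpc]
  have c3 : p * q * q = p * q := by rw [mul_assoc, hqq]
  have c4 : p * q * p = p * q := by rw [mul_assoc, ← hpc q, ← mul_assoc, hpp]
  have c5 : p * q * (p * q) = p * q := by rw [← mul_assoc, c4, c3]
  rcases hpm _ c1 c2 c5 c4 with h1 | h1
  · exact h1
  · rcases hqm _ c1 c2 c5 c3 with h2 | h2
    · exact h2
    · exact absurd (h1.symm.trans h2) h

lemma minproj_finite (A : Type*) [Ring A] [StarRing A] [Algebra ℂ A] [FiniteDimensional ℂ A] :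
    {p : A | IsMinCentralProjection p}.Finite := by
  refine LinearIndependent.setFinite (R := ℂ) ?_
  rw [linearIndependent_iff']
  intro s g hg i hi
  have h := congrArg (fun x => x * (i : A)) hg
  simp only [Finset.sum_mul, zero_mul, smul_mul_assoc] at h
  rw [Finset.sum_eq_single i] at h
  · rw [i.2.2.2.1] at h
    exact (smul_eq_zero.1 h).resolve_right i.2.1
  · intro j _ hj
    rw [minproj_orth j.2 i.2 (fun h => hj (Subtype.ext h)), smul_zero]
  · exact fun h => absurd hi h

lemma minproj_below [FiniteDimensional ℂ A] (e : A) (he0 : e ≠ 0)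
    (hes : star e = e) (hee : e * e = e) (hec : ∀ b, e * b = b * e) :
    ∃ q, IsMinCentralProjection q ∧ q * e = q := by
  let S : Set A := {q | q ≠ 0 ∧ star q = q ∧ q * q = q ∧ (∀ b, q * b = b * q) ∧ q * e = q}
  let f : A → ℕ := fun q => Module.finrank ℂ (LinearMap.range (LinearMap.mulLeft ℂ q))
  obtain ⟨q, hq, hmin⟩ : ∃ q ∈ S, ∀ q' ∈ S, f q ≤ f q' := by
    have hne : (f '' S).Nonempty := ⟨f e, e, ⟨he0, hes, hee, hec, hee⟩, rfl⟩
    obtain ⟨q, hq, h⟩ := Nat.sInf_mem hne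
    exact ⟨q, hq, fun q' hq' => h ▸ Nat.sInf_le ⟨q', hq', rfl⟩⟩
  obtain ⟨hq0, hqs, hqq, hqc, hqe⟩ := hq
  refine ⟨q, ⟨hq0, hqs, hqq, hqc, ?_⟩, hqe⟩
  intro r hrc hrs hrr hrq
  by_cases hr0 : r = 0
  · exact Or.inl hr0
  right
  have h1 := hmin r ⟨hr0, hrs, hrr, hrc, by rw [← hrq, mul_assoc, hqe]⟩
  have h2 : LinearMap.range (LinearMap.mulLeft ℂ r) ≤ LinearMap.range (LinearMap.mulLeft ℂ q) := by
    rintro _ ⟨y, rfl⟩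
    refine ⟨r * y, ?_⟩
    simp only [LinearMap.mulLeft_apply]
    rw [← mul_assoc, hqc, hrq]
  have h3 := Submodule.eq_of_le_of_finrank_le h2 h1
  have h4 : q ∈ LinearMap.range (LinearMap.mulLeft ℂ r) := by
    rw [h3]; exact ⟨1, by simp⟩
  obtain ⟨y, hy⟩ := h4
  simp only [LinearMap.mulLeft_apply] at hy
  rw [← hrq]
  conv_lhs => rw [← hy]
  rw [← mul_assoc, hrr, hy]

lemma minproj_sum [FiniteDimensional ℂ A] (P : Finset A)
    (hP : ∀ p, p ∈ P ↔ IsMinCentralProjection p) : ∑ p ∈ P, p = 1 := by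
  by_contra hne
  have hps : ∀ p ∈ P, p * (∑ q ∈ P, q) = p := by
    intro p hp
    rw [Finset.mul_sum, Finset.sum_eq_single p]
    · exact ((hP p).1 hp).2.2.1
    · exact fun q hq hqp => minproj_orth ((hP p).1 hp) ((hP q).1 hq) hqp.symm
    · exact fun h => absurd hp h
  have hss : (∑ q ∈ P, q) * (∑ q ∈ P, q) = ∑ q ∈ P, q := by
    conv_lhs => rw [Finset.sum_mul]
    exact Finset.sum_congr rfl hps
  have hst : star (∑ q ∈ P, q) = ∑ q ∈ P, q := by
    rw [star_sum]
    exact Finset.sum_congr rfl fun p hp => ((hP p).1 hp).2.1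
  have hsc : ∀ b, (∑ q ∈ P, q) * b = b * (∑ q ∈ P, q) := by
    intro b
    rw [Finset.sum_mul, Finset.mul_sum]
    exact Finset.sum_congr rfl fun p hp => ((hP p).1 hp).2.2.2.1 b
  obtain ⟨q, hq, hqe⟩ := minproj_below (1 - ∑ q ∈ P, q) (sub_ne_zero.2 (Ne.symm hne))
    (by rw [star_sub, star_one, hst])
    (by rw [mul_sub, sub_mul, sub_mul, hss]; simp)
    (fun b => by rw [sub_mul, mul_sub, hsc]; simp)
  rw [mul_sub, hps q ((hP q).2 hq), mul_one, sub_self] at hqe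
  exact hq.1 hqe.symm

end proj

section build

lemma rank_trace {V : Type*} [AddCommGroup V] [Module ℂ V] [FiniteDimensional ℂ V]
    (f : V →ₗ[ℂ] V) (hf : f * f = f) :
    (Module.finrank ℂ (LinearMap.range f) : ℂ) = LinearMap.trace ℂ V f :=
  ((LinearMap.IsIdempotentElem.isProj_range f hf).trace).symm

/-- Block-diagonal direct sums of matrix representations, reindexed. -/
lemma build {A : Type*} [Ring A] [StarRing A] [Algebra ℂ A] {I : Type*} [Fintype I] [DecidableEq I]
    (t : I → ℕ) (τ : ∀ i, A →⋆ₐ[ℂ] Matrix (Fin (t i)) (Fin (t i)) ℂ) (d : ℕ) (hd : ∑ i, t i = d) :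
    ∃ ρ : A →⋆ₐ[ℂ] BH d, ∀ a,
      LinearMap.trace ℂ (HS d) (ρ a : HS d →ₗ[ℂ] HS d) = ∑ i, (τ i a).trace := by
  have hcard : Fintype.card (Σ i, Fin (t i)) = d := by simp [hd]
  let e : (Σ i, Fin (t i)) ≃ Fin d := Fintype.equivFinOfCardEq hcard
  let ρ1 : A →⋆ₐ[ℂ] Matrix (Fin d) (Fin d) ℂ :=
    { toFun := fun a => Matrix.reindexAlgEquiv ℂ ℂ e (Matrix.blockDiagonal' fun i => τ i a)
      map_one' := by
        have : (fun i => τ i (1 : A)) = 1 := by ext1 i; simp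
        rw [this, Matrix.blockDiagonal'_one, map_one]
      map_mul' := fun a b => by
        rw [← map_mul, ← Matrix.blockDiagonal'_mul]; simp only [map_mul]
      map_zero' := by
        have : (fun i => τ i (0 : A)) = 0 := by ext1 i; simp
        rw [this, Matrix.blockDiagonal'_zero, map_zero]
      map_add' := fun a b => by
        rw [← map_add, ← Matrix.blockDiagonal'_add]
        congr 2; ext1 i; simp
      commutes' := fun r => by
        have : (fun i => τ i (algebraMap ℂ A r)) = r • 1 := by
          ext1 i; simp [Algebra.algebraMap_eq_smul_one]
        rw [this, Matrix.blockDiagonal'_smul, Matrix.blockDiagonal'_one, map_smul, map_one,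
          Algebra.algebraMap_eq_smul_one]
      map_star' := fun a => by
        simp only [Matrix.coe_reindexAlgEquiv, Matrix.star_eq_conjTranspose,
          Matrix.conjTranspose_reindex, Matrix.blockDiagonal'_conjTranspose, map_star] }
  let E : Matrix (Fin d) (Fin d) ℂ →⋆ₐ[ℂ] BH d :=
    ((Matrix.toEuclideanCLM (n := Fin d) (𝕜 := ℂ) : Matrix (Fin d) (Fin d) ℂ ≃⋆ₐ[ℂ] BH d) :
      Matrix (Fin d) (Fin d) ℂ →⋆ₐ[ℂ] BH d)
  refine ⟨E.comp ρ1, ?_⟩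
  intro a
  have h1 : ((E.comp ρ1) a : HS d →ₗ[ℂ] HS d) = Matrix.toEuclideanLin (ρ1 a) := rfl
  rw [h1, Matrix.toEuclideanLin_eq_toLin, Matrix.trace_toLin_eq]
  change (Matrix.reindex e e (Matrix.blockDiagonal' fun i => τ i a)).trace = _
  rw [← Matrix.trace_blockDiagonal']
  simp only [Matrix.trace, Matrix.diag, Matrix.reindex_apply, Matrix.submatrix_apply]
  exact Equiv.sum_comp e.symm (fun x => Matrix.blockDiagonal' (fun i => τ i a) x x)

end build

section main
variable {A : Type*} [NormedRing A] [StarRing A] [CStarRing A] [NormedAlgebra ℂ A]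
      [StarModule ℂ A] [FiniteDimensional ℂ A]

/-- The rank of an operator. -/
def rk {m : ℕ} (f : BH m) : ℕ := Module.finrank ℂ (LinearMap.range (f : HS m →ₗ[ℂ] HS m))

lemma rk_trace {m : ℕ} (f : BH m) (hf : f * f = f) :
    (rk f : ℂ) = LinearMap.trace ℂ (HS m) (f : HS m →ₗ[ℂ] HS m) :=
  rank_trace _ (by
    ext1 x
    exact DFunLike.congr_fun hf x)

lemma exists_piece {m : ℕ} (π : A →⋆ₐ[ℂ] BH m) (p : A) (hp : IsMinCentralProjection p) :
    ∃ t : ℕ, 0 < t ∧ t ∣ rk (π p) ∧ ∃ τ : A →⋆ₐ[ℂ] Matrix (Fin t) (Fin t) ℂ, τ p = 1 := by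
  by_cases h : rk (π p) = 0
  · refine ⟨Module.finrank ℂ (LinearMap.range (Algebra.lmul ℂ A p)), ?_, by simp [h],
      compress (gnsCore A) (Algebra.lmul ℂ A) ?_ p hp.2.2.1 hp.2.2.2.1⟩
    · rw [Module.finrank_pos_iff_exists_ne_zero]
      exact ⟨⟨p, 1, by simp⟩, fun h => hp.1 (congrArg Subtype.val h)⟩
    · intro a x y
      change lmTr A (star (a * x) * y) = lmTr A (star x * (star a * y))
      rw [star_mul, mul_assoc]
  · let φ : A →ₐ[ℂ] Module.End ℂ (HS m) :=
      { toFun := fun a => (π a : HS m →ₗ[ℂ] HS m)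
        map_one' := by ext1 x; simp
        map_mul' := fun a b => by ext1 x; simp
        map_zero' := by ext1 x; simp
        map_add' := fun a b => by ext1 x; simp
        commutes' := fun r => by ext1 x; simp [Algebra.algebraMap_eq_smul_one] }
    refine ⟨rk (π p), Nat.pos_of_ne_zero h, dvd_rfl,
      compress_aux φ ?_ p hp.2.2.1 hp.2.2.2.1⟩
    intro a x y
    change inner ℂ (π a x) y = inner ℂ x (π (star a) y)
    rw [map_star, ContinuousLinearMap.star_eq_adjoint, ContinuousLinearMap.adjoint_inner_right]

lemma main1 {m : ℕ} (hm : 0 < m) (π : A →⋆ₐ[ℂ] BH m) :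
    ∃ K T : ℕ, 0 < K ∧ 0 < T ∧ ∀ c d : ℕ, T ∣ c → m ≤ c → K * c = m + d →
      ∃ ρ : A →⋆ₐ[ℂ] BH d, ∀ p, IsMinCentralProjection p → rk (π p) + rk (ρ p) = c := by
  classical
  let P : Finset A := (minproj_finite A).toFinset
  have hP : ∀ p, p ∈ P ↔ IsMinCentralProjection p := fun p => by simp [P]
  have hsum := minproj_sum P hP
  have hidem : ∀ {n : ℕ} (ρ : A →⋆ₐ[ℂ] BH n) (p : A), IsMinCentralProjection p →
      ρ p * ρ p = ρ p := fun ρ p hp => by rw [← map_mul, hp.2.2.1]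
  have hr : ∑ p ∈ P, rk (π p) = m := by
    have h1 : ((∑ p ∈ P, rk (π p) : ℕ) : ℂ) = m := by
      push_cast
      rw [Finset.sum_congr rfl fun p hp => rk_trace _ (hidem π p ((hP p).1 hp)), ← map_sum,
        ← ContinuousLinearMap.toLinearMap_sum, ← map_sum, hsum, map_one]
      change LinearMap.trace ℂ (HS m) 1 = _
      simp
    exact_mod_cast h1
  choose t ht0 htd τ hτ using fun p : P => exists_piece π p.1 ((hP p.1).1 p.2)
  refine ⟨P.card, ∏ p : P, t p, ?_, Finset.prod_pos fun p _ => ht0 p, ?_⟩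
  · rw [Finset.card_pos, Finset.nonempty_iff_ne_empty]
    intro h
    rw [h, Finset.sum_empty] at hr
    omega
  intro c d hTc hmc hK
  have hle : ∀ p : P, rk (π p.1) ≤ c := fun p =>
    (Finset.single_le_sum (f := fun p => rk (π p)) (fun _ _ => Nat.zero_le _) p.2).trans (hr.le.trans hmc)
  let ν : P → ℕ := fun p => (c - rk (π p.1)) / t p
  have hν : ∀ p, ν p * t p = c - rk (π p.1) := fun p =>
    Nat.div_mul_cancel
      (Nat.dvd_sub ((Finset.dvd_prod_of_mem t (Finset.mem_univ p)).trans hTc) (htd p))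
  have hd : ∑ i : (Σ p : P, Fin (ν p)), t i.1 = d := by
    rw [Fintype.sum_sigma]
    simp only [Finset.sum_const, Finset.card_univ, Fintype.card_fin, smul_eq_mul, hν]
    have h1 : ∑ p : P, (c - rk (π p.1)) + ∑ p : P, rk (π p.1) = P.card * c := by
      rw [← Finset.sum_add_distrib,
        Finset.sum_congr rfl fun p _ => Nat.sub_add_cancel (hle p)]
      simp
    have h2 : ∑ p : P, rk (π p.1) = m := 
      (Finset.sum_coe_sort P (fun p => rk (π p))).trans hr
    omega
  obtain ⟨ρ, hρ⟩ := build (fun i : (Σ p : P, Fin (ν p)) => t i.1) (fun i => τ i.1) d hd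
  refine ⟨ρ, fun p hp => ?_⟩
  have hpP : p ∈ P := (hP p).2 hp
  have h1 : (rk (ρ p) : ℂ) = ((c - rk (π p) : ℕ) : ℂ) := by
    rw [rk_trace _ (hidem ρ p hp), hρ, Fintype.sum_sigma, Finset.sum_eq_single ⟨p, hpP⟩]
    · have h5 : τ ⟨p, hpP⟩ p = 1 := hτ ⟨p, hpP⟩
      rw [← hν ⟨p, hpP⟩]
      simp [h5]
    · intro q _ hq
      have h2 : τ q p = 0 := by
        have h3 : p * q.1 = 0 :=
          minproj_orth hp ((hP _).1 q.2) (fun h => hq (Subtype.ext h.symm))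
        have h4 := congrArg (τ q) h3
        rwa [map_mul, hτ, mul_one, map_zero] at h4
      simp [h2]
    · exact fun h => absurd (Finset.mem_univ _) h
  have h2 : rk (ρ p) = c - rk (π p) := by exact_mod_cast h1
  have h3 : rk (π p) ≤ c := hle ⟨p, hpP⟩
  omega

lemma prodRank_eq {m n : ℕ} (f : BH m) (g : BH n) (hf : f * f = f) (hg : g * g = g) :
    prodRank (f.prodMap g) = rk f + rk g := by
  have h : ((prodRank (f.prodMap g) : ℕ) : ℂ) = ((rk f + rk g : ℕ) : ℂ) := by
    push_cast
    rw [rk_trace f hf, rk_trace g hg, ← LinearMap.trace_prodMap']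
    refine rank_trace (f.prodMap g : HS m × HS n →ₗ[ℂ] HS m × HS n) ?_
    apply LinearMap.ext
    rintro ⟨x, y⟩
    exact Prod.ext (DFunLike.congr_fun hf x) (DFunLike.congr_fun hg y)
  exact_mod_cast h

end main

/-- Given unital *-representations `π_i : A_i → B(H)` of finite-dimensional C*-algebras on a
finite-dimensional Hilbert space `H`, there are a finite-dimensional Hilbert space `Ĥ` and
unital *-representations `πh_i : A_i → B(Ĥ)` such that each `π_i ⊕ πh_i` satisfies the Rank
of Central Projections condition. -/
theorem exists_RCP_enlargement
    (A1 : Type*) [NormedRing A1] [StarRing A1] [CStarRing A1] [NormedAlgebra ℂ A1]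
      [StarModule ℂ A1] [FiniteDimensional ℂ A1]
    (A2 : Type*) [NormedRing A2] [StarRing A2] [CStarRing A2] [NormedAlgebra ℂ A2]
      [StarModule ℂ A2] [FiniteDimensional ℂ A2]
    (m : ℕ) (hm : 0 < m)
    (π1 : A1 →⋆ₐ[ℂ] BH m) (π2 : A2 →⋆ₐ[ℂ] BH m) :
    ∃ m' : ℕ, 0 < m' ∧
      ∃ (πh1 : A1 →⋆ₐ[ℂ] BH m') (πh2 : A2 →⋆ₐ[ℂ] BH m'),
        (∀ p p' : A1, IsMinCentralProjection p → IsMinCentralProjection p' →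
          prodRank ((π1 p).prodMap (πh1 p)) = prodRank ((π1 p').prodMap (πh1 p'))) ∧
        (∀ p p' : A2, IsMinCentralProjection p → IsMinCentralProjection p' →
          prodRank ((π2 p).prodMap (πh2 p)) = prodRank ((π2 p').prodMap (πh2 p'))) := by
  obtain ⟨K1, T1, hK1, hT1, h1⟩ := main1 hm π1
  obtain ⟨K2, T2, hK2, hT2, h2⟩ := main1 hm π2
  have hbig : 2 * m ≤ K1 * K2 * T1 * T2 * (2 * m) := Nat.le_mul_of_pos_left _ (by positivity)
  have hc1 : 2 * m ≤ K2 * T1 * T2 * (2 * m) := Nat.le_mul_of_pos_left _ (by positivity)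
  have hc2 : 2 * m ≤ K1 * T1 * T2 * (2 * m) := Nat.le_mul_of_pos_left _ (by positivity)
  have hd : K1 * K2 * T1 * T2 * (2 * m) = m + (K1 * K2 * T1 * T2 * (2 * m) - m) := by omega
  obtain ⟨ρ1, hρ1⟩ := h1 (K2 * T1 * T2 * (2 * m)) (K1 * K2 * T1 * T2 * (2 * m) - m)
    ⟨K2 * T2 * (2 * m), by ring⟩ (by omega) (by rw [← hd]; ring)
  obtain ⟨ρ2, hρ2⟩ := h2 (K1 * T1 * T2 * (2 * m)) (K1 * K2 * T1 * T2 * (2 * m) - m)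
    ⟨K1 * T1 * (2 * m), by ring⟩ (by omega) (by rw [← hd]; ring)
  refine ⟨K1 * K2 * T1 * T2 * (2 * m) - m, by omega, ρ1, ρ2, ?_, ?_⟩
  · intro p p' hp hp'
    rw [prodRank_eq _ _ (by rw [← map_mul, hp.2.2.1]) (by rw [← map_mul, hp.2.2.1]),
      prodRank_eq _ _ (by rw [← map_mul, hp'.2.2.1]) (by rw [← map_mul, hp'.2.2.1]),
      hρ1 p hp, hρ1 p' hp']
  · intro p p' hp hp'
    rw [prodRank_eq _ _ (by rw [← map_mul, hp.2.2.1]) (by rw [← map_mul, hp.2.2.1]),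
      prodRank_eq _ _ (by rw [← map_mul, hp'.2.2.1]) (by rw [← map_mul, hp'.2.2.1]),
      hρ2 p hp, hρ2 p' hp']
end
end

section
/- Let A1 and A2 be finite-dimensional unital C*-algebras over ℂ with (dim A1 − 1)(dim A2 − 1) ≥ 2, let H be a finite-dimensional complex Hilbert space, and let ρ_1 : A1 → B(H), ρ_2 : A2 → B(H) be unital *-homomorphisms satisfying the Rank of Central Projections condition: for each i = 1, 2, the rank of ρ_i(p) is the same for all minimal projections p of the center of A_i. Then the set { u ∈ U(H) : ρ_1(A1)' ∩ u ρ_2(A2)' u* = ℂ·1 } is dense in the unitary group U(H) with the operator norm, where the commutants are taken in B(H). (Equivalently: the representation ρ of A1 * A2 determined by (ρ_1, ρ_2) is densely perturbable to an irreducible representation.) -/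
set_option synthInstance.maxHeartbeats 1000000
set_option maxHeartbeats 1000000

noncomputable section

/-- The rank of an operator on `ℂ^m`. -/
def opRank {m : ℕ} (f : BH m) : ℕ :=
  Module.finrank ℂ (LinearMap.range (f : HS m →ₗ[ℂ] HS m))

/-- The commutant in `B(H)` of a set of operators. -/
def commutantSet {m : ℕ} (S : Set (BH m)) : Set (BH m) :=
  {x | ∀ s ∈ S, x * s = s * x}


/-- A central idempotent of a C*-ring is self-adjoint. -/
lemma central_idem_star {A : Type*} [NormedRing A] [StarRing A] [CStarRing A]
    (z : A) (hz : z * z = z) (hc : ∀ b, z * b = b * z) : star z = z := by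
  have h1 : star z * star z = star z := by rw [← star_mul, hz]
  have key : ∀ w : A, w * w = w → (∀ b, w * b = b * w) → star w * star w = star w →
      w = w * star w := by
    intro w hw hcw hsw
    have : (w - w * star w) * star (w - w * star w) = 0 := by
      simp only [star_sub, star_mul, star_star]
      have e1 : w * (w * star w) = w * star w := by rw [← mul_assoc, hw]
      have e2 : w * star w * star w = w * star w := by rw [mul_assoc, hsw]
      have e3 : w * star w * (w * star w) = w * star w := by
        rw [← mul_assoc, ← hcw (w * star w), e1, e2]
      rw [sub_mul, mul_sub, mul_sub, e1, e2, e3]; simp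
    have := (CStarRing.mul_star_self_eq_zero_iff _).1 this
    exact sub_eq_zero.1 this
  have h2 := key z hz hc h1
  conv_lhs => rw [h2]
  rw [star_mul, star_star, ← h2]

lemma fd_cstar_semisimple (A : Type*) [NormedRing A] [StarRing A] [CStarRing A] [NormedAlgebra ℂ A]
    [FiniteDimensional ℂ A] : IsSemisimpleRing A := by
  have : IsArtinianRing A := IsArtinianRing.of_finite ℂ A
  rw [IsArtinianRing.isSemisimpleRing_iff_jacobson]
  rw [eq_bot_iff]
  intro x hx
  obtain ⟨n, hn⟩ := IsArtinianRing.isNilpotent_jacobson_bot (R := A)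
  have hx' : star x * x ∈ Ideal.jacobson (⊥ : Ideal A) := by
    rw [Ideal.jacobson_bot]
    exact Ideal.mul_mem_left _ _ hx
  have hpow : (star x * x) ^ n = 0 := by
    have := Ideal.pow_mem_pow hx' n
    rw [hn] at this
    simpa using this
  have hsa : IsSelfAdjoint (star x * x) := IsSelfAdjoint.star_mul_self x
  have h2 : ‖(star x * x) ^ (2 ^ n)‖ = ‖star x * x‖ ^ (2 ^ n) := by
    have := hsa.nnnorm_pow_two_pow n
    simpa using congrArg NNReal.toReal this
  have h3 : (star x * x) ^ (2 ^ n) = 0 := pow_eq_zero_of_le (Nat.lt_two_pow_self).le hpow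
  rw [h3, norm_zero] at h2
  have h4 : star x * x = 0 := by
    have := pow_eq_zero_iff (by positivity) |>.1 h2.symm
    simpa using this
  exact (CStarRing.star_mul_self_eq_zero_iff x).1 h4

structure MU {R : Type*} [Ring R] {r : ℕ} {n : Fin r → ℕ}
    (E : (i : Fin r) → Fin (n i) → Fin (n i) → R) : Prop where
  mul_same : ∀ i j k l, E i j k * E i k l = E i j l
  mul_ne : ∀ i j k k' l, k ≠ k' → E i j k * E i k' l = 0
  mul_ne' : ∀ i i' j k j' k', i ≠ i' → E i j k * E i' j' k' = 0
  sum_one : ∑ i, ∑ j, E i j j = 1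

lemma exists_MU (A : Type*) [NormedRing A] [StarRing A] [CStarRing A] [NormedAlgebra ℂ A]
    [FiniteDimensional ℂ A] : ∃ (r : ℕ) (n : Fin r → ℕ)
      (E : (i : Fin r) → Fin (n i) → Fin (n i) → A), MU E ∧ (∀ i, 0 < n i) ∧
      Module.finrank ℂ A = ∑ i, n i * n i ∧ (∀ i, IsMinCentralProjection (∑ j, E i j j)) ∧
      ∀ a : A, ∃ c : (i : Fin r) → Fin (n i) → Fin (n i) → ℂ,
        a = ∑ i, ∑ j, ∑ k, c i j k • E i j k := by
  have := fd_cstar_semisimple A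
  obtain ⟨r, n, hn, ⟨φ⟩⟩ := IsSemisimpleRing.exists_algEquiv_pi_matrix_of_isAlgClosed ℂ A
  have hsum : ∀ i, ∑ j, φ.symm (Pi.single i (Matrix.single j j 1)) = φ.symm (Pi.single i 1) := by
    intro i
    rw [← map_sum, ← Matrix.sum_single_one]
    congr 1
    ext i' : 1
    rw [Finset.sum_apply]
    by_cases h : i = i'
    · subst h; simp
    · simp [Pi.single_apply, Ne.symm h]
  refine ⟨r, n, fun i j k => φ.symm (Pi.single i (Matrix.single j k 1)), ⟨?_, ?_, ?_, ?_⟩, ?_, ?_, ?_, ?_⟩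
  · intro i j k l
    rw [← map_mul, ← Pi.single_mul]; simp
  · intro i j k k' l h
    rw [← map_mul, ← Pi.single_mul]; simp [h]
  · intro i i' j k j' k' h
    rw [← map_mul]
    rw [map_eq_zero_iff _ φ.symm.injective]
    ext i'' : 1
    by_cases h1 : i'' = i
    · subst h1; simp [Pi.single_apply, h]
    · simp [Pi.single_apply, h1]
  · simp_rw [hsum]
    rw [← map_sum]
    rw [Finset.univ_sum_single (fun i => (1 : Matrix (Fin (n i)) (Fin (n i)) ℂ))]
    exact map_one φ.symm
  · exact fun i => Nat.pos_of_ne_zero (hn i).out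
  · rw [φ.toLinearEquiv.finrank_eq, Module.finrank_pi_fintype]
    simp [Module.finrank_matrix]
  · intro i
    rw [hsum]
    have hc : ∀ b : A, φ.symm (Pi.single i 1) * b = b * φ.symm (Pi.single i 1) := by
      intro b
      apply φ.injective
      rw [map_mul, map_mul, φ.apply_symm_apply]
      ext i' : 1
      by_cases h : i' = i
      · subst h; simp
      · simp [Pi.single_apply, h]
    have hid : φ.symm (Pi.single i 1) * φ.symm (Pi.single i 1) = φ.symm (Pi.single i 1) := by
      rw [← map_mul, ← Pi.single_mul]; simp
    refine ⟨?_, central_idem_star _ hid hc, hid, hc, ?_⟩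
    · rw [Ne, map_eq_zero_iff _ φ.symm.injective]
      intro h
      have h1 := congrFun h i
      have : NeZero (n i) := hn i
      rw [Pi.single_eq_same, Pi.zero_apply] at h1
      exact one_ne_zero h1
    · intro q hq _ hqq hqe
      have hq0 : ∀ i', i' ≠ i → φ q i' = 0 := by
        intro i' h
        have := congrFun (congrArg φ hqe) i'
        rw [map_mul, φ.apply_symm_apply] at this
        simpa [Pi.single_apply, h] using this.symm
      have hscal : ∃ c : ℂ, φ q i = Matrix.scalar (Fin (n i)) c := by
        have : ∀ M, Commute M (φ q i) := by
          intro M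
          have := congrFun (congrArg φ (hq (φ.symm (Pi.single i M)))) i
          rw [map_mul, map_mul, φ.apply_symm_apply] at this
          show _ * _ = _ * _
          simpa using this.symm
        obtain ⟨c, hc⟩ := Matrix.mem_range_scalar_of_commute_single (M := φ q i)
          (fun a b _ => this _)
        exact ⟨c, hc.symm⟩
      obtain ⟨c, hcc⟩ := hscal
      have hq1 : φ q i * φ q i = φ q i := by
        have := congrFun (congrArg φ hqq) i
        simpa using this
      have hc2 : c * c = c := by
        have : NeZero (n i) := hn i
        rw [hcc, ← map_mul] at hq1
        exact Matrix.scalar_inj.1 hq1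
      have : c = 0 ∨ c = 1 := by
        have : c * (c - 1) = 0 := by rw [mul_sub, hc2]; ring
        rcases mul_eq_zero.1 this with h | h
        · exact Or.inl h
        · exact Or.inr (sub_eq_zero.1 h)
      rcases this with rfl | rfl
      · left
        apply φ.injective
        rw [map_zero]
        ext i' : 1
        by_cases h : i' = i
        · subst h; rw [hcc]; simp
        · exact hq0 _ h
      · right
        apply φ.injective
        rw [φ.apply_symm_apply]
        ext i' : 1
        by_cases h : i' = i
        · subst h; rw [hcc]; simp
        · rw [hq0 _ h]; simp [Pi.single_apply, h]
  · intro a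
    refine ⟨fun i j k => φ a i j k, ?_⟩
    apply φ.injective
    simp only [map_sum, map_smul, φ.apply_symm_apply]
    ext i' : 1
    simp only [Finset.sum_apply, Pi.smul_apply]
    rw [Finset.sum_eq_single i']
    · simp only [Pi.single_eq_same]
      conv_lhs => rw [Matrix.matrix_eq_sum_single (φ a i')]
      simp [Matrix.smul_single]
    · intro b _ hb
      simp [Pi.single_apply, Ne.symm hb]
    · simp

open Module TensorProduct in
lemma trace_mulLR {V : Type*} [AddCommGroup V] [Module ℂ V] [FiniteDimensional ℂ V]
    (A B : End ℂ V) :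
    LinearMap.trace ℂ (End ℂ V) (LinearMap.mulLeftRight ℂ (A, B)) =
      LinearMap.trace ℂ V A * LinearMap.trace ℂ V B := by
  let e := dualTensorHomEquiv ℂ V V
  have h : LinearMap.mulLeftRight ℂ (A, B) =
      e.conj (TensorProduct.map (Module.Dual.transpose (R := ℂ) B) A) := by
    rw [← LinearEquiv.symm_apply_eq]
    apply TensorProduct.ext'
    intro f v
    change e.symm (LinearMap.mulLeftRight ℂ (A, B) (e (f ⊗ₜ[ℂ] v))) = _
    simp only [TensorProduct.map_tmul]
    rw [LinearEquiv.symm_apply_eq]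
    ext w
    simp [e, dualTensorHomEquiv, Module.End.mul_apply]
    rfl
  rw [h, LinearMap.trace_conj', LinearMap.trace_tensorProduct', LinearMap.trace_transpose', mul_comm]

/-- The space of operators `Y = P Y (1 - P)` commuting with a family. -/
def WSub {R : Type*} [Ring R] [Algebra ℂ R] (P : R) {ι : Type*} (E : ι → R) : Submodule ℂ R where
  carrier := {Y | P * Y * (1 - P) = Y ∧ ∀ i, Y * E i = E i * Y}
  add_mem' := by
    rintro a b ⟨h1, h2⟩ ⟨h3, h4⟩
    refine ⟨by rw [mul_add, add_mul, h1, h3], fun i => by rw [add_mul, mul_add, h2, h4]⟩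
  zero_mem' := by simp
  smul_mem' := by
    rintro c a ⟨h1, h2⟩
    refine ⟨by rw [mul_smul_comm, smul_mul_assoc, h1], fun i => by
      rw [smul_mul_assoc, mul_smul_comm, h2]⟩

lemma MU.trace_diag {V : Type*} [AddCommGroup V] [Module ℂ V] [FiniteDimensional ℂ V]
    {r : ℕ} {n : Fin r → ℕ} {E : (i : Fin r) → Fin (n i) → Fin (n i) → Module.End ℂ V} (hE : MU E)
    (P : Module.End ℂ V) (hc : ∀ i j k, E i j k * P = P * E i j k) (i) (j k l : Fin (n i)) :
    LinearMap.trace ℂ V (E i j k * P) = if j = k then LinearMap.trace ℂ V (E i l l * P) else 0 := by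
  split_ifs with h
  · subst h
    rw [← hE.mul_same i j l j, mul_assoc, LinearMap.trace_mul_comm, mul_assoc, ← hc, ← mul_assoc,
      hE.mul_same]
  · rw [← hE.mul_same i j k k, mul_assoc, LinearMap.trace_mul_comm, mul_assoc, ← hc, ← mul_assoc,
      hE.mul_ne _ _ _ _ _ (Ne.symm h)]
    simp

lemma idem_trace {V : Type*} [AddCommGroup V] [Module ℂ V] [FiniteDimensional ℂ V]
    (P : Module.End ℂ V) (hP : P * P = P) :
    LinearMap.trace ℂ V P = (Module.finrank ℂ (LinearMap.range P) : ℂ) :=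
  (LinearMap.IsIdempotentElem.isProj_range P hP).trace

lemma idem_mul_comm {R : Type*} [Ring R] {a b : R} (ha : a * a = a) (hb : b * b = b)
    (hab : a * b = b * a) : (a * b) * (a * b) = a * b := by
  rw [mul_assoc, ← mul_assoc b, ← hab, mul_assoc a b b, hb, ← mul_assoc, ha]

lemma MU.count {V : Type*} [AddCommGroup V] [Module ℂ V] [FiniteDimensional ℂ V]
    {r : ℕ} {n : Fin r → ℕ} {E : (i : Fin r) → Fin (n i) → Fin (n i) → Module.End ℂ V} (hE : MU E)
    (hn : ∀ i, 0 < n i)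
    (P : Module.End ℂ V) (hP : P * P = P) (hc : ∀ i j k, E i j k * P = P * E i j k) :
    ∃ α β : Fin r → ℕ,
      Module.finrank ℂ (WSub P (fun x : (Σ i : Fin r, Fin (n i) × Fin (n i)) =>
        E x.1 x.2.1 x.2.2)) = ∑ i, α i * β i ∧
      ∑ i, n i * α i = Module.finrank ℂ (LinearMap.range P) ∧
      ∑ i, n i * β i = Module.finrank ℂ (LinearMap.range (1 - P)) ∧
      ∀ i, n i * α i + n i * β i = Module.finrank ℂ (LinearMap.range (∑ j, E i j j)) := by
  let o : ∀ i, Fin (n i) := fun i => ⟨0, hn i⟩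
  set Q := 1 - P with hQ
  have hQQ : Q * Q = Q := by rw [hQ, mul_sub, sub_mul, sub_mul, hP]; simp
  have hcQ : ∀ i j k, E i j k * Q = Q * E i j k := by
    intro i j k; rw [hQ, mul_sub, sub_mul, hc]; simp
  have hdd : ∀ i j, E i j j * E i j j = E i j j := fun i j => hE.mul_same _ _ _ _
  let α : Fin r → ℕ := fun i => Module.finrank ℂ (LinearMap.range (E i (o i) (o i) * P))
  let β : Fin r → ℕ := fun i => Module.finrank ℂ (LinearMap.range (E i (o i) (o i) * Q))
  have hα : ∀ i, LinearMap.trace ℂ V (E i (o i) (o i) * P) = α i := fun i =>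
    idem_trace _ (idem_mul_comm (hdd _ _) hP (hc _ _ _))
  have hβ : ∀ i, LinearMap.trace ℂ V (E i (o i) (o i) * Q) = β i := fun i =>
    idem_trace _ (idem_mul_comm (hdd _ _) hQQ (hcQ _ _ _))
  have htP : ∀ i j k, LinearMap.trace ℂ V (E i j k * P) = if j = k then (α i : ℂ) else 0 := by
    intro i j k; rw [hE.trace_diag P hc i j k (o i), hα]
  have htQ : ∀ i j k, LinearMap.trace ℂ V (E i j k * Q) = if j = k then (β i : ℂ) else 0 := by
    intro i j k; rw [hE.trace_diag Q hcQ i j k (o i), hβ]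
  have hsP : ∀ i, LinearMap.trace ℂ V ((∑ j, E i j j) * P) = n i * α i := by
    intro i; rw [Finset.sum_mul, map_sum]; simp [htP]
  have hsQ : ∀ i, LinearMap.trace ℂ V ((∑ j, E i j j) * Q) = n i * β i := by
    intro i; rw [Finset.sum_mul, map_sum]; simp [htQ]
  refine ⟨α, β, ?_, ?_, ?_, ?_⟩
  · let Φ : Module.End ℂ V →ₗ[ℂ] Module.End ℂ V :=
      ∑ i, (n i : ℂ)⁻¹ • ∑ j, ∑ k, LinearMap.mulLeftRight ℂ (E i j k * P, Q * E i k j)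
    have hΦ : ∀ x, Φ x = ∑ i, (n i : ℂ)⁻¹ • ∑ j, ∑ k, E i j k * (P * x * Q) * E i k j := by
      intro x
      simp [Φ, LinearMap.sum_apply, mul_assoc]
    have hproj : LinearMap.IsProj (WSub P (fun x : (Σ i : Fin r, Fin (n i) × Fin (n i)) =>
        E x.1 x.2.1 x.2.2)) Φ := by
      constructor
      · intro x
        rw [hΦ]
        constructor
        · rw [← hQ]
          simp only [Finset.mul_sum, Finset.sum_mul, mul_smul_comm, smul_mul_assoc]
          refine Finset.sum_congr rfl fun i _ => ?_
          refine congrArg _ (Finset.sum_congr rfl fun j _ => Finset.sum_congr rfl fun k _ => ?_)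
          calc P * (E i j k * (P * x * Q) * E i k j) * Q
              = (P * E i j k) * (P * x * Q) * (E i k j * Q) := by noncomm_ring
            _ = E i j k * (P * P * x * (Q * Q)) * E i k j := by rw [← hc, hcQ]; noncomm_ring
            _ = _ := by rw [hP, hQQ]
        · rintro ⟨i0, l, m⟩
          simp only [Finset.mul_sum, Finset.sum_mul, mul_smul_comm, smul_mul_assoc]
          refine Finset.sum_congr rfl fun i _ => ?_
          by_cases hi : i = i0
          · subst hi
            congr 1
            refine (Finset.sum_eq_single l ?_ ?_).trans
              (Eq.trans ?_ (Finset.sum_eq_single m ?_ ?_).symm)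
            · intro b _ hb
              refine Finset.sum_eq_zero fun k _ => ?_
              rw [mul_assoc, hE.mul_ne _ _ _ _ _ hb]; simp
            · simp
            · refine Finset.sum_congr rfl fun k _ => ?_
              rw [mul_assoc, hE.mul_same, ← mul_assoc (E i l m), ← mul_assoc (E i l m), hE.mul_same]
            · intro b _ hb
              refine Finset.sum_eq_zero fun k _ => ?_
              rw [← mul_assoc, ← mul_assoc, hE.mul_ne _ _ _ _ _ (Ne.symm hb)]; simp
            · simp
          · congr 1
            rw [Finset.sum_eq_zero, Finset.sum_eq_zero]
            · intro j _
              refine Finset.sum_eq_zero fun k _ => ?_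
              rw [← mul_assoc, ← mul_assoc, hE.mul_ne' _ _ _ _ _ _ (Ne.symm hi)]; simp
            · intro j _
              refine Finset.sum_eq_zero fun k _ => ?_
              rw [mul_assoc, hE.mul_ne' _ _ _ _ _ _ hi]; simp
      · rintro x ⟨h1, h2⟩
        rw [hΦ, ← hQ] at *
        rw [h1]
        have : ∀ i j k, E i j k * x * E i k j = E i j j * x := by
          intro i j k
          rw [mul_assoc, h2 ⟨i, k, j⟩, ← mul_assoc, hE.mul_same]
        simp only [this, Finset.sum_const, Finset.card_univ, Fintype.card_fin]
        have h3 : ∀ i, (n i : ℂ)⁻¹ • ∑ j, n i • (E i j j * x) = (∑ j, E i j j) * x := by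
          intro i
          have : (n i : ℂ) ≠ 0 := by exact_mod_cast (hn i).ne'
          rw [← Finset.smul_sum, ← Nat.cast_smul_eq_nsmul ℂ, smul_smul, inv_mul_cancel₀ this,
            one_smul, Finset.sum_mul]
        simp only [h3]
        rw [← Finset.sum_mul, hE.sum_one, one_mul]
    have ht := hproj.trace
    have ht2 : LinearMap.trace ℂ _ Φ = ∑ i, (α i : ℂ) * β i := by
      simp only [Φ, map_sum, map_smul, trace_mulLR]
      refine Finset.sum_congr rfl fun i _ => ?_
      have : (n i : ℂ) ≠ 0 := by exact_mod_cast (hn i).ne'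
      simp only [← hcQ, htP, htQ]
      simp [this]
    rw [ht] at ht2
    exact_mod_cast ht2
  · have : LinearMap.trace ℂ V P = ∑ i, (n i : ℂ) * α i := by
      rw [← one_mul P, ← hE.sum_one, Finset.sum_mul, map_sum]
      exact Finset.sum_congr rfl fun i _ => hsP i
    rw [idem_trace P hP] at this
    exact_mod_cast this.symm
  · have : LinearMap.trace ℂ V Q = ∑ i, (n i : ℂ) * β i := by
      rw [← one_mul Q, ← hE.sum_one, Finset.sum_mul, map_sum]
      exact Finset.sum_congr rfl fun i _ => hsQ i
    rw [idem_trace Q hQQ] at this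
    exact_mod_cast this.symm
  · intro i
    have hid : (∑ j, E i j j) * (∑ j, E i j j) = ∑ j, E i j j := by
      rw [Finset.sum_mul_sum]
      refine Finset.sum_congr rfl fun j _ => ?_
      rw [Finset.sum_eq_single j, hE.mul_same]
      · intro b _ hb; exact hE.mul_ne _ _ _ _ _ (Ne.symm hb)
      · simp
    have h1 := hsP i
    have h2 := hsQ i
    have h3 : LinearMap.trace ℂ V (∑ j, E i j j) = n i * α i + n i * β i := by
      rw [← h1, ← h2, ← map_add, ← mul_add, hQ]; simp
    rw [idem_trace _ hid] at h3
    exact_mod_cast h3.symm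

lemma arith_bound {r : ℕ} (n α β : Fin r → ℕ) (hn : ∀ i, 0 < n i) (R a b : ℕ)
    (ha : ∑ i, n i * α i = a) (hb : ∑ i, n i * β i = b)
    (hR : ∀ i, n i * α i + n i * β i = R) (ha0 : 0 < a) (hb0 : 0 < b)
    (hd : 2 ≤ ∑ i, n i * n i) :
    2 * ∑ i, α i * β i ≤ a * b ∧ (3 ≤ ∑ i, n i * n i → 2 * ∑ i, α i * β i < a * b) := by
  have hle : ∀ i, α i * β i ≤ (n i * α i) * (n i * β i) := fun i =>
    Nat.mul_le_mul (Nat.le_mul_of_pos_left _ (hn i)) (Nat.le_mul_of_pos_left _ (hn i))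
  have hsum : ∑ i, α i * β i ≤ ∑ i, (n i * α i) * (n i * β i) := Finset.sum_le_sum fun i _ => hle i
  have hcs : r * ∑ i, (n i * α i) * (n i * β i) ≤ a * b := by
    have h1 : (∑ i, (n i * α i : ℝ)) ^ 2 ≤ r * ∑ i, (n i * α i : ℝ) ^ 2 := by
      have := sq_sum_le_card_mul_sum_sq (s := Finset.univ) (f := fun i => (n i * α i : ℝ))
      simpa using this
    have hy : ∀ i, (n i * β i : ℝ) = R - n i * α i := by
      intro i; have := hR i; rw [← this]; push_cast; ring
    have ha' : ∑ i, (n i * α i : ℝ) = a := by exact_mod_cast ha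
    have hb' : (b : ℝ) = r * R - a := by
      have : ∑ i, (n i * β i : ℝ) = b := by exact_mod_cast hb
      rw [← this]; simp only [hy]; rw [Finset.sum_sub_distrib, ha']; simp
    have : (r : ℝ) * ∑ i, (n i * α i : ℝ) * (n i * β i) ≤ a * b := by
      simp only [hy]
      have : ∑ i, (n i * α i : ℝ) * (R - n i * α i) = R * a - ∑ i, (n i * α i : ℝ) ^ 2 := by
        rw [← ha', Finset.mul_sum, ← Finset.sum_sub_distrib]
        exact Finset.sum_congr rfl fun i _ => by ring
      rw [this, hb', mul_sub]
      rw [ha'] at h1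
      nlinarith
    exact_mod_cast this
  have hab : 0 < a * b := Nat.mul_pos ha0 hb0
  rcases Nat.lt_or_ge r 3 with hr | hr
  · interval_cases r
    · simp at ha; omega
    · simp only [Fin.sum_univ_one, Fin.isValue] at *
      have hn2 : 2 ≤ n 0 := by
        by_contra h
        have : n 0 ≤ 1 := by omega
        nlinarith
      have : 2 * (α 0 * β 0) < a * b := by
        subst ha hb
        have h0 : 0 < α 0 := Nat.pos_of_mul_pos_left ha0
        have h1 : 0 < β 0 := Nat.pos_of_mul_pos_left hb0
        have h3 : 0 < α 0 * β 0 := Nat.mul_pos h0 h1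
        have h4 : 4 ≤ n 0 * n 0 := Nat.mul_le_mul hn2 hn2
        calc 2 * (α 0 * β 0) < 4 * (α 0 * β 0) := by omega
          _ ≤ n 0 * n 0 * (α 0 * β 0) := Nat.mul_le_mul_right _ h4
          _ = _ := by ring
      exact ⟨this.le, fun _ => this⟩
    · refine ⟨by omega, fun h3 => ?_⟩
      simp only [Fin.sum_univ_two, Fin.isValue] at *
      by_contra hcon
      have key : ∀ x0 y0 x1 y1 n0 α0 β0 : ℕ, 2 ≤ n0 → x0 = n0 * α0 → y0 = n0 * β0 →
          x0 + y0 = R → x1 + y1 = R → x0 + x1 = a → y0 + y1 = b →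
          2 * (x0 * y0 + x1 * y1) ≤ a * b → α0 * β0 + x1 * y1 < x0 * y0 + x1 * y1 ∨
          2 * (x0 * y0 + x1 * y1) < a * b := by
        intro x0 y0 x1 y1 n0 α0 β0 h2 hx hy e1 e2 e3 e4 e5
        rcases Nat.eq_zero_or_pos (α0 * β0) with h0 | h0
        · right
          rcases Nat.mul_eq_zero.1 h0 with h0 | h0
          · subst h0
            have : x0 = 0 := by simp [hx]
            subst this
            subst e3 e4
            have : y0 = x1 + y1 := by omega
            subst this
            nlinarith
          · subst h0
            have : y0 = 0 := by simp [hy]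
            subst this
            subst e3 e4
            have : x0 = x1 + y1 := by omega
            subst this
            nlinarith
        · left
          have h4 : 4 ≤ n0 * n0 := Nat.mul_le_mul h2 h2
          have : x0 * y0 = n0 * n0 * (α0 * β0) := by rw [hx, hy]; ring
          have : 4 * (α0 * β0) ≤ x0 * y0 := by rw [this]; exact Nat.mul_le_mul_right _ h4
          omega
      have hle0 := hle 0
      have hle1 := hle 1
      have hor : 2 ≤ n 0 ∨ 2 ≤ n 1 := by
        by_contra h
        have h0 : n 0 = 1 := by have := hn 0; omega
        have h1 : n 1 = 1 := by have := hn 1; omega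
        rw [h0, h1] at h3; omega
      rcases hor with h | h
      · have := key _ _ _ _ (n 0) (α 0) (β 0) h rfl rfl (hR 0) (hR 1) ha hb hcs
        omega
      · have := key _ _ _ _ (n 1) (α 1) (β 1) h rfl rfl (hR 1) (hR 0) (by omega) (by omega)
          (by omega)
        omega
  · have h3 : 3 * ∑ i, (n i * α i) * (n i * β i) ≤ a * b :=
      le_trans (Nat.mul_le_mul_right _ hr) hcs
    constructor
    · omega
    · intro _; omega

open Filter Topology in
lemma perturb {M : Type*} [NormedRing M] [StarRing M] [CStarRing M] [NormedAlgebra ℂ M]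
    [StarModule ℂ M] [FiniteDimensional ℂ M] [CompleteSpace M] (S1 : Submodule ℂ (M)) (π : M →ₗ[ℂ] M) (v : M)
    (hv : v ∈ unitary (M)) (ε : ℝ) (hε : 0 < ε) :
    ∃ u ∈ unitary (M), dist u v < ε ∧ ∀ K : M, ∀ X ∈ S1, π (star u * X * u) = 0 →
      ∃ Z ∈ S1, π (star u * (X * K - K * X) * u) = π (star u * Z * u) := by
  let L : M → (S1 →ₗ[ℂ] M) := fun u =>
    π ∘ₗ (LinearMap.mulLeftRight ℂ (star u, u)) ∘ₗ S1.subtype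
  have hL : ∀ u (X : S1), L u X = π (star u * X * u) := fun u X => rfl
  let f : M → ℕ := fun u => Module.finrank ℂ (LinearMap.range (L u))
  let T : Set (M) := {u | u ∈ unitary (M) ∧ dist u v < ε}
  obtain ⟨u, huT, hmax⟩ : ∃ u ∈ T, ∀ w ∈ T, f w ≤ f u := by
    have hne : (f '' T).Nonempty := ⟨f v, v, ⟨hv, by simpa using hε⟩, rfl⟩
    have hbd : BddAbove (f '' T) := ⟨Module.finrank ℂ (M), by
      rintro _ ⟨w, _, rfl⟩
      exact Submodule.finrank_le _⟩
    obtain ⟨u, hu, h⟩ := Nat.sSup_mem hne hbd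
    exact ⟨u, hu, fun w hw => h ▸ le_csSup hbd ⟨w, hw, rfl⟩⟩
  refine ⟨u, huT.1, huT.2, ?_⟩
  -- skew-adjoint case
  have hskew : ∀ K : M, star K = -K → ∀ X ∈ S1, π (star u * X * u) = 0 →
      ∃ Z ∈ S1, π (star u * (X * K - K * X) * u) = π (star u * Z * u) := by
    intro K hK X hX hX0
    by_contra hcon
    have hD : π (star u * (X * K - K * X) * u) ∉ LinearMap.range (L u) := by
      rintro ⟨Z, hZ⟩
      exact hcon ⟨Z, Z.2, by rw [← hZ, hL]⟩
    let b := Module.finBasis ℂ (LinearMap.range (L u))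
    have hx : ∀ i, ∃ x : S1, L u x = b i := fun i => (b i).2
    choose x hx using hx
    let w : ℝ → M := fun t => NormedSpace.exp (t • K) * u
    have hw0 : w 0 = u := by simp [w]
    have hE : HasDerivAt (fun t : ℝ => NormedSpace.exp (t • K)) K 0 := by
      have := hasDerivAt_exp_smul_const (𝕂 := ℝ) K (0 : ℝ)
      simpa using this
    have hder : ∀ Y : M, HasDerivAt (fun t => π (star (w t) * Y * w t))
        (π (star u * (Y * K - K * Y) * u)) 0 := by
      intro Y
      let F : M →L[ℂ] M := LinearMap.toContinuousLinearMap
        (π ∘ₗ (LinearMap.mulLeftRight ℂ (star u, u)))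
      have hF : ∀ Z, F Z = π (star u * Z * u) := fun Z => rfl
      have h1 := ((hE.star).mul_const Y).mul hE
      have h2 := ((F.restrictScalars ℝ).hasFDerivAt).comp_hasDerivAt (0 : ℝ) h1
      have e1 : (⇑(F.restrictScalars ℝ) ∘ ((fun t : ℝ => star (NormedSpace.exp (t • K)) * Y) *
          fun t : ℝ => NormedSpace.exp (t • K))) = fun t => π (star (w t) * Y * w t) := by
        funext t
        simp only [Function.comp, ContinuousLinearMap.coe_restrictScalars', hF, w, star_mul,
          Pi.mul_apply]
        congr 1
        noncomm_ring
      have e2 : (F.restrictScalars ℝ) (star K * Y * NormedSpace.exp ((0:ℝ) • K) +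
          star (NormedSpace.exp ((0:ℝ) • K)) * Y * K) = π (star u * (Y * K - K * Y) * u) := by
        simp only [ContinuousLinearMap.coe_restrictScalars', hF, zero_smul,
          NormedSpace.exp_zero, star_one, mul_one, one_mul, hK]
        congr 1
        noncomm_ring
      rw [← e1, ← e2]
      exact h2
    let d := Module.finrank ℂ (LinearMap.range (L u))
    let g : ℝ → Fin (d + 1) → M := fun t =>
      Fin.cons (t⁻¹ • π (star (w t) * X * w t)) (fun i => π (star (w t) * x i * w t))
    let g0 : Fin (d + 1) → M :=
      Fin.cons (π (star u * (X * K - K * X) * u)) (fun i => (b i : M))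
    have hg0 : LinearIndependent ℂ g0 := by
      rw [linearIndependent_finCons]
      constructor
      · exact b.linearIndependent.map' (LinearMap.range (L u)).subtype (Submodule.ker_subtype _)
      · intro hmem
        apply hD
        refine (Submodule.span_le.2 ?_) hmem
        rintro _ ⟨i, rfl⟩
        exact (b i).2
    have hlim : Tendsto g (𝓝[≠] 0) (𝓝 g0) := by
      rw [tendsto_pi_nhds]
      intro i
      refine Fin.cases ?_ (fun i => ?_) i
      · have := (hder X).tendsto_slope_zero
        simp only [zero_add, hw0, hX0, sub_zero] at this
        exact this
      · have := (hder (x i)).continuousAt.tendsto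
        simp only [hw0] at this
        rw [← hL, hx] at this
        exact this.mono_left nhdsWithin_le_nhds
    have hwT : ∀ᶠ t in 𝓝[≠] (0:ℝ), w t ∈ T := by
      have hc : ContinuousAt w 0 := (hE.mul_const u).continuousAt
      have : ∀ᶠ t in 𝓝 (0:ℝ), dist (w t) v < ε := by
        have hc' : Tendsto (fun t => dist (w t) v) (𝓝 0) (𝓝 (dist (w 0) v)) :=
          hc.tendsto.dist tendsto_const_nhds
        rw [hw0] at hc'
        exact hc'.eventually (gt_mem_nhds huT.2)
      filter_upwards [this.filter_mono nhdsWithin_le_nhds] with t ht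
      refine ⟨mul_mem ?_ huT.1, ht⟩
      let _ : NormedAlgebra ℚ M := NormedAlgebra.restrictScalars ℚ ℝ M
      apply NormedSpace.exp_mem_unitary_of_mem_skewAdjoint
      rw [skewAdjoint.mem_iff, star_smul, hK]
      simp
    obtain ⟨t, htT, hli⟩ := (hwT.and (hlim.eventually hg0.eventually)).exists
    have h1 : d + 1 ≤ f (w t) := by
      have := finrank_span_eq_card hli
      rw [Fintype.card_fin] at this
      rw [← this]
      refine Submodule.finrank_mono (Submodule.span_le.2 ?_)
      rintro _ ⟨i, rfl⟩
      refine Fin.cases ?_ (fun i => ?_) i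
      · show t⁻¹ • π (star (w t) * X * w t) ∈ LinearMap.range (L (w t))
        rw [← Complex.coe_smul]
        exact Submodule.smul_mem _ _ ⟨⟨X, hX⟩, rfl⟩
      · exact ⟨x i, rfl⟩
    have h2 := hmax _ htT
    have : f u = d := rfl
    omega
  intro K X hX hX0
  let K1 : M := (2⁻¹ : ℂ) • (K - star K)
  let K2 : M := (2⁻¹ : ℂ) • (Complex.I • (K + star K))
  have hK1 : star K1 = - K1 := by
    simp only [K1, star_smul, star_sub, star_star]
    rw [← smul_neg, neg_sub]; congr 1; simp
  have hK2 : star K2 = - K2 := by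
    simp only [K2, star_smul, star_add, star_star]
    rw [← smul_neg, ← neg_smul, add_comm]; congr 1
    · simp
    · simp
  have hK : K = K1 + (-Complex.I) • K2 := by
    simp only [K1, K2]
    rw [smul_comm (-Complex.I), smul_smul (-Complex.I)]
    simp only [neg_mul, Complex.I_mul_I, neg_neg, one_smul]
    rw [← smul_add]
    have : K - star K + (K + star K) = (2:ℂ) • K := by rw [two_smul]; abel
    rw [this, smul_smul]; simp
  obtain ⟨Z1, hZ1, h1⟩ := hskew K1 hK1 X hX hX0
  obtain ⟨Z2, hZ2, h2⟩ := hskew K2 hK2 X hX hX0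
  refine ⟨Z1 + (-Complex.I) • Z2, S1.add_mem hZ1 (S1.smul_mem _ hZ2), ?_⟩
  have e1 : star u * (X * K - K * X) * u = star u * (X * K1 - K1 * X) * u +
      (-Complex.I) • (star u * (X * K2 - K2 * X) * u) := by
    conv_lhs => rw [hK]
    simp only [mul_add, add_mul, mul_smul_comm, smul_mul_assoc, mul_sub, sub_mul, smul_sub]
    abel
  have e2 : star u * (Z1 + (-Complex.I) • Z2) * u = star u * Z1 * u +
      (-Complex.I) • (star u * Z2 * u) := by
    simp only [mul_add, add_mul, mul_smul_comm, smul_mul_assoc]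
  rw [e1, e2, map_add, map_add, map_smul, map_smul, h1, h2]

lemma exists_nontriv_idem {m : ℕ} (Y : BH m) (hY : IsSelfAdjoint Y) (hns : ∀ c : ℂ, Y ≠ c • (1 : BH m)) :
    ∃ P : BH m, P * P = P ∧ P ≠ 0 ∧ P ≠ 1 ∧ ∀ B : BH m, Y * B = B * Y → P * B = B * P := by
  have hfinC : (spectrum ℂ Y).Finite := by
    have := Module.End.finite_spectrum (K := ℂ) (Y : HS m →ₗ[ℂ] HS m)
    have e := AlgEquiv.spectrum_eq (Module.End.toContinuousLinearMap (𝕜 := ℂ) (HS m)) (Y : HS m →ₗ[ℂ] HS m)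
    have e2 : Module.End.toContinuousLinearMap (𝕜 := ℂ) (HS m) (Y : HS m →ₗ[ℂ] HS m) = Y := by
      ext; rfl
    rw [e2] at e
    rw [e]; exact this
  have hfin : (spectrum ℝ Y).Finite := by
    rw [← spectrum.preimage_algebraMap ℂ]
    exact hfinC.preimage (FaithfulSMul.algebraMap_injective ℝ ℂ).injOn
  have hcont : ∀ f : ℝ → ℝ, ContinuousOn f (spectrum ℝ Y) := fun f => hfin.continuousOn f
  have hex : ∃ a ∈ spectrum ℝ Y, ∃ b ∈ spectrum ℝ Y, a ≠ b := by
    by_contra hcon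
    push Not at hcon
    have : ∃ c : ℝ, ∀ a ∈ spectrum ℝ Y, a = c := by
      rcases (spectrum ℝ Y).eq_empty_or_nonempty with h | ⟨c, hc⟩
      · exact ⟨0, by simp [h]⟩
      · exact ⟨c, fun a ha => hcon a ha c hc⟩
    obtain ⟨c, hc⟩ := this
    apply hns (c : ℂ)
    have h1 : cfc (fun x : ℝ => x) Y = cfc (fun _ : ℝ => c) Y :=
      cfc_congr (fun x hx => hc x hx)
    rw [cfc_id' ℝ Y, cfc_const c Y] at h1
    rw [h1, Algebra.algebraMap_eq_smul_one]
    exact (Complex.coe_smul c (1 : BH m)).symm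
  obtain ⟨a, ha, b, hb, hab⟩ := hex
  let f : ℝ → ℝ := fun x => if x = a then 1 else 0
  refine ⟨cfc f Y, ?_, ?_, ?_, ?_⟩
  · rw [← cfc_mul f f Y (hcont _) (hcont _)]
    congr 1
    funext x
    simp [f]
  · intro h
    rw [← cfc_const_zero ℝ Y] at h
    have := (cfc_eq_cfc_iff_eqOn hY (hcont _) (hcont _)).1 h ha
    simp [f] at this
  · intro h
    rw [← cfc_const_one ℝ Y] at h
    have := (cfc_eq_cfc_iff_eqOn hY (hcont _) (hcont _)).1 h hb
    simp [f, Ne.symm hab] at this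
  · intro B hB
    exact hY.commute_cfc (b := B) hB f

lemma opRank_pos {m : ℕ} (P : BH m) (h : P ≠ 0) : 0 < opRank P := by
  unfold opRank
  rw [Module.finrank_pos_iff, Submodule.nontrivial_iff_ne_bot, Ne, LinearMap.range_eq_bot]
  intro h0
  exact h (ContinuousLinearMap.coe_injective (by simpa using h0))

/-- `B(H)` as the linear endomorphisms. -/
def toEnd (m : ℕ) : BH m ≃ₐ[ℂ] Module.End ℂ (HS m) :=
  (Module.End.toContinuousLinearMap (𝕜 := ℂ) (HS m)).symm

lemma opRank_eq {m : ℕ} (f : BH m) :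
    opRank f = Module.finrank ℂ (LinearMap.range (toEnd m f)) := rfl

lemma finrank_WSub_le {A : Type*} [NormedRing A] [StarRing A] [CStarRing A] [NormedAlgebra ℂ A]
    [FiniteDimensional ℂ A] {m : ℕ} (σ : A →ₐ[ℂ] BH m)
    (hRCP : ∀ p p' : A, IsMinCentralProjection p → IsMinCentralProjection p' →
      opRank (σ p) = opRank (σ p'))
    (P : BH m) (hP : P * P = P) (hP0 : P ≠ 0) (hP1 : P ≠ 1) (hc : ∀ a, P * σ a = σ a * P)
    (hd : 2 ≤ Module.finrank ℂ A) :
    2 * Module.finrank ℂ (WSub P σ) ≤ opRank P * opRank (1 - P) ∧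
    (3 ≤ Module.finrank ℂ A → 2 * Module.finrank ℂ (WSub P σ) < opRank P * opRank (1 - P)) := by
  obtain ⟨r, n, E, hE, hn, hdim, hmin, -⟩ := exists_MU A
  let τ : A →ₐ[ℂ] Module.End ℂ (HS m) := (toEnd m).toAlgHom.comp σ
  have hτ : ∀ a, τ a = toEnd m (σ a) := fun a => rfl
  have hE' : MU (fun i j k => τ (E i j k)) := by
    refine ⟨?_, ?_, ?_, ?_⟩
    · intro i j k l; rw [← map_mul, hE.mul_same]
    · intro i j k k' l h; rw [← map_mul, hE.mul_ne _ _ _ _ _ h, map_zero]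
    · intro i i' j k j' k' h; rw [← map_mul, hE.mul_ne' _ _ _ _ _ _ h, map_zero]
    · simp only [← map_sum, hE.sum_one, map_one]
  obtain ⟨α, β, hW, ha, hb, hR⟩ := hE'.count hn (toEnd m P) (by rw [← map_mul, hP])
    (fun i j k => by rw [hτ, ← map_mul, ← map_mul, hc])
  rw [← map_one (toEnd m), ← map_sub, ← opRank_eq] at hb
  rw [← opRank_eq] at ha
  have hPpos := opRank_pos P hP0
  have hQpos := opRank_pos (1 - P) (sub_ne_zero.2 (Ne.symm hP1))
  have hr : 0 < r := by
    rcases Nat.eq_zero_or_pos r with h | h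
    · subst h; simp at ha; omega
    · exact h
  have hle : Module.finrank ℂ (WSub P σ) ≤ ∑ i, α i * β i := by
    rw [← hW, ← LinearEquiv.finrank_map_eq (toEnd m).toLinearEquiv]
    refine Submodule.finrank_mono ?_
    rintro _ ⟨Y, ⟨h1, h2⟩, rfl⟩
    refine ⟨?_, fun x => ?_⟩
    · change toEnd m P * toEnd m Y * (1 - toEnd m P) = toEnd m Y
      rw [← map_one (toEnd m), ← map_sub, ← map_mul, ← map_mul, h1]
    · change toEnd m Y * toEnd m (σ _) = toEnd m (σ _) * toEnd m Y
      rw [← map_mul, ← map_mul, h2]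
  have hbd := arith_bound n α β hn (opRank (σ (∑ j, E ⟨0, hr⟩ j j))) _ _ ha hb (by
    intro i
    rw [hR i, ← map_sum, hτ, ← opRank_eq]
    exact hRCP _ _ (hmin _) (hmin _)) hPpos hQpos (by rw [← hdim]; exact hd)
  rw [← hdim] at hbd
  exact ⟨by omega, fun h => by have := hbd.2 h; omega⟩

lemma finrank_corner {m : ℕ} (P Q : BH m) (hP : P * P = P) (hQ : Q * Q = Q) :
    Module.finrank ℂ (LinearMap.range (LinearMap.mulLeftRight ℂ (P, Q))) = opRank P * opRank Q := by
  have hP' : toEnd m P * toEnd m P = toEnd m P := by rw [← map_mul, hP]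
  have hQ' : toEnd m Q * toEnd m Q = toEnd m Q := by rw [← map_mul, hQ]
  have hid : IsIdempotentElem (LinearMap.mulLeftRight ℂ (toEnd m P, toEnd m Q)) := by
    refine LinearMap.ext fun T => ?_
    rw [Module.End.mul_apply]
    simp only [LinearMap.mulLeftRight_apply]
    calc _ = (toEnd m P * toEnd m P) * T * (toEnd m Q * toEnd m Q) := by simp only [mul_assoc]
      _ = _ := by rw [hP', hQ']
  have h1 := (LinearMap.IsIdempotentElem.isProj_range _ hid).trace
  rw [trace_mulLR, idem_trace _ hP', idem_trace _ hQ'] at h1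
  have h2 : Module.finrank ℂ (LinearMap.range (LinearMap.mulLeftRight ℂ (P, Q))) =
      Module.finrank ℂ (LinearMap.range (LinearMap.mulLeftRight ℂ (toEnd m P, toEnd m Q))) := by
    rw [← LinearEquiv.finrank_map_eq (toEnd m).toLinearEquiv]
    suffices key : Submodule.map ((toEnd m).toLinearEquiv : BH m →ₗ[ℂ] Module.End ℂ (HS m))
        (LinearMap.range (LinearMap.mulLeftRight ℂ (P, Q))) =
        LinearMap.range (LinearMap.mulLeftRight ℂ (toEnd m P, toEnd m Q))  by
      rw [key]
    ext Z
    constructor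
    · rintro ⟨_, ⟨T, rfl⟩, rfl⟩
      exact ⟨toEnd m T, by simp⟩
    · rintro ⟨T, rfl⟩
      refine ⟨_, ⟨(toEnd m).symm T, rfl⟩, ?_⟩
      simp
  rw [h2, opRank_eq, opRank_eq]
  exact_mod_cast h1.symm

lemma opRank_conj {m : ℕ} (u f : BH m) (hu : u ∈ unitary (BH m)) (hf : f * f = f) :
    opRank (u * f * star u) = opRank f := by
  have hu1 : star u * u = 1 := Unitary.star_mul_self_of_mem hu
  have hg : (u * f * star u) * (u * f * star u) = u * f * star u := by
    calc _ = u * f * (star u * u) * f * star u := by simp only [mul_assoc]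
      _ = _ := by rw [hu1, mul_one, mul_assoc u, hf]
  have h1 := idem_trace (toEnd m f) (by rw [← map_mul, hf])
  have h2 := idem_trace (toEnd m (u * f * star u)) (by rw [← map_mul, hg])
  have h3 : LinearMap.trace ℂ (HS m) (toEnd m (u * f * star u)) =
      LinearMap.trace ℂ (HS m) (toEnd m f) := by
    rw [map_mul (toEnd m), LinearMap.trace_mul_comm, ← map_mul (toEnd m), ← mul_assoc, hu1,
      one_mul]
  rw [h3, h1] at h2
  rw [opRank_eq, opRank_eq]
  exact_mod_cast h2.symm

/-- The commutant as a submodule. -/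
def commSub {m : ℕ} (S : Set (BH m)) : Submodule ℂ (BH m) where
  carrier := commutantSet S
  add_mem' := by
    intro a b ha hb s hs
    rw [add_mul, mul_add, ha s hs, hb s hs]
  zero_mem' := by intro s _; simp
  smul_mem' := by
    intro c a ha s hs
    rw [smul_mul_assoc, mul_smul_comm, ha s hs]

lemma exists_ker_eq {M : Type*} [AddCommGroup M] [Module ℂ M] (S : Submodule ℂ M) :
    ∃ π : M →ₗ[ℂ] M, ∀ x, π x = 0 ↔ x ∈ S := by
  obtain ⟨T, hT⟩ := S.exists_isCompl
  refine ⟨T.subtype ∘ₗ T.projectionOnto S hT.symm, fun x => ?_⟩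
  simp


lemma WSub_compress {R : Type*} [Ring R] [Algebra ℂ R] (P : R) (hP : P * P = P) {ι : Type*}
    (τ : ι → R) (hτ : ∀ a, P * τ a = τ a * P) (Z : R) (hZ : ∀ a, Z * τ a = τ a * Z) :
    P * Z * (1 - P) ∈ WSub P τ := by
  have hQ : (1 - P) * (1 - P) = 1 - P := by rw [mul_sub, sub_mul, sub_mul, hP]; simp
  constructor
  · calc _ = (P * P) * Z * ((1 - P) * (1 - P)) := by simp only [mul_assoc]
      _ = _ := by rw [hP, hQ]
  · intro a
    have hQτ : (1 - P) * τ a = τ a * (1 - P) := by rw [sub_mul, mul_sub, hτ]; simp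
    rw [mul_assoc, hQτ, ← mul_assoc, mul_assoc P, hZ, ← mul_assoc, hτ]
    simp only [mul_assoc]

lemma selfAdjoint_I_smul {R : Type*} [Ring R] [StarRing R] [Algebra ℂ R] [StarModule ℂ R] (X : R) :
    IsSelfAdjoint (Complex.I • (X - star X)) := by
  rw [IsSelfAdjoint, star_smul, star_sub, star_star, ← neg_sub X, smul_neg, ← neg_smul]
  simp

lemma scalar_of_parts {R : Type*} [Ring R] [StarRing R] [Algebra ℂ R] (X : R) (c d : ℂ)
    (hc : X + star X = c • (1 : R)) (hd : Complex.I • (X - star X) = d • (1 : R)) :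
    ∃ k : ℂ, X = k • (1 : R) := by
  refine ⟨2⁻¹ * (c + (-Complex.I) * d), ?_⟩
  rw [mul_smul, add_smul, mul_smul, ← hc, ← hd, smul_smul]
  have : -Complex.I * Complex.I = 1 := by simp
  rw [this, one_smul]
  have : X + star X + (X - star X) = (2 : ℂ) • X := by rw [two_smul]; abel
  rw [this, smul_smul]; simp


/-- If `ρ_1, ρ_2` are unital *-representations of finite-dimensional C*-algebras `A1, A2`
(with `(dim A1 − 1)(dim A2 − 1) ≥ 2`) on a finite-dimensional Hilbert space `H`
satisfying the RCP condition, then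
`{ u ∈ U(H) : ρ1(A1)' ∩ u ρ2(A2)' u* = ℂ·1 }` is dense in `U(H)`. -/
theorem RCP_implies_DPI
    (A1 : Type*) [NormedRing A1] [StarRing A1] [CStarRing A1] [NormedAlgebra ℂ A1]
      [StarModule ℂ A1] [FiniteDimensional ℂ A1]
    (A2 : Type*) [NormedRing A2] [StarRing A2] [CStarRing A2] [NormedAlgebra ℂ A2]
      [StarModule ℂ A2] [FiniteDimensional ℂ A2]
    (hdim : 2 ≤ (Module.finrank ℂ A1 - 1) * (Module.finrank ℂ A2 - 1))
    (m : ℕ) (hm : 0 < m)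
    (ρ1 : A1 →⋆ₐ[ℂ] BH m) (ρ2 : A2 →⋆ₐ[ℂ] BH m)
    (hRCP1 : ∀ p p' : A1, IsMinCentralProjection p → IsMinCentralProjection p' →
      opRank (ρ1 p) = opRank (ρ1 p'))
    (hRCP2 : ∀ p p' : A2, IsMinCentralProjection p → IsMinCentralProjection p' →
      opRank (ρ2 p) = opRank (ρ2 p')) :
    ∀ v ∈ unitary (BH m),
      v ∈ closure {u : BH m | u ∈ unitary (BH m) ∧
        commutantSet (Set.range (ρ1 : A1 → BH m)) ∩
            ((fun x => u * x * star u) '' commutantSet (Set.range (ρ2 : A2 → BH m))) =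
          Set.range (fun c : ℂ => c • (1 : BH m))} := by
  intro v hv
  rw [Metric.mem_closure_iff]
  intro ε hε
  obtain ⟨π, hπ⟩ := exists_ker_eq (commSub (Set.range (ρ2 : A2 → BH m)))
  obtain ⟨u, hu, huv, hper⟩ := perturb (commSub (Set.range (ρ1 : A1 → BH m))) π v hv ε hε
  refine ⟨u, ⟨hu, ?_⟩, by rwa [dist_comm]⟩
  have hu1 : star u * u = 1 := Unitary.star_mul_self_of_mem hu
  have hu2 : u * star u = 1 := Unitary.mul_star_self_of_mem hu
  let σ2 : A2 →ₐ[ℂ] BH m :=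
    ((Unitary.conjStarAlgAut ℂ (BH m) ⟨u, hu⟩ : BH m ≃⋆ₐ[ℂ] BH m) : BH m →⋆ₐ[ℂ] BH m).toAlgHom.comp
      ρ2.toAlgHom
  have hσ2 : ∀ a, σ2 a = u * ρ2 a * star u := fun a => rfl
  have hconj : ∀ Y r : BH m, star u * Y * u * r = r * (star u * Y * u) ↔
      Y * (u * r * star u) = (u * r * star u) * Y := by
    intro Y r
    have e1 : u * (star u * Y * u * r) * star u = Y * (u * r * star u) := by
      calc _ = (u * star u) * Y * (u * r * star u) := by simp only [mul_assoc]
        _ = _ := by rw [hu2, one_mul]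
    have e2 : u * (r * (star u * Y * u)) * star u = (u * r * star u) * Y := by
      calc _ = (u * r * star u) * Y * (u * star u) := by simp only [mul_assoc]
        _ = _ := by rw [hu2, mul_one]
    constructor
    · intro h
      rw [← e1, ← e2, h]
    · intro h
      rw [← e1, ← e2] at h
      have h' := congrArg (fun x => star u * x * u) h
      have e3 : ∀ x : BH m, star u * (u * x * star u) * u = x := by
        intro x
        calc _ = (star u * u) * x * (star u * u) := by simp only [mul_assoc]
          _ = _ := by rw [hu1, one_mul, mul_one]
      simpa only [e3] using h'
  have hN2 : ∀ Y : BH m, (star u * Y * u ∈ commSub (Set.range (ρ2 : A2 → BH m))) ↔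
      ∀ a, Y * σ2 a = σ2 a * Y := by
    intro Y
    constructor
    · intro h a
      rw [hσ2, ← hconj]
      exact h _ ⟨a, rfl⟩
    · rintro h _ ⟨a, rfl⟩
      rw [hconj]
      exact h a
  have hσstar : ∀ a, star (σ2 a) = σ2 (star a) := by
    intro a
    rw [hσ2, hσ2, star_mul, star_mul, star_star, map_star, mul_assoc]
  have hd1 : 2 ≤ Module.finrank ℂ A1 := by
    by_contra h
    have : Module.finrank ℂ A1 - 1 = 0 := by omega
    rw [this] at hdim; omega
  have hd2 : 2 ≤ Module.finrank ℂ A2 := by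
    by_contra h
    have : Module.finrank ℂ A2 - 1 = 0 := by omega
    rw [this] at hdim; omega
  have hd3 : 3 ≤ Module.finrank ℂ A1 ∨ 3 ≤ Module.finrank ℂ A2 := by
    by_contra h
    have h1 : Module.finrank ℂ A1 - 1 = 1 := by omega
    have h2 : Module.finrank ℂ A2 - 1 = 1 := by omega
    rw [h1, h2] at hdim; omega
  have hmain : ∀ Y : BH m, IsSelfAdjoint Y → (∀ a, Y * ρ1 a = ρ1 a * Y) →
      (∀ a, Y * σ2 a = σ2 a * Y) → ∃ c : ℂ, Y = c • (1 : BH m) := by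
    intro Y hY hY1 hY2
    by_contra hcon
    push Not at hcon
    obtain ⟨P, hP, hP0, hP1, hPc⟩ := exists_nontriv_idem Y hY hcon
    have hPρ : ∀ a, P * ρ1 a = ρ1 a * P := fun a => hPc _ (hY1 a)
    have hPσ : ∀ a, P * σ2 a = σ2 a * P := fun a => hPc _ (hY2 a)
    have hQ : (1 - P) * (1 - P) = 1 - P := by rw [mul_sub, sub_mul, sub_mul, hP]; simp
    have hQP : (1 - P) * P = 0 := by rw [sub_mul, hP]; simp
    have hb1 := finrank_WSub_le ρ1.toAlgHom hRCP1 P hP hP0 hP1 hPρ hd1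
    have hb2 := finrank_WSub_le σ2 (by
      intro p p' hp hp'
      rw [hσ2, hσ2, opRank_conj _ _ hu (by rw [← map_mul, hp.2.2.1]),
        opRank_conj _ _ hu (by rw [← map_mul, hp'.2.2.1])]
      exact hRCP2 p p' hp hp') P hP hP0 hP1 hPσ hd2
    have hcorner := finrank_corner P (1 - P) hP hQ
    have hle : LinearMap.range (LinearMap.mulLeftRight ℂ (P, 1 - P)) ≤
        WSub P ρ1.toAlgHom ⊔ WSub P σ2 := by
      rintro _ ⟨T, rfl⟩
      have hPm : P ∈ commSub (Set.range (ρ1 : A1 → BH m)) := by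
        rintro _ ⟨a, rfl⟩; exact hPρ a
      obtain ⟨Z, hZ, hZeq⟩ := hper (P * T * (1 - P)) P hPm ((hπ _).2 ((hN2 P).2 hPσ))
      have e1 : P * (P * T * (1 - P)) - P * T * (1 - P) * P = P * T * (1 - P) := by
        rw [mul_assoc (P * T), hQP, mul_zero, sub_zero, ← mul_assoc, ← mul_assoc, hP]
      rw [e1, ← sub_eq_zero, ← map_sub, hπ, ← sub_mul, ← mul_sub, hN2] at hZeq
      have hZ1 : ∀ a, Z * ρ1 a = ρ1 a * Z := fun a => hZ _ ⟨a, rfl⟩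
      have m1 := WSub_compress P hP (ρ1 : A1 → BH m) hPρ Z hZ1
      have m2 := WSub_compress P hP (σ2 : A2 → BH m) hPσ _ hZeq
      have e2 : LinearMap.mulLeftRight ℂ (P, 1 - P) T =
          P * Z * (1 - P) + P * (P * T * (1 - P) - Z) * (1 - P) := by
        have e3 : P * (P * T * (1 - P)) * (1 - P) = P * T * (1 - P) := by
          rw [← mul_assoc, ← mul_assoc, hP, mul_assoc, hQ]
        rw [mul_sub P (P * T * (1 - P)) Z, sub_mul _ _ (1 - P), e3, LinearMap.mulLeftRight_apply]
        abel
      rw [e2]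
      exact Submodule.add_mem_sup m1 m2
    have h1 := Submodule.finrank_mono hle
    have h2 := Submodule.finrank_add_le_finrank_add_finrank (WSub P ρ1.toAlgHom) (WSub P σ2)
    rw [hcorner] at h1
    rcases hd3 with h | h
    · have := hb1.2 h; have := hb2.1; omega
    · have := hb2.2 h; have := hb1.1; omega
  apply Set.Subset.antisymm
  · rintro X ⟨hX1, x, hx, rfl⟩
    have hXx : star u * (u * x * star u) * u = x := by
      calc _ = (star u * u) * x * (star u * u) := by simp only [mul_assoc]
        _ = _ := by rw [hu1, one_mul, mul_one]
    have hXρ : ∀ a, (u * x * star u) * ρ1 a = ρ1 a * (u * x * star u) := fun a => hX1 _ ⟨a, rfl⟩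
    have hXσ : ∀ a, (u * x * star u) * σ2 a = σ2 a * (u * x * star u) := by
      rw [← hN2, hXx]; exact hx
    show u * x * star u ∈ _
    generalize u * x * star u = X at hXρ hXσ
    have hXρ' : ∀ a, star X * ρ1 a = ρ1 a * star X := by
      intro a
      have := congrArg star (hXρ (star a))
      rw [star_mul, star_mul, map_star, star_star] at this
      exact this.symm
    have hXσ' : ∀ a, star X * σ2 a = σ2 a * star X := by
      intro a
      have := congrArg star (hXσ (star a))
      rw [star_mul, star_mul, ← hσstar, star_star] at this
      exact this.symm
    obtain ⟨c, hc⟩ := hmain (X + star X) (IsSelfAdjoint.add_star_self X)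
      (fun a => by rw [add_mul, mul_add, hXρ, hXρ']) (fun a => by rw [add_mul, mul_add, hXσ, hXσ'])
    obtain ⟨d, hd⟩ := hmain (Complex.I • (X - star X)) (selfAdjoint_I_smul X)
      (fun a => by rw [smul_mul_assoc, mul_smul_comm, sub_mul, mul_sub, hXρ, hXρ'])
      (fun a => by rw [smul_mul_assoc, mul_smul_comm, sub_mul, mul_sub, hXσ, hXσ'])
    obtain ⟨k, hk⟩ := scalar_of_parts X c d hc hd
    exact ⟨k, hk.symm⟩
  · rintro _ ⟨c, rfl⟩
    refine ⟨?_, c • 1, ?_, ?_⟩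
    · intro s _; simp
    · intro s _; simp
    · show u * (c • 1) * star u = c • 1
      rw [mul_smul_comm, smul_mul_assoc, mul_one, hu2]
end
end
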